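/- Inhomogeneous Strichartz estimate in Lorentz spaces: for n ∈ ℕ, 2 ≤ p, r < 2*, an interval I with t₀ ∈ Ī, and A_S f(t) = ∫_{t₀}^t e^{i(t−τ)Δ} f(τ) dτ, one has ‖A_S f‖_{L^{γ(p)}(I, L^{p,2})} ≲ ‖f‖_{L^{γ(r)'}(I, L^{r',2})}, where 1/γ(q) = (n/2)(1/2 − 1/q) and primes denote Hölder conjugates. -/

import Mathlib

open MeasureTheory ENNReal Set Filter

noncomputable section

abbrev Rn (n : ℕ) := EuclideanSpace ℝ (Fin n)

/-- Decreasing rearrangement of `f` with respect to `μ`. -/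
def rearrangement {α : Type*} [MeasurableSpace α] (μ : Measure α)
    {E : Type*} [NNNorm E] (f : α → E) (t : ℝ) : ℝ≥0∞ :=
  sInf {l : ℝ≥0∞ | μ {x | l < (‖f x‖₊ : ℝ≥0∞)} ≤ ENNReal.ofReal t}

/-- Lorentz quasinorm `‖f‖_{L^{p,q}}` defined via the decreasing rearrangement. -/
def lorentzNorm {α : Type*} [MeasurableSpace α] {E : Type*} [NNNorm E]
    (μ : Measure α) (p q : ℝ≥0∞) (f : α → E) : ℝ≥0∞ :=
  if q = ∞ then ⨆ t ∈ Ioi (0:ℝ), ENNReal.ofReal (t ^ p.toReal⁻¹) * rearrangement μ f t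
  else (∫⁻ t in Ioi (0:ℝ),
      (ENNReal.ofReal (t ^ p.toReal⁻¹) * rearrangement μ f t) ^ q.toReal
        * ENNReal.ofReal t⁻¹) ^ q.toReal⁻¹

/-- `‖f‖_{L^{p,2}(ℝ^n)}`. -/
def lornorm (n : ℕ) (p : ℝ) (f : Rn n → ℂ) : ℝ≥0∞ :=
  lorentzNorm volume (ENNReal.ofReal p) 2 f

/-- The free Schrödinger propagator `e^{itΔ}` on `ℝ^n`, given by convolution with
`(4πit)^{-n/2} e^{i|x|²/(4t)}`. -/
def schrodinger (n : ℕ) (t : ℝ) (f : Rn n → ℂ) : Rn n → ℂ := fun x =>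
  (4 * (Real.pi : ℂ) * Complex.I * (t : ℂ)) ^ (-(n : ℂ) / 2) *
    ∫ y : Rn n, Complex.exp (Complex.I * ((‖x - y‖ : ℂ)) ^ 2 / (4 * (t : ℂ))) * f y

/-- The Strichartz exponent `γ(p)` with `1/γ(p) = (n/2)(1/2 - 1/p)` (so `γ(2) = ∞`). -/
def gam (n : ℕ) (p : ℝ) : ℝ≥0∞ := (ENNReal.ofReal ((n / 2 : ℝ) * (1/2 - 1/p)))⁻¹

/-- Hölder conjugate of an extended-real exponent. -/
def conjE (p : ℝ≥0∞) : ℝ≥0∞ := (1 - p⁻¹)⁻¹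

/-- Mixed space-time norm `‖f‖_{L^γ(I, X)}` given the map `t ↦ ‖f(t)‖_X`. -/
def timeNorm (γ : ℝ≥0∞) (I : Set ℝ) (N : ℝ → ℝ≥0∞) : ℝ≥0∞ :=
  if γ = ∞ then essSup N (volume.restrict I)
  else (∫⁻ t in I, N t ^ γ.toReal) ^ γ.toReal⁻¹

/-- `2 ≤ p < 2*` where `2* = 2n/(n-2)` for `n ≥ 3` and `2* = ∞` for `n = 1, 2`. -/
def subcrit (n : ℕ) (p : ℝ) : Prop := 2 ≤ p ∧ (3 ≤ n → p < 2 * n / (n - 2))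

/-- Duhamel operator `A_S f (t) = ∫_{t₀}^t e^{i(t-τ)Δ} f(τ) dτ`. -/
def duhamel (n : ℕ) (t₀ : ℝ) (f : ℝ → Rn n → ℂ) (t : ℝ) : Rn n → ℂ :=
  fun x => ∫ τ in t₀..t, schrodinger n (t - τ) (f τ) x

/-- The inhomogeneous nonlinearity `|x|^{-b} |u|^σ u`. -/
def nonlin (n : ℕ) (b σ : ℝ) (u : Rn n → ℂ) : Rn n → ℂ := fun x =>
  Complex.ofReal (‖x‖ ^ (-b)) * (Complex.ofReal (‖u x‖ ^ σ) * u x)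

/-- Laplacian on `ℝ^n` of a complex-valued function. -/
def lap (n : ℕ) (f : Rn n → ℂ) (x : Rn n) : ℂ :=
  ∑ i : Fin n, fderiv ℝ (fun y => fderiv ℝ f y (EuclideanSpace.single i 1)) x
    (EuclideanSpace.single i 1)

/-- `u` solves `i ∂_t u + Δ u = λ |x|^{-b} |u|^σ u` classically away from `x = 0`. -/
def solvesINLS (n : ℕ) (b σ : ℝ) (lam : ℂ) (u : ℝ → Rn n → ℂ) : Prop :=
  ∀ t : ℝ, ∀ x : Rn n, x ≠ 0 →
    Complex.I * deriv (fun s => u s x) t + lap n (u t) x =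
      lam * Complex.ofReal (‖x‖ ^ (-b)) * (Complex.ofReal (‖u t x‖ ^ σ) * u t x)

/-- Peetre K-functional for the couple `(L²(ℝ^n), L^r(ℝ^n))`. -/
def Kfun (n : ℕ) (r : ℝ) (t : ℝ) (f : Rn n → ℂ) : ℝ≥0∞ :=
  ⨅ g : Rn n → ℂ,
    eLpNorm g 2 volume + ENNReal.ofReal t * eLpNorm (f - g) (ENNReal.ofReal r) volume

/-- Real interpolation norm for `(L², L^r)_{θ,2}` by the K-method. -/
def interpNorm (n : ℕ) (r θ : ℝ) (f : Rn n → ℂ) : ℝ≥0∞ :=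
  (∫⁻ t in Ioi (0:ℝ), (ENNReal.ofReal (t ^ (-θ)) * Kfun n r t f) ^ (2:ℝ)
    * ENNReal.ofReal t⁻¹) ^ ((2:ℝ)⁻¹)

/-- `u` is a solution of the Duhamel equation for INLS with data `u₀` on the time set `I`,
belonging to `L^{γ(r)}(I, L^{r,2})`. -/
def IsSolOn (n : ℕ) (b σ r : ℝ) (lam : ℂ) (u₀ : Rn n → ℂ) (I : Set ℝ)
    (u : ℝ → Rn n → ℂ) : Prop :=
  Measurable (fun q : ℝ × Rn n => u q.1 q.2) ∧
  timeNorm (gam n r) I (fun t => lornorm n r (u t)) < ∞ ∧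
  ∀ t ∈ I, ∀ᵐ x : Rn n ∂volume, u t x = schrodinger n t u₀ x -
    Complex.I * lam * duhamel n 0 (fun τ => nonlin n b σ (u τ)) t x

end

section Rearrangement

/-- The indicator of `a < b`. -/
noncomputable def ltInd (a b : ℝ≥0∞) : ℝ≥0∞ := if a < b then 1 else 0

lemma measurable_ltInd : Measurable (fun z : ℝ≥0∞ × ℝ≥0∞ => ltInd z.1 z.2) :=
  Measurable.ite (measurableSet_lt measurable_fst measurable_snd) measurable_const measurable_const

@[fun_prop]
lemma Measurable.ltInd {α : Type*} [MeasurableSpace α] {f g : α → ℝ≥0∞} (hf : Measurable f)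
    (hg : Measurable g) : Measurable (fun x => _root_.ltInd (f x) (g x)) :=
  measurable_ltInd.comp (hf.prodMk hg)

lemma setOf_ofReal_lt_inter (v : ℝ) :
    {a : ℝ | ENNReal.ofReal a < ENNReal.ofReal v} ∩ Ioi 0 = Ioo 0 v := by
  ext a
  simp only [mem_inter_iff, mem_ofPred_eq, mem_Ioi, mem_Ioo]
  constructor
  · rintro ⟨h, h0⟩
    exact ⟨h0, ((ENNReal.ofReal_lt_ofReal_iff_of_nonneg h0.le).1 h)⟩
  · rintro ⟨h0, h⟩
    exact ⟨(ENNReal.ofReal_lt_ofReal_iff_of_nonneg h0.le).2 h, h0⟩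

lemma lintegral_mul_ltInd_ofReal (h : ℝ → ℝ≥0∞) (v : ℝ) :
    ∫⁻ a in Ioi (0:ℝ), h a * ltInd (ENNReal.ofReal a) (ENNReal.ofReal v)
      = ∫⁻ a in Ioo 0 v, h a := by
  have hm : MeasurableSet {a : ℝ | ENNReal.ofReal a < ENNReal.ofReal v} :=
    measurableSet_lt (by fun_prop) measurable_const
  rw [← setOf_ofReal_lt_inter, ← Measure.restrict_restrict hm, ← lintegral_indicator hm]
  refine lintegral_congr fun a => ?_
  by_cases ha : ENNReal.ofReal a < ENNReal.ofReal v
  · rw [indicator_of_mem (by exact ha)]; simp [ltInd, ha]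
  · rw [indicator_of_notMem (by exact ha)]; simp [ltInd, ha]

lemma lintegral_ltInd (v : ℝ≥0∞) : ∫⁻ a in Ioi (0:ℝ), ltInd (ENNReal.ofReal a) v = v := by
  induction v with
  | top => simp [ltInd]
  | coe v =>
    have := lintegral_mul_ltInd_ofReal (fun _ => 1) v
    simpa using this

lemma lintegral_lintegral_ltInd (v w : ℝ≥0∞) :
    ∫⁻ a in Ioi (0:ℝ), ∫⁻ b in Ioi (0:ℝ),
      ltInd (ENNReal.ofReal a) v * ltInd (ENNReal.ofReal b) w = v * w := by
  calc _ = ∫⁻ a in Ioi (0:ℝ), ltInd (ENNReal.ofReal a) v * w :=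
        lintegral_congr fun a => by rw [lintegral_const_mul _ (by fun_prop), lintegral_ltInd]
    _ = _ := by rw [lintegral_mul_const _ (by fun_prop), lintegral_ltInd]

lemma lintegral_two_mul_ltInd (v : ℝ≥0∞) :
    ∫⁻ a in Ioi (0:ℝ), ENNReal.ofReal (2 * a) * ltInd (ENNReal.ofReal a) v = v ^ 2 := by
  have key : ∀ v : NNReal,
      ∫⁻ a in Ioi (0:ℝ), ENNReal.ofReal (2 * a) * ltInd (ENNReal.ofReal a) v = v ^ 2 := by
    intro v
    have h1 := lintegral_mul_ltInd_ofReal (fun a => ENNReal.ofReal (2 * a)) v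
    rw [ENNReal.ofReal_coe_nnreal] at h1
    rw [h1, restrict_Ioo_eq_restrict_Ioc, ← ofReal_integral_eq_lintegral_ofReal,
      ← intervalIntegral.integral_of_le (NNReal.coe_nonneg v)]
    · rw [intervalIntegral.integral_const_mul, integral_id]
      rw [← ENNReal.ofReal_coe_nnreal, ← ENNReal.ofReal_pow (NNReal.coe_nonneg v)]
      congr 1; ring
    · exact (Continuous.integrableOn_Ioc (by fun_prop))
    · filter_upwards [self_mem_ae_restrict measurableSet_Ioc] with a ha
      have := ha.1
      simp only [Pi.zero_apply]; positivity
  induction v with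
  | coe v => exact key v
  | top =>
    rw [ENNReal.top_pow two_ne_zero]
    refine ENNReal.eq_top_of_forall_nnreal_le fun r => ?_
    calc (r : ℝ≥0∞) ≤ ((r + 1 : NNReal) : ℝ≥0∞) ^ 2 := by
          norm_cast; have := r.2; nlinarith [show (0:NNReal) ≤ r from zero_le]
      _ = _ := (key _).symm
      _ ≤ _ := by
          gcongr with a
          simp only [ltInd]
          split_ifs <;> simp_all

variable {X : Type*} [MeasurableSpace X]

/-- Decreasing rearrangement of an extended nonnegative function. -/
noncomputable def rearr (μ : Measure X) (u : X → ℝ≥0∞) (t : ℝ) : ℝ≥0∞ :=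
  sInf {l : ℝ≥0∞ | μ {x | l < u x} ≤ ENNReal.ofReal t}

/-- The Lorentz quasinorm with second exponent `2` of an extended nonnegative function. -/
noncomputable def lor (μ : Measure X) (q : ℝ) (u : X → ℝ≥0∞) : ℝ≥0∞ :=
  (∫⁻ t in Ioi (0:ℝ), ENNReal.ofReal t ^ (2 / q - 1) * rearr μ u t ^ 2) ^ (1 / 2 : ℝ)

lemma measure_rearr_lt_le (μ : Measure X) (u : X → ℝ≥0∞) (t : ℝ) :
    μ {x | rearr μ u t < u x} ≤ ENNReal.ofReal t := by
  set S := {l : ℝ≥0∞ | μ {x | l < u x} ≤ ENNReal.ofReal t} with hS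
  have hne : S.Nonempty := ⟨⊤, by simp [hS]⟩
  obtain ⟨l, hl, hlim, hmem⟩ := exists_seq_tendsto_sInf hne (OrderBot.bddBelow S)
  have hsub : {x | rearr μ u t < u x} = ⋃ k, {x | l k < u x} := by
    ext x
    simp only [mem_ofPred_eq, mem_iUnion]
    constructor
    · intro hx
      exact (hlim.eventually (gt_mem_nhds hx)).exists
    · rintro ⟨k, hk⟩
      exact lt_of_le_of_lt (sInf_le (hmem k)) hk
  rw [hsub, (Monotone.directed_le ?_).measure_iUnion]
  · exact iSup_le hmem
  · intro i j hij x (hx : l i < u x)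
    exact lt_of_le_of_lt (hl hij) hx

lemma lt_rearr_iff (μ : Measure X) (u : X → ℝ≥0∞) (t : ℝ) (l : ℝ≥0∞) :
    l < rearr μ u t ↔ ENNReal.ofReal t < μ {x | l < u x} := by
  constructor
  · intro h
    by_contra! h2
    exact absurd (sInf_le (show l ∈ {l | μ {x | l < u x} ≤ ENNReal.ofReal t} from h2)) (not_le.2 h)
  · intro h
    by_contra! h2
    refine absurd ((measure_mono ?_).trans (measure_rearr_lt_le μ u t)) (not_le.2 h)
    intro x (hx : l < u x)
    exact lt_of_le_of_lt h2 hx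

lemma rearr_le_of_measure_le {μ : Measure X} {u : X → ℝ≥0∞} {t : ℝ} {l : ℝ≥0∞}
    (h : μ {x | l < u x} ≤ ENNReal.ofReal t) : rearr μ u t ≤ l := sInf_le h

lemma ltInd_rearr (μ : Measure X) (u : X → ℝ≥0∞) (t : ℝ) (l : ℝ≥0∞) :
    ltInd l (rearr μ u t) = ltInd (ENNReal.ofReal t) (μ {x | l < u x}) := by
  simp only [ltInd, lt_rearr_iff]

lemma rearr_mono {μ : Measure X} {u v : X → ℝ≥0∞} (h : ∀ᵐ x ∂μ, u x ≤ v x) (t : ℝ) :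
    rearr μ u t ≤ rearr μ v t := by
  refine rearr_le_of_measure_le (le_trans (measure_mono_ae ?_) (measure_rearr_lt_le μ v t))
  filter_upwards [h] with x hx (hx2 : rearr μ v t < u x)
  exact lt_of_lt_of_le hx2 hx

lemma rearr_antitone (μ : Measure X) (u : X → ℝ≥0∞) : Antitone (rearr μ u) := by
  intro s t hst
  refine rearr_le_of_measure_le ((measure_rearr_lt_le μ u s).trans ?_)
  exact ENNReal.ofReal_le_ofReal hst

@[fun_prop]
lemma measurable_rearr (μ : Measure X) (u : X → ℝ≥0∞) : Measurable (rearr μ u) :=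
  (rearr_antitone μ u).measurable

lemma measurable_distr {T : Type*} [MeasurableSpace T] (μ : Measure X) [SFinite μ]
    {u : T → X → ℝ≥0∞} (hu : Measurable (Function.uncurry u)) :
    Measurable (fun z : T × ℝ≥0∞ => μ {x | z.2 < u z.1 x}) := by
  have : MeasurableSet {w : (T × ℝ≥0∞) × X | w.1.2 < u w.1.1 w.2} :=
    measurableSet_lt (by fun_prop)
      (hu.comp ((measurable_fst.comp measurable_fst).prodMk measurable_snd))
  exact measurable_measure_prodMk_left this

lemma measurable_distr_left {T : Type*} [MeasurableSpace T] (μ : Measure X) [SFinite μ]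
    {u : T → X → ℝ≥0∞} (hu : Measurable (Function.uncurry u)) (l : ℝ≥0∞) :
    Measurable (fun t => μ {x | l < u t x}) :=
  (measurable_distr μ hu).comp (measurable_id.prodMk measurable_const)

lemma measurable_distr_right (μ : Measure X) (u : X → ℝ≥0∞) :
    Measurable (fun l => μ {x | l < u x}) := by
  refine Antitone.measurable fun l m h => measure_mono ?_
  intro x (hx : m < u x)
  exact lt_of_le_of_lt h hx

lemma measurable_rearr_prod {T : Type*} [MeasurableSpace T] (μ : Measure X) [SFinite μ]
    {u : T → X → ℝ≥0∞} (hu : Measurable (Function.uncurry u)) :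
    Measurable (fun z : T × ℝ => rearr μ (u z.1) z.2) := by
  refine measurable_of_Ioi fun l => ?_
  have : (fun z : T × ℝ => rearr μ (u z.1) z.2) ⁻¹' Ioi l
      = {z : T × ℝ | ENNReal.ofReal z.2 < μ {x | l < u z.1 x}} := by
    ext z; exact lt_rearr_iff μ (u z.1) z.2 l
  rw [this]
  exact measurableSet_lt (by fun_prop) ((measurable_distr_left μ hu l).comp measurable_fst)

lemma measurable_lor {T : Type*} [MeasurableSpace T] (μ : Measure X) [SFinite μ] (q : ℝ)
    {u : T → X → ℝ≥0∞} (hu : Measurable (Function.uncurry u)) :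
    Measurable (fun t => lor μ q (u t)) := by
  unfold lor
  refine Measurable.pow_const ?_ _
  refine Measurable.lintegral_prod_right' (f := fun z : T × ℝ =>
    ENNReal.ofReal z.2 ^ (2 / q - 1) * rearr μ (u z.1) z.2 ^ 2) ?_
  have := measurable_rearr_prod μ hu
  fun_prop

lemma lor_mono {μ : Measure X} (q : ℝ) {u v : X → ℝ≥0∞} (h : ∀ᵐ x ∂μ, u x ≤ v x) :
    lor μ q u ≤ lor μ q v := by
  unfold lor
  gcongr with t
  exact rearr_mono h t

lemma lor_sq (μ : Measure X) (q : ℝ) (u : X → ℝ≥0∞) :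
    lor μ q u ^ 2 = ∫⁻ t in Ioi (0:ℝ), ENNReal.ofReal t ^ (2 / q - 1) * rearr μ u t ^ 2 := by
  unfold lor
  rw [← ENNReal.rpow_natCast, ← ENNReal.rpow_mul]; norm_num

lemma rearr_zero (μ : Measure X) (t : ℝ) : rearr μ (fun _ => 0) t = 0 :=
  le_antisymm (rearr_le_of_measure_le (by simp)) bot_le

lemma lor_zero (μ : Measure X) (q : ℝ) : lor μ q (fun _ => 0) = 0 := by
  simp [lor, rearr_zero]

lemma lintegral_mul_rearr {μ : Measure X} {u : X → ℝ≥0∞} {h : ℝ → ℝ≥0∞} (hh : Measurable h) :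
    ∫⁻ t in Ioi (0:ℝ), h t * rearr μ u t = ∫⁻ a in Ioi (0:ℝ), ∫⁻ t in Ioi (0:ℝ),
      h t * ltInd (ENNReal.ofReal t) (μ {x | ENNReal.ofReal a < u x}) := by
  rw [lintegral_lintegral_swap]
  · refine lintegral_congr fun t => ?_
    simp_rw [← ltInd_rearr]
    rw [lintegral_const_mul _ (by fun_prop), lintegral_ltInd]
  · have hd : Measurable fun z : ℝ × ℝ => μ {x | ENNReal.ofReal z.1 < u x} :=
      (measurable_distr_right μ u).comp (by fun_prop)
    exact ((hh.comp measurable_snd).mul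
      (Measurable.ltInd (by fun_prop) hd)).aemeasurable

lemma lintegral_mul_rearr_sq {μ : Measure X} {u : X → ℝ≥0∞} {h : ℝ → ℝ≥0∞} (hh : Measurable h) :
    ∫⁻ t in Ioi (0:ℝ), h t * rearr μ u t ^ 2 = ∫⁻ a in Ioi (0:ℝ), ENNReal.ofReal (2 * a) *
      ∫⁻ t in Ioi (0:ℝ), h t * ltInd (ENNReal.ofReal t) (μ {x | ENNReal.ofReal a < u x}) := by
  have hm := measurable_distr_right μ u
  simp_rw [← lintegral_const_mul' (ENNReal.ofReal _) _ ENNReal.ofReal_ne_top]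
  rw [lintegral_lintegral_swap]
  · refine lintegral_congr fun t => ?_
    simp_rw [← ltInd_rearr]
    rw [← lintegral_two_mul_ltInd, ← lintegral_const_mul _ (by fun_prop)]
    refine lintegral_congr fun a => ?_
    ring
  · have hd : Measurable fun z : ℝ × ℝ => μ {x | ENNReal.ofReal z.1 < u x} :=
      hm.comp (by fun_prop)
    exact Measurable.aemeasurable ((by fun_prop : Measurable fun z : ℝ × ℝ =>
      ENNReal.ofReal (2 * z.1)).mul ((hh.comp measurable_snd).mul
      (Measurable.ltInd (by fun_prop) hd)))

lemma lintegral_eq_distr {μ : Measure X} [SFinite μ] {u : X → ℝ≥0∞} (hu : Measurable u) :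
    ∫⁻ x, u x ∂μ = ∫⁻ a in Ioi (0:ℝ), μ {x | ENNReal.ofReal a < u x} := by
  calc ∫⁻ x, u x ∂μ = ∫⁻ x, (∫⁻ a in Ioi (0:ℝ), ltInd (ENNReal.ofReal a) (u x)) ∂μ := by
        simp_rw [lintegral_ltInd]
    _ = ∫⁻ a in Ioi (0:ℝ), ∫⁻ x, ltInd (ENNReal.ofReal a) (u x) ∂μ := by
        rw [lintegral_lintegral_swap]
        exact Measurable.aemeasurable (by fun_prop)
    _ = _ := by
        refine lintegral_congr fun a => ?_
        have hs : MeasurableSet {x | ENNReal.ofReal a < u x} := measurableSet_lt measurable_const hu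
        rw [← lintegral_indicator_one hs]
        refine lintegral_congr fun x => ?_
        simp [ltInd, indicator_apply]

lemma lintegral_rearr {μ : Measure X} [SFinite μ] {u : X → ℝ≥0∞} (hu : Measurable u) :
    ∫⁻ t in Ioi (0:ℝ), rearr μ u t = ∫⁻ x, u x ∂μ := by
  have := lintegral_mul_rearr (μ := μ) (u := u) (h := fun _ => 1) measurable_const
  simp only [one_mul] at this
  rw [this, lintegral_eq_distr hu]
  exact lintegral_congr fun a => lintegral_ltInd _

lemma rearr_rpow (μ : Measure X) (u : X → ℝ≥0∞) {q : ℝ} (hq : 0 < q) (t : ℝ) :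
    rearr μ (fun x => u x ^ q) t = rearr μ u t ^ q := by
  refine eq_of_forall_lt_iff fun l => ?_
  rw [lt_rearr_iff]
  have h : ∀ v : ℝ≥0∞, l < v ^ q ↔ l ^ q⁻¹ < v := fun v => (ENNReal.rpow_inv_lt_iff hq).symm
  simp_rw [h]
  rw [lt_rearr_iff]

lemma lintegral_rearr_rpow {μ : Measure X} [SFinite μ] {u : X → ℝ≥0∞} (hu : Measurable u)
    {q : ℝ} (hq : 0 < q) :
    ∫⁻ t in Ioi (0:ℝ), rearr μ u t ^ q = ∫⁻ x, u x ^ q ∂μ := by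
  simp_rw [← rearr_rpow μ u hq]
  exact lintegral_rearr (hu.pow_const q)

lemma lor_two {μ : Measure X} [SFinite μ] {u : X → ℝ≥0∞} (hu : Measurable u) :
    lor μ 2 u = (∫⁻ x, u x ^ 2 ∂μ) ^ (1 / 2 : ℝ) := by
  have := lintegral_rearr_rpow (μ := μ) hu (q := 2) two_pos
  simp only [ENNReal.rpow_ofNat] at this
  rw [← this]
  simp [lor]

/-- The Hardy-Littlewood rearrangement inequality. -/
lemma lintegral_mul_le_rearr {μ : Measure X} [SFinite μ] {u v : X → ℝ≥0∞} (hu : Measurable u)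
    (hv : Measurable v) :
    ∫⁻ x, u x * v x ∂μ ≤ ∫⁻ t in Ioi (0:ℝ), rearr μ u t * rearr μ v t := by
  have hdu := measurable_distr_right μ u
  have hdv := measurable_distr_right μ v
  calc ∫⁻ x, u x * v x ∂μ
      = ∫⁻ x, (∫⁻ a in Ioi (0:ℝ), ∫⁻ b in Ioi (0:ℝ),
          ltInd (ENNReal.ofReal a) (u x) * ltInd (ENNReal.ofReal b) (v x)) ∂μ := by
        simp_rw [lintegral_lintegral_ltInd]
    _ = ∫⁻ a in Ioi (0:ℝ), ∫⁻ b in Ioi (0:ℝ), ∫⁻ x,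
          ltInd (ENNReal.ofReal a) (u x) * ltInd (ENNReal.ofReal b) (v x) ∂μ := by
        rw [lintegral_lintegral_swap]
        · refine lintegral_congr fun a => ?_
          rw [lintegral_lintegral_swap]
          exact Measurable.aemeasurable (by fun_prop)
        · refine Measurable.aemeasurable ?_
          refine Measurable.lintegral_prod_right' (f := fun z : (X × ℝ) × ℝ =>
            ltInd (ENNReal.ofReal z.1.2) (u z.1.1) * ltInd (ENNReal.ofReal z.2) (v z.1.1)) ?_
          fun_prop
    _ ≤ ∫⁻ a in Ioi (0:ℝ), ∫⁻ b in Ioi (0:ℝ), ∫⁻ t in Ioi (0:ℝ),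
          ltInd (ENNReal.ofReal a) (rearr μ u t) * ltInd (ENNReal.ofReal b) (rearr μ v t) := by
        refine lintegral_mono fun a => lintegral_mono fun b => ?_
        dsimp only
        simp_rw [ltInd_rearr]
        have e : ∀ t, ltInd (ENNReal.ofReal t) (μ {x | ENNReal.ofReal a < u x})
            * ltInd (ENNReal.ofReal t) (μ {x | ENNReal.ofReal b < v x})
            = ltInd (ENNReal.ofReal t) (min (μ {x | ENNReal.ofReal a < u x})
              (μ {x | ENNReal.ofReal b < v x})) := by
          intro t; simp only [ltInd, lt_min_iff, ite_and]; split_ifs <;> simp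
        simp_rw [e, lintegral_ltInd]
        have hsu : MeasurableSet {x | ENNReal.ofReal a < u x} :=
          measurableSet_lt measurable_const hu
        have hsv : MeasurableSet {x | ENNReal.ofReal b < v x} :=
          measurableSet_lt measurable_const hv
        have e2 : ∀ x, ltInd (ENNReal.ofReal a) (u x) * ltInd (ENNReal.ofReal b) (v x)
            = ({x | ENNReal.ofReal a < u x} ∩ {x | ENNReal.ofReal b < v x}).indicator 1 x := by
          intro x; simp only [ltInd, indicator_apply, mem_inter_iff, mem_ofPred_eq, ite_and]
          split_ifs <;> simp
        simp_rw [e2]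
        rw [lintegral_indicator_one (hsu.inter hsv)]
        exact le_min (measure_mono inter_subset_left) (measure_mono inter_subset_right)
    _ = ∫⁻ t in Ioi (0:ℝ), ∫⁻ a in Ioi (0:ℝ), ∫⁻ b in Ioi (0:ℝ),
          ltInd (ENNReal.ofReal a) (rearr μ u t) * ltInd (ENNReal.ofReal b) (rearr μ v t) := by
        symm
        rw [lintegral_lintegral_swap]
        · refine lintegral_congr fun a => ?_
          rw [lintegral_lintegral_swap]
          exact Measurable.aemeasurable (by fun_prop)
        · refine Measurable.aemeasurable ?_
          refine Measurable.lintegral_prod_right' (f := fun z : (ℝ × ℝ) × ℝ =>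
            ltInd (ENNReal.ofReal z.1.2) (rearr μ u z.1.1)
              * ltInd (ENNReal.ofReal z.2) (rearr μ v z.1.1)) ?_
          fun_prop
    _ = _ := by
        simp_rw [lintegral_lintegral_ltInd]

end Rearrangement

section LorentzInequalities

variable {X Y : Type*} [MeasurableSpace X] [MeasurableSpace Y]

lemma lintegral_rearr_mul_le {μ : Measure X} {ν : Measure Y} (u : X → ℝ≥0∞) (v : Y → ℝ≥0∞)
    {q r : ℝ} (hqr : 1 / q + 1 / r = 1) :
    ∫⁻ t in Ioi (0:ℝ), rearr μ u t * rearr ν v t ≤ lor μ q u * lor ν r v := by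
  unfold lor
  refine le_trans (le_of_eq ?_) (ENNReal.lintegral_mul_norm_pow_le (p := 1 / 2) (q := 1 / 2)
    (Measurable.aemeasurable (by fun_prop)) (Measurable.aemeasurable (by fun_prop))
    (by norm_num) (by norm_num) (by norm_num))
  refine setLIntegral_congr_fun measurableSet_Ioi fun t ht => ?_
  have ht : (0:ℝ) < t := ht
  have h0 : ENNReal.ofReal t ≠ 0 := by simpa using ht
  rw [← ENNReal.mul_rpow_of_nonneg _ _ (by norm_num)]
  have : ENNReal.ofReal t ^ (2 / q - 1) * rearr μ u t ^ 2
      * (ENNReal.ofReal t ^ (2 / r - 1) * rearr ν v t ^ 2)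
      = (rearr μ u t * rearr ν v t) ^ (2:ℝ) := by
    rw [mul_mul_mul_comm, ← ENNReal.rpow_add _ _ h0 ENNReal.ofReal_ne_top]
    have : 2 / q - 1 + (2 / r - 1) = 0 := by linear_combination 2 * hqr
    rw [this, ENNReal.rpow_zero, one_mul, ← mul_pow, ENNReal.rpow_ofNat]
  rw [this, ← ENNReal.rpow_mul]
  norm_num

lemma lintegral_mul_le_lor {μ : Measure X} [SFinite μ] {u v : X → ℝ≥0∞} (hu : Measurable u)
    (hv : Measurable v) {q r : ℝ} (hqr : 1 / q + 1 / r = 1) :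
    ∫⁻ x, u x * v x ∂μ ≤ lor μ q u * lor μ r v :=
  (lintegral_mul_le_rearr hu hv).trans (lintegral_rearr_mul_le u v hqr)

lemma lor_interpolation (μ : Measure X) (u : X → ℝ≥0∞) {p r θ : ℝ} (h0 : 0 ≤ θ) (h1 : θ ≤ 1)
    (h : 2 / p - 1 = θ * (2 / r - 1)) :
    lor μ p u ≤ lor μ 2 u ^ (1 - θ) * lor μ r u ^ θ := by
  unfold lor
  rw [← ENNReal.rpow_mul, ← ENNReal.rpow_mul, mul_comm (1 / 2 : ℝ), mul_comm (1 / 2 : ℝ),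
    ENNReal.rpow_mul, ENNReal.rpow_mul, ← ENNReal.mul_rpow_of_nonneg _ _ (by norm_num)]
  gcongr
  refine le_trans (le_of_eq ?_) (ENNReal.lintegral_mul_norm_pow_le (p := 1 - θ) (q := θ)
    (Measurable.aemeasurable (by fun_prop)) (Measurable.aemeasurable (by fun_prop))
    (by linarith) h0 (by ring))
  refine setLIntegral_congr_fun measurableSet_Ioi fun t ht => ?_
  rw [ENNReal.mul_rpow_of_nonneg _ _ (by linarith), ENNReal.mul_rpow_of_nonneg _ _ h0,
    mul_mul_mul_comm, ← ENNReal.rpow_add_of_nonneg _ _ (by linarith) h0]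
  simp only [sub_add_cancel, ENNReal.rpow_one]
  rw [h, ← ENNReal.rpow_mul, ← ENNReal.rpow_mul, mul_comm θ]
  simp

lemma rearr_le_liminf {μ : Measure X} {u : X → ℝ≥0∞} {v : ℕ → X → ℝ≥0∞}
    (hv : ∀ k, Measurable (v k)) (h : ∀ x, u x ≤ liminf (fun k => v k x) atTop) (t : ℝ) :
    rearr μ u t ≤ liminf (fun k => rearr μ (v k) t) atTop := by
  refine le_of_forall_lt fun l hl => ?_
  obtain ⟨m, hlm, hm⟩ := exists_between hl
  refine lt_of_lt_of_le hlm ?_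
  refine le_liminf_of_le (by isBoundedDefault) ?_
  rw [lt_rearr_iff] at hm
  have h2 : μ {x | m < u x} ≤ liminf (fun k => μ {x | m < v k x}) atTop := by
    have hs : ∀ k, MeasurableSet {x | m < v k x} := fun k => measurableSet_lt measurable_const (hv k)
    have := lintegral_liminf_le (μ := μ) (u := atTop)
      (f := fun k => {x | m < v k x}.indicator (1 : X → ℝ≥0∞))
      (fun k => measurable_one.indicator (hs k))
    simp_rw [fun k => lintegral_indicator_one (μ := μ) (hs k)] at this
    refine le_trans ?_ this
    have hsub : {x | m < u x} ⊆ {x | ∀ᶠ k in atTop, m < v k x} := by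
      intro x (hx : m < u x)
      exact eventually_lt_of_lt_liminf (lt_of_lt_of_le hx (h x))
    have hms : MeasurableSet {x | ∀ᶠ k in atTop, m < v k x} :=
      by
        have : {x | ∀ᶠ k in atTop, m < v k x} = liminf (fun k => {x | m < v k x}) atTop := by
          ext x; simp [mem_liminf_iff_eventually_mem]
        rw [this]
        exact MeasurableSet.measurableSet_liminf hs
    refine (measure_mono hsub).trans ?_
    rw [← lintegral_indicator_one hms]
    refine lintegral_mono fun x => ?_
    by_cases hx : x ∈ {x | ∀ᶠ k in atTop, m < v k x}
    · rw [indicator_of_mem hx]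
      refine le_liminf_of_le (by isBoundedDefault) ?_
      filter_upwards [show ∀ᶠ k in atTop, m < v k x from hx] with k hk
      rw [indicator_of_mem (by exact hk)]
    · rw [indicator_of_notMem hx]; exact zero_le
  filter_upwards [eventually_lt_of_lt_liminf (lt_of_lt_of_le hm h2)] with k hk
  exact ((lt_rearr_iff _ _ _ _).2 hk).le

lemma ENNReal.rpow_liminf_le (u : ℕ → ℝ≥0∞) {q : ℝ} (hq : 0 < q) :
    (liminf u atTop) ^ q = liminf (fun k => u k ^ q) atTop := by
  exact (ENNReal.orderIsoRpow q hq).liminf_apply (by isBoundedDefault) (by isBoundedDefault)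
    (by isBoundedDefault) (by isBoundedDefault)

lemma lor_le_liminf {μ : Measure X} {u : X → ℝ≥0∞} {v : ℕ → X → ℝ≥0∞} (q : ℝ)
    (hv : ∀ k, Measurable (v k)) (h : ∀ x, u x ≤ liminf (fun k => v k x) atTop) :
    lor μ q u ≤ liminf (fun k => lor μ q (v k)) atTop := by
  unfold lor
  rw [← ENNReal.rpow_liminf_le _ (by norm_num)]
  gcongr
  refine le_trans (setLIntegral_mono_ae' measurableSet_Ioi ?_) (lintegral_liminf_le fun k => ?_)
  · refine ae_of_all _ fun t (ht : 0 < t) => ?_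
    refine le_trans (mul_le_mul_right (pow_le_pow_left' (rearr_le_liminf hv h t) 2) _) ?_
    have e1 : (liminf (fun k => rearr μ (v k) t) atTop) ^ 2
        = liminf (fun k => rearr μ (v k) t ^ 2) atTop := by
      have := ENNReal.rpow_liminf_le (fun k => rearr μ (v k) t) (q := 2) two_pos
      simpa only [ENNReal.rpow_ofNat] using this
    rw [e1]
    refine (ENNReal.liminf_const_mul_of_ne_top ?_).ge
    rw [ENNReal.ofReal_rpow_of_pos ‹0 < t›]
    exact ENNReal.ofReal_ne_top
  · fun_prop

lemma lor_le_lintegral_rpow {μ : Measure X} [SFinite μ] {u : X → ℝ≥0∞} (hu : Measurable u)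
    {q : ℝ} (hq : 0 < q) (hq2 : q ≤ 2) :
    lor μ q u ≤ (∫⁻ x, u x ^ q ∂μ) ^ (1 / q) := by
  rw [← lintegral_rearr_rpow hu hq]
  set Q := ∫⁻ t in Ioi (0:ℝ), rearr μ u t ^ q with hQ
  have hsup : ∀ t ∈ Ioi (0:ℝ), ENNReal.ofReal t * rearr μ u t ^ q ≤ Q := by
    intro t ht
    calc ENNReal.ofReal t * rearr μ u t ^ q = ∫⁻ s in Ioc 0 t, rearr μ u t ^ q := by
          simp [mul_comm]
      _ ≤ ∫⁻ s in Ioc 0 t, rearr μ u s ^ q := by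
          refine setLIntegral_mono' measurableSet_Ioc fun s hs => ?_
          gcongr
          exact rearr_antitone μ u hs.2
      _ ≤ Q := lintegral_mono_set Ioc_subset_Ioi_self
  unfold lor
  have : (∫⁻ t in Ioi (0:ℝ), ENNReal.ofReal t ^ (2 / q - 1) * rearr μ u t ^ 2) ≤ Q ^ (2 / q) := by
    calc _ ≤ ∫⁻ t in Ioi (0:ℝ), Q ^ (2 / q - 1) * rearr μ u t ^ q := by
          refine setLIntegral_mono' measurableSet_Ioi fun t ht => ?_
          have e : ENNReal.ofReal t ^ (2 / q - 1) * rearr μ u t ^ 2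
              = (ENNReal.ofReal t * rearr μ u t ^ q) ^ (2 / q - 1) * rearr μ u t ^ q := by
            have hn : 0 ≤ 2 / q - 1 := by rw [sub_nonneg, le_div_iff₀ hq]; linarith
            rw [ENNReal.mul_rpow_of_nonneg _ _ hn, mul_assoc, ← ENNReal.rpow_mul,
              ← ENNReal.rpow_add_of_nonneg _ _ (by positivity) hq.le, ← ENNReal.rpow_ofNat]
            congr 2
            field_simp; ring
          rw [e]
          gcongr
          · rw [sub_nonneg, le_div_iff₀ hq]; linarith
          · exact hsup t ht
      _ = Q ^ (2 / q - 1) * Q := by rw [lintegral_const_mul _ (by fun_prop)]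
      _ = Q ^ (2 / q) := by
          nth_rw 2 [← ENNReal.rpow_one Q]
          rw [← ENNReal.rpow_add_of_nonneg _ _ _ zero_le_one, sub_add_cancel]
          rw [sub_nonneg, le_div_iff₀ hq]; linarith
  calc _ ≤ (Q ^ (2 / q)) ^ (1 / 2 : ℝ) := by gcongr
    _ = _ := by rw [← ENNReal.rpow_mul]; congr 1; field_simp

lemma lintegral_le_of_le_powers {G : ℝ → ℝ≥0∞} {c e₁ e₂ : ℝ} {M : ℝ≥0∞} (hc : 0 < c)
    (h₁ : 0 < e₁) (h₂ : 0 < e₂)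
    (hG₁ : ∀ s, 0 < s → s ≤ c → G s ≤ M * ENNReal.ofReal (c ^ (-e₁) * s ^ (e₁ - 1)))
    (hG₂ : ∀ s, c < s → G s ≤ M * ENNReal.ofReal (c ^ e₂ * s ^ (-e₂ - 1))) :
    ∫⁻ s in Ioi (0:ℝ), G s ≤ M * ENNReal.ofReal (1 / e₁ + 1 / e₂) := by
  rw [← Ioc_union_Ioi_eq_Ioi hc.le]
  refine (lintegral_union_le _ _ _).trans ?_
  rw [ENNReal.ofReal_add (by positivity) (by positivity), mul_add]
  gcongr
  · calc _ ≤ ∫⁻ s in Ioc 0 c, M * ENNReal.ofReal (c ^ (-e₁) * s ^ (e₁ - 1)) :=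
          setLIntegral_mono' measurableSet_Ioc fun s hs => hG₁ s hs.1 hs.2
      _ = M * ∫⁻ s in Ioc 0 c, ENNReal.ofReal (c ^ (-e₁) * s ^ (e₁ - 1)) :=
          lintegral_const_mul _ (by fun_prop)
      _ = _ := by
          congr 1
          rw [← ofReal_integral_eq_lintegral_ofReal]
          · rw [← intervalIntegral.integral_of_le hc.le, intervalIntegral.integral_const_mul,
              integral_rpow (Or.inl (by linarith))]
            congr 1
            rw [sub_add_cancel, Real.zero_rpow h₁.ne', sub_zero, ← mul_div_assoc,
              ← Real.rpow_add hc]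
            simp
          · exact (intervalIntegrable_iff_integrableOn_Ioc_of_le hc.le).1
              ((intervalIntegral.intervalIntegrable_rpow' (by linarith)).const_mul _)
          · filter_upwards [self_mem_ae_restrict measurableSet_Ioc] with s hs
            have := hs.1
            simp only [Pi.zero_apply]; positivity
  · calc _ ≤ ∫⁻ s in Ioi c, M * ENNReal.ofReal (c ^ e₂ * s ^ (-e₂ - 1)) :=
          setLIntegral_mono' measurableSet_Ioi fun s hs => hG₂ s hs
      _ = M * ∫⁻ s in Ioi c, ENNReal.ofReal (c ^ e₂ * s ^ (-e₂ - 1)) :=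
          lintegral_const_mul _ (by fun_prop)
      _ = _ := by
          congr 1
          rw [← ofReal_integral_eq_lintegral_ofReal]
          · rw [integral_const_mul, integral_Ioi_rpow_of_lt (by linarith) hc]
            congr 1
            rw [sub_add_cancel, neg_div_neg_eq, ← mul_div_assoc, ← Real.rpow_add hc]
            simp
          · exact (integrableOn_Ioi_rpow_of_lt (by linarith) hc).const_mul _
          · filter_upwards [self_mem_ae_restrict measurableSet_Ioi] with s hs
            have : 0 < s := hc.trans hs
            simp only [Pi.zero_apply]; positivity

/-- Schur's test for a symmetric kernel against two rearrangements. -/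
lemma lintegral_kernel_rearr_le {μ : Measure X} {ν : Measure Y} (u : X → ℝ≥0∞) (v : Y → ℝ≥0∞)
    {q : ℝ} {κ : ℝ → ℝ → ℝ≥0∞} (hκ : Measurable (Function.uncurry κ))
    (hsymm : ∀ s t, κ s t = κ t s) {S : ℝ≥0∞}
    (hS : ∀ s, 0 < s → ∫⁻ t in Ioi (0:ℝ),
      κ s t * ENNReal.ofReal ((s * t) ^ (1 - 1 / q) * t⁻¹) ≤ S) :
    ∫⁻ s in Ioi (0:ℝ), ∫⁻ t in Ioi (0:ℝ), κ s t * (rearr μ u s * rearr ν v t)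
      ≤ S * (lor μ q u * lor ν q v) := by
  set U : ℝ × ℝ → ℝ≥0∞ := fun z => κ z.1 z.2 * ENNReal.ofReal ((z.1 * z.2) ^ (1 - 1 / q) * z.2⁻¹)
    * (ENNReal.ofReal z.1 ^ (2 / q - 1) * rearr μ u z.1 ^ 2) with hU
  set V : ℝ × ℝ → ℝ≥0∞ := fun z => κ z.1 z.2 * ENNReal.ofReal ((z.1 * z.2) ^ (1 - 1 / q) * z.1⁻¹)
    * (ENNReal.ofReal z.2 ^ (2 / q - 1) * rearr ν v z.2 ^ 2) with hV
  have hκ' : Measurable fun z : ℝ × ℝ => κ z.1 z.2 := hκ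
  have mU : Measurable U := by fun_prop
  have mV : Measurable V := by fun_prop
  set m := (volume.restrict (Ioi (0:ℝ))).prod (volume.restrict (Ioi (0:ℝ))) with hm
  have iU : ∫⁻ z, U z ∂m ≤ S * lor μ q u ^ 2 := by
    rw [lintegral_prod _ mU.aemeasurable, lor_sq, ← lintegral_const_mul _ (by fun_prop)]
    refine setLIntegral_mono' measurableSet_Ioi fun s hs => ?_
    simp only [hU]
    rw [lintegral_mul_const _ (by fun_prop)]
    gcongr
    exact hS s hs
  have iV : ∫⁻ z, V z ∂m ≤ S * lor ν q v ^ 2 := by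
    rw [lintegral_prod_symm _ mV.aemeasurable, lor_sq, ← lintegral_const_mul _ (by fun_prop)]
    refine setLIntegral_mono' measurableSet_Ioi fun s hs => ?_
    simp only [hV]
    rw [lintegral_mul_const _ (by fun_prop)]
    gcongr
    refine le_trans (le_of_eq ?_) (hS s hs)
    refine lintegral_congr fun t => ?_
    rw [hsymm, mul_comm t s]
  have hsqrt : ∀ a b : ℝ≥0∞, (a * b ^ 2) ^ (1 / 2 : ℝ) = a ^ (1 / 2 : ℝ) * b := by
    intro a b
    rw [ENNReal.mul_rpow_of_nonneg _ _ (by norm_num), ← ENNReal.rpow_ofNat, ← ENNReal.rpow_mul]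
    norm_num
  calc ∫⁻ s in Ioi (0:ℝ), ∫⁻ t in Ioi (0:ℝ), κ s t * (rearr μ u s * rearr ν v t)
      = ∫⁻ z, κ z.1 z.2 * (rearr μ u z.1 * rearr ν v z.2) ∂m :=
        (lintegral_prod (fun z : ℝ × ℝ => κ z.1 z.2 * (rearr μ u z.1 * rearr ν v z.2))
          (Measurable.aemeasurable (by fun_prop))).symm
    _ = ∫⁻ z, U z ^ (1 / 2 : ℝ) * V z ^ (1 / 2 : ℝ) ∂m := by
        rw [hm, Measure.prod_restrict]
        refine setLIntegral_congr_fun (measurableSet_Ioi.prod measurableSet_Ioi) ?_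
        rintro ⟨s, t⟩ ⟨hs, ht⟩
        have hs : 0 < s := hs
        have ht : 0 < t := ht
        simp only [hU, hV]
        rw [← ENNReal.mul_rpow_of_nonneg _ _ (by norm_num)]
        have key : κ s t * ENNReal.ofReal ((s * t) ^ (1 - 1 / q) * t⁻¹)
            * (ENNReal.ofReal s ^ (2 / q - 1) * rearr μ u s ^ 2)
            * (κ s t * ENNReal.ofReal ((s * t) ^ (1 - 1 / q) * s⁻¹)
            * (ENNReal.ofReal t ^ (2 / q - 1) * rearr ν v t ^ 2))
            = (κ s t * (rearr μ u s * rearr ν v t)) ^ (2:ℝ) := by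
          have hr : ENNReal.ofReal ((s * t) ^ (1 - 1 / q) * t⁻¹)
            * ENNReal.ofReal ((s * t) ^ (1 - 1 / q) * s⁻¹) * ENNReal.ofReal s ^ (2 / q - 1)
            * ENNReal.ofReal t ^ (2 / q - 1) = 1 := by
            rw [ENNReal.ofReal_rpow_of_pos hs, ENNReal.ofReal_rpow_of_pos ht,
              ← ENNReal.ofReal_mul (by positivity), ← ENNReal.ofReal_mul (by positivity),
              ← ENNReal.ofReal_mul (by positivity), ENNReal.ofReal_eq_one]
            have e1 : s⁻¹ = s ^ (-1 : ℝ) := (Real.rpow_neg_one s).symm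
            have e2 : t⁻¹ = t ^ (-1 : ℝ) := (Real.rpow_neg_one t).symm
            rw [Real.mul_rpow hs.le ht.le, e1, e2]
            calc _ = (s ^ (1 - 1 / q) * s ^ (1 - 1 / q) * s ^ (-1:ℝ) * s ^ (2 / q - 1)) *
                  (t ^ (1 - 1 / q) * t ^ (1 - 1 / q) * t ^ (-1:ℝ) * t ^ (2 / q - 1)) := by ring
              _ = 1 := by
                rw [← Real.rpow_add hs, ← Real.rpow_add hs, ← Real.rpow_add hs,
                  ← Real.rpow_add ht, ← Real.rpow_add ht, ← Real.rpow_add ht]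
                have : 1 - 1 / q + (1 - 1 / q) + -1 + (2 / q - 1) = 0 := by ring
                rw [this]; simp
          rw [ENNReal.rpow_ofNat]
          calc _ = (ENNReal.ofReal ((s * t) ^ (1 - 1 / q) * t⁻¹)
            * ENNReal.ofReal ((s * t) ^ (1 - 1 / q) * s⁻¹) * ENNReal.ofReal s ^ (2 / q - 1)
            * ENNReal.ofReal t ^ (2 / q - 1)) * (κ s t * (rearr μ u s * rearr ν v t)) ^ 2 := by ring
            _ = _ := by rw [hr, one_mul]
        rw [key, ← ENNReal.rpow_mul]
        norm_num
    _ ≤ (∫⁻ z, U z ∂m) ^ (1 / 2 : ℝ) * (∫⁻ z, V z ∂m) ^ (1 / 2 : ℝ) :=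
        ENNReal.lintegral_mul_norm_pow_le mU.aemeasurable mV.aemeasurable
          (by norm_num) (by norm_num) (by norm_num)
    _ ≤ (S * lor μ q u ^ 2) ^ (1 / 2 : ℝ) * (S * lor ν q v ^ 2) ^ (1 / 2 : ℝ) := by gcongr
    _ = S * (lor μ q u * lor ν q v) := by
        rw [hsqrt, hsqrt, mul_mul_mul_comm, ← ENNReal.rpow_add_of_nonneg _ _ (by norm_num)
          (by norm_num)]
        norm_num

/-- Double layer-cake bound: a function of the two distribution functions that is dominated by a
kernel integrated over a box is controlled by the kernel tested on the rearrangements. -/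
lemma lintegral_lintegral_distr_le {μ : Measure X} {ν : Measure Y} (u : X → ℝ≥0∞)
    (v : Y → ℝ≥0∞) {κ : ℝ → ℝ → ℝ≥0∞} (hκ : Measurable (Function.uncurry κ))
    {Φ : ℝ → ℝ → ℝ≥0∞}
    (hΦ : ∀ a > 0, ∀ b > 0, Φ a b ≤ ∫⁻ s in Ioi (0:ℝ), ∫⁻ t in Ioi (0:ℝ), κ s t *
      (ltInd (ENNReal.ofReal s) (μ {x | ENNReal.ofReal a < u x})
        * ltInd (ENNReal.ofReal t) (ν {y | ENNReal.ofReal b < v y}))) :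
    ∫⁻ a in Ioi (0:ℝ), ∫⁻ b in Ioi (0:ℝ), Φ a b ≤
      ∫⁻ s in Ioi (0:ℝ), ∫⁻ t in Ioi (0:ℝ), κ s t * (rearr μ u s * rearr ν v t) := by
  set m := (volume.restrict (Ioi (0:ℝ))).prod (volume.restrict (Ioi (0:ℝ))) with hm
  have hκ' : Measurable fun z : ℝ × ℝ => κ z.1 z.2 := hκ
  have hF : Measurable fun w : (ℝ × ℝ) × (ℝ × ℝ) => κ w.2.1 w.2.2 *
      (ltInd (ENNReal.ofReal w.1.1) (rearr μ u w.2.1)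
        * ltInd (ENNReal.ofReal w.1.2) (rearr ν v w.2.2)) := by
    refine Measurable.mul (hκ'.comp measurable_snd) ?_
    fun_prop
  calc ∫⁻ a in Ioi (0:ℝ), ∫⁻ b in Ioi (0:ℝ), Φ a b
      ≤ ∫⁻ a in Ioi (0:ℝ), ∫⁻ b in Ioi (0:ℝ), ∫⁻ z, κ z.1 z.2 *
        (ltInd (ENNReal.ofReal a) (rearr μ u z.1)
          * ltInd (ENNReal.ofReal b) (rearr ν v z.2)) ∂m := by
        refine setLIntegral_mono' measurableSet_Ioi fun a ha =>
          setLIntegral_mono' measurableSet_Ioi fun b hb => (hΦ a ha b hb).trans (le_of_eq ?_)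
        rw [hm, lintegral_prod _ (Measurable.aemeasurable (by fun_prop))]
        simp_rw [ltInd_rearr]
    _ = ∫⁻ w, ∫⁻ z, κ z.1 z.2 * (ltInd (ENNReal.ofReal w.1) (rearr μ u z.1)
          * ltInd (ENNReal.ofReal w.2) (rearr ν v z.2)) ∂m ∂m := by
        rw [hm, lintegral_prod]
        exact (hF.lintegral_prod_right').aemeasurable
    _ = ∫⁻ z, ∫⁻ w, κ z.1 z.2 * (ltInd (ENNReal.ofReal w.1) (rearr μ u z.1)
          * ltInd (ENNReal.ofReal w.2) (rearr ν v z.2)) ∂m ∂m :=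
        lintegral_lintegral_swap hF.aemeasurable
    _ = ∫⁻ z, κ z.1 z.2 * (rearr μ u z.1 * rearr ν v z.2) ∂m := by
        refine lintegral_congr fun z => ?_
        rw [lintegral_const_mul _ (by fun_prop), hm, lintegral_prod _
          (Measurable.aemeasurable (by fun_prop)), lintegral_lintegral_ltInd]
    _ = _ := lintegral_prod _ (Measurable.aemeasurable (by fun_prop))

end LorentzInequalities

section FixedTime

set_option linter.unusedSectionVars false

variable {X Y : Type*} [MeasurableSpace X] [MeasurableSpace Y]

/-- Bounded measurable functions supported in a set of finite measure. -/
structure Nice (μ : Measure X) (f : X → ℂ) : Prop where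
  meas : Measurable f
  bdd : ∃ M : ℝ, ∀ x, ‖f x‖ ≤ M
  supp : μ (Function.support f) < ⊤

/-- The bilinear form with kernel `L`. -/
noncomputable def form (μ : Measure X) (ν : Measure Y) (L : X → Y → ℂ) (f : X → ℂ) (g : Y → ℂ) :
    ℂ := ∫ z, L z.1 z.2 * (f z.1 * g z.2) ∂(μ.prod ν)

/-- The unimodular part of `f` on the superlevel set `{|f| > a}`. -/
noncomputable def layer (f : X → ℂ) (a : ℝ) (x : X) : ℂ :=
  if ENNReal.ofReal a < ‖f x‖ₑ then f x / (‖f x‖ : ℂ) else 0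

lemma measurable_layer {f : X → ℂ} (hf : Measurable f) :
    Measurable (Function.uncurry (layer f)) :=
  Measurable.ite (measurableSet_lt (by fun_prop) (by fun_prop)) (by fun_prop) measurable_const

lemma norm_layer_le (f : X → ℂ) (a : ℝ) (x : X) : ‖layer f a x‖ ≤ 1 := by
  unfold layer
  split_ifs
  · simp only [norm_div, Complex.norm_real, norm_norm]
    exact div_self_le_one _
  · simp

lemma enorm_layer_le (f : X → ℂ) (a : ℝ) (x : X) :
    ‖layer f a x‖ₑ ≤ ltInd (ENNReal.ofReal a) ‖f x‖ₑ := by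
  unfold ltInd
  split_ifs with h
  · rw [← ofReal_norm]
    exact ENNReal.ofReal_le_one.2 (norm_layer_le f a x)
  · simp [layer, h]

lemma layer_eq_zero {f : X → ℂ} {x : X} (h : f x = 0) (a : ℝ) : layer f a x = 0 := by
  simp [layer, h]

lemma integral_layer {f : X → ℂ} {x : X} {M : ℝ} (hM : ‖f x‖ ≤ M) :
    ∫ a in Ioc 0 M, layer f a x = f x := by
  have : ∫ a in Ioc 0 M, layer f a x
      = ∫ a in Ioc 0 M, (Iio ‖f x‖).indicator (fun _ => f x / (‖f x‖ : ℂ)) a := by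
    refine setIntegral_congr_fun measurableSet_Ioc fun a ha => ?_
    have : ENNReal.ofReal a < ‖f x‖ₑ ↔ a < ‖f x‖ := by
      rw [← ofReal_norm, ENNReal.ofReal_lt_ofReal_iff_of_nonneg ha.1.le]
    simp [layer, indicator, this]
  rw [this, setIntegral_indicator measurableSet_Iio]
  have : Ioc 0 M ∩ Iio ‖f x‖ = Ioo 0 ‖f x‖ := by
    ext a; constructor
    · rintro ⟨h1, h2⟩; exact ⟨h1.1, h2⟩
    · rintro ⟨h1, h2⟩; exact ⟨⟨h1, h2.le.trans hM⟩, h2⟩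
  rw [this, setIntegral_const]
  by_cases h : f x = 0
  · simp [h]
  · have h' : (‖f x‖ : ℂ) ≠ 0 := by simpa using h
    simp [Measure.real, mul_div_cancel₀ _ h']

lemma Nice.layer {μ : Measure X} {f : X → ℂ} (hf : Nice μ f) (a : ℝ) : Nice μ (layer f a) where
  meas := (measurable_layer hf.meas).comp (measurable_const.prodMk measurable_id)
  bdd := ⟨1, norm_layer_le f a⟩
  supp := (measure_mono (Function.support_subset_iff'.2 fun _ hx =>
    layer_eq_zero (Function.notMem_support.1 hx) a)).trans_lt hf.supp

lemma Nice.integrable {μ : Measure X} {f : X → ℂ} (hf : Nice μ f) : Integrable f μ := by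
  obtain ⟨M, hM⟩ := hf.bdd
  rw [← integrableOn_iff_integrable_of_support_subset (s := Function.support f) subset_rfl]
  exact Measure.integrableOn_of_bounded hf.supp.ne hf.meas.aestronglyMeasurable
    (M := M) (ae_of_all _ hM)

lemma Nice.measure_lt {μ : Measure X} {f : X → ℂ} (hf : Nice μ f) (a : ℝ) :
    μ {x | ENNReal.ofReal a < ‖f x‖ₑ} < ⊤ := by
  refine (measure_mono ?_).trans_lt hf.supp
  intro x (hx : ENNReal.ofReal a < ‖f x‖ₑ) (h : f x = 0)
  simp [h] at hx

/-- Layer-cake decomposition of a bilinear form with bounded kernel. -/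
lemma enorm_form_le_lintegral {μ : Measure X} {ν : Measure Y} [SFinite μ] [SFinite ν]
    {L : X → Y → ℂ} (hL : Measurable (Function.uncurry L)) {lam : ℝ} (hb : ∀ x y, ‖L x y‖ ≤ lam)
    {f : X → ℂ} {g : Y → ℂ} (hf : Nice μ f) (hg : Nice ν g) :
    ‖form μ ν L f g‖ₑ ≤ ∫⁻ a in Ioi (0:ℝ), ∫⁻ b in Ioi (0:ℝ),
      ‖form μ ν L (layer f a) (layer g b)‖ₑ := by
  obtain ⟨M, hM⟩ := hf.bdd
  obtain ⟨N, hN⟩ := hg.bdd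
  set m := (volume.restrict (Ioc 0 M)).prod (volume.restrict (Ioc 0 N)) with hm
  have hL' : Measurable fun z : X × Y => L z.1 z.2 := hL
  have mf : Measurable fun z : ℝ × X => layer f z.1 z.2 := measurable_layer hf.meas
  have mg : Measurable fun z : ℝ × Y => layer g z.1 z.2 := measurable_layer hg.meas
  have hmeas : Measurable fun w : (X × Y) × (ℝ × ℝ) =>
      L w.1.1 w.1.2 * (layer f w.2.1 w.1.1 * layer g w.2.2 w.1.2) := by
    refine (hL'.comp measurable_fst).mul (Measurable.mul ?_ ?_)
    · exact mf.comp (by fun_prop : Measurable fun w : (X × Y) × (ℝ × ℝ) => (w.2.1, w.1.1))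
    · exact mg.comp (by fun_prop : Measurable fun w : (X × Y) × (ℝ × ℝ) => (w.2.2, w.1.2))
  have hint : Integrable (fun w : (X × Y) × (ℝ × ℝ) =>
      L w.1.1 w.1.2 * (layer f w.2.1 w.1.1 * layer g w.2.2 w.1.2)) ((μ.prod ν).prod m) := by
    set S : Set ((X × Y) × (ℝ × ℝ)) := (Function.support f ×ˢ Function.support g) ×ˢ univ with hS
    rw [← integrableOn_iff_integrable_of_support_subset (s := S)]
    · refine Measure.integrableOn_of_bounded (M := lam) ?_ hmeas.aestronglyMeasurable
        (ae_of_all _ fun w => ?_)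
      · rw [hS, Measure.prod_prod, Measure.prod_prod]
        refine (ENNReal.mul_lt_top (ENNReal.mul_lt_top hf.supp hg.supp) ?_).ne
        rw [hm, ← univ_prod_univ, Measure.prod_prod]
        simp only [Measure.restrict_apply_univ]
        exact ENNReal.mul_lt_top measure_Ioc_lt_top measure_Ioc_lt_top
      · rw [norm_mul, norm_mul]
        have h1 := norm_layer_le f w.2.1 w.1.1
        have h2 := norm_layer_le g w.2.2 w.1.2
        calc _ ≤ lam * (1 * 1) := by
              gcongr
              · exact (norm_nonneg _).trans (hb w.1.1 w.1.2)
              · exact hb _ _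
          _ = lam := by ring
    · intro w hw
      refine ⟨⟨fun h => hw ?_, fun h => hw ?_⟩, mem_univ _⟩
      · simp [layer_eq_zero h]
      · simp [layer_eq_zero h]
  have key : form μ ν L f g = ∫ w, form μ ν L (layer f w.1) (layer g w.2) ∂m := by
    unfold form
    rw [integral_integral_swap (f := fun (w : ℝ × ℝ) (z : X × Y) =>
      L z.1 z.2 * (layer f w.1 z.1 * layer g w.2 z.2)) hint.swap]
    refine integral_congr_ae (ae_of_all _ fun z => ?_)
    simp only
    rw [integral_const_mul, hm, integral_prod_mul (fun a => layer f a z.1) (fun b => layer g b z.2),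
      integral_layer (hM _), integral_layer (hN _)]
  rw [key]
  refine (enorm_integral_le_lintegral_enorm _).trans ?_
  have hmm : Measurable fun w : ℝ × ℝ => form μ ν L (layer f w.1) (layer g w.2) := by
    unfold form
    exact (StronglyMeasurable.integral_prod_right'
      (f := fun w : (ℝ × ℝ) × (X × Y) => L w.2.1 w.2.2 * (layer f w.1.1 w.2.1 * layer g w.1.2 w.2.2))
      (hmeas.comp measurable_swap).stronglyMeasurable).measurable
  rw [hm, lintegral_prod _ hmm.enorm.aemeasurable]
  refine (lintegral_mono_set Ioc_subset_Ioi_self).trans ?_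
  exact lintegral_mono fun a => lintegral_mono_set Ioc_subset_Ioi_self

lemma enorm_form_layer_le {μ : Measure X} {ν : Measure Y} [SFinite μ] [SFinite ν]
    {L : X → Y → ℂ} {lam : ℝ} (hb : ∀ x y, ‖L x y‖ ≤ lam)
    {f : X → ℂ} {g : Y → ℂ} (hf : Measurable f) (hg : Measurable g) (a b : ℝ) :
    ‖form μ ν L (layer f a) (layer g b)‖ₑ ≤ ENNReal.ofReal lam *
      (μ {x | ENNReal.ofReal a < ‖f x‖ₑ} * ν {y | ENNReal.ofReal b < ‖g y‖ₑ}) := by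
  refine (enorm_integral_le_lintegral_enorm _).trans ?_
  have hA : MeasurableSet {x | ENNReal.ofReal a < ‖f x‖ₑ} :=
    measurableSet_lt measurable_const hf.enorm
  have hB : MeasurableSet {y | ENNReal.ofReal b < ‖g y‖ₑ} :=
    measurableSet_lt measurable_const hg.enorm
  calc _ ≤ ∫⁻ z, ENNReal.ofReal lam * (ltInd (ENNReal.ofReal a) ‖f z.1‖ₑ
        * ltInd (ENNReal.ofReal b) ‖g z.2‖ₑ) ∂(μ.prod ν) := by
        refine lintegral_mono fun z => ?_
        rw [enorm_mul, enorm_mul]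
        gcongr
        · rw [← ofReal_norm]; exact ENNReal.ofReal_le_ofReal (hb _ _)
        · exact enorm_layer_le _ _ _
        · exact enorm_layer_le _ _ _
    _ = _ := by
        rw [lintegral_const_mul' _ _ ENNReal.ofReal_ne_top,
          lintegral_prod_mul (f := fun x => ltInd (ENNReal.ofReal a) ‖f x‖ₑ)
            (g := fun y => ltInd (ENNReal.ofReal b) ‖g y‖ₑ) (Measurable.aemeasurable (by fun_prop))
            (Measurable.aemeasurable (by fun_prop))]
        simp only [ltInd]
        congr 2
        · rw [← lintegral_indicator_one hA]; simp [indicator]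
        · rw [← lintegral_indicator_one hB]; simp [indicator]

lemma lor_two_layer_le {μ : Measure X} [SFinite μ] {f : X → ℂ} (hf : Measurable f) (a : ℝ) :
    lor μ 2 (fun x => ‖layer f a x‖ₑ) ≤ μ {x | ENNReal.ofReal a < ‖f x‖ₑ} ^ (1 / 2 : ℝ) := by
  have hA : MeasurableSet {x | ENNReal.ofReal a < ‖f x‖ₑ} :=
    measurableSet_lt measurable_const hf.enorm
  have hm : Measurable (layer f a) :=
    (measurable_layer hf).comp (measurable_const.prodMk measurable_id)
  rw [lor_two hm.enorm]
  gcongr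
  rw [← lintegral_indicator_one hA]
  refine lintegral_mono fun x => ?_
  refine (pow_le_pow_left' (enorm_layer_le f a x) 2).trans ?_
  simp only [ltInd, indicator, mem_ofPred_eq]
  split_ifs <;> simp

lemma lintegral_lintegral_mul_ltInd_ge {κ : ℝ → ℝ → ℝ≥0∞} {d e k : ℝ≥0∞}
    (h : ∀ s, 0 < s → ∀ t, 0 < t → ENNReal.ofReal s < d → ENNReal.ofReal t < e → k ≤ κ s t) :
    k * (d * e) ≤ ∫⁻ s in Ioi (0:ℝ), ∫⁻ t in Ioi (0:ℝ),
      κ s t * (ltInd (ENNReal.ofReal s) d * ltInd (ENNReal.ofReal t) e) := by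
  rw [← lintegral_lintegral_ltInd d e, ← lintegral_const_mul _ (by fun_prop)]
  refine setLIntegral_mono' measurableSet_Ioi fun s hs => ?_
  rw [← lintegral_const_mul _ (by fun_prop)]
  refine setLIntegral_mono' measurableSet_Ioi fun t ht => ?_
  by_cases h1 : ENNReal.ofReal s < d
  · by_cases h2 : ENNReal.ofReal t < e
    · gcongr
      exact h s hs t ht h1 h2
    · simp [ltInd, h2]
  · simp [ltInd, h1]

/-- Interpolation of the `L¹ → L^∞` and `L²` bounds for a bilinear form, with Lorentz exponent 2. -/
lemma enorm_form_le_lor {μ : Measure X} [SFinite μ] {L : X → X → ℂ}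
    (hL : Measurable (Function.uncurry L)) {lam : ℝ} (hlam : 0 < lam) (hb : ∀ x y, ‖L x y‖ ≤ lam)
    (h2 : ∀ f g, Nice μ f → Nice μ g →
      ‖form μ μ L f g‖ₑ ≤ lor μ 2 (fun x => ‖f x‖ₑ) * lor μ 2 (fun x => ‖g x‖ₑ))
    {p : ℝ} (hp : 2 < p) {f g : X → ℂ} (hf : Nice μ f) (hg : Nice μ g) :
    ‖form μ μ L f g‖ₑ ≤ ENNReal.ofReal (lam ^ (1 - 2 / p))
      * ENNReal.ofReal (1 / (1 / p) + 1 / (1 / 2 - 1 / p))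
      * (lor μ (p / (p - 1)) (fun x => ‖f x‖ₑ) * lor μ (p / (p - 1)) (fun x => ‖g x‖ₑ)) := by
  have hp0 : 0 < p := by linarith
  set κ : ℝ → ℝ → ℝ≥0∞ := fun s t => min (ENNReal.ofReal lam) (ENNReal.ofReal ((s * t) ^ (-(1/2) : ℝ)))
    with hκ
  have mκ : Measurable (Function.uncurry κ) := by
    simp only [hκ, Function.uncurry_def]; fun_prop
  refine (enorm_form_le_lintegral hL hb hf hg).trans ?_
  refine (lintegral_lintegral_distr_le (μ := μ) (ν := μ) (κ := κ) (u := fun x => ‖f x‖ₑ)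
    (v := fun x => ‖g x‖ₑ) mκ ?_).trans ?_
  · intro a ha b hb'
    set d := μ {x | ENNReal.ofReal a < ‖f x‖ₑ} with hd
    set e := μ {x | ENNReal.ofReal b < ‖g x‖ₑ} with he
    have hd' : d ≠ ⊤ := (hf.measure_lt a).ne
    have he' : e ≠ ⊤ := (hg.measure_lt b).ne
    have b1 := enorm_form_layer_le (μ := μ) (ν := μ) hb hf.meas hg.meas a b
    have b2 := (h2 _ _ (hf.layer a) (hg.layer b)).trans
      (mul_le_mul' (lor_two_layer_le hf.meas a) (lor_two_layer_le hg.meas b))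
    rw [← hd, ← he] at b1 b2
    by_cases hde : d * e = 0
    · rw [hde, mul_zero] at b1
      exact b1.trans bot_le
    have hde' : d * e ≠ ⊤ := ENNReal.mul_ne_top hd' he'
    refine le_trans ?_ (lintegral_lintegral_mul_ltInd_ge
      (k := min (ENNReal.ofReal lam) ((d * e) ^ (-(1 / 2) : ℝ))) ?_)
    · rw [min_mul_of_nonneg _ _ bot_le]
      refine le_min b1 (b2.trans (le_of_eq ?_))
      rw [← ENNReal.mul_rpow_of_nonneg _ _ (by norm_num)]
      nth_rw 3 [← ENNReal.rpow_one (d * e)]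
      rw [← ENNReal.rpow_add _ _ hde hde']
      norm_num
    · intro s hs t ht hsd hte
      refine min_le_min le_rfl ?_
      rw [← ENNReal.ofReal_rpow_of_pos (by positivity), ENNReal.ofReal_mul hs.le,
        ENNReal.rpow_neg, ENNReal.rpow_neg]
      gcongr
  · refine lintegral_kernel_rearr_le _ _ mκ (fun s t => by simp only [hκ, mul_comm]) ?_
    intro s hs
    have hq : 1 - 1 / (p / (p - 1)) = 1 / p := by
      have : p - 1 ≠ 0 := by linarith
      field_simp; ring
    have hpi : 1 / p < 1 / 2 := by gcongr
    rw [hq]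
    have hc : (0:ℝ) < lam ^ (-2 : ℝ) / s := by positivity
    have hlp : ∀ x : ℝ, (lam ^ (-2:ℝ)) ^ x = lam ^ (-2 * x) := fun x => by
      rw [← Real.rpow_mul hlam.le]
    refine lintegral_le_of_le_powers hc (e₁ := 1 / p) (e₂ := 1 / 2 - 1 / p) (by positivity)
      (by linarith) ?_ ?_
    · intro t ht _
      refine (mul_le_mul_left (min_le_left _ _) _).trans (le_of_eq ?_)
      rw [← ENNReal.ofReal_mul (by positivity), ← ENNReal.ofReal_mul (by positivity)]
      congr 1
      rw [Real.div_rpow (by positivity) hs.le, hlp, Real.mul_rpow hs.le ht.le,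
        Real.rpow_sub ht, Real.rpow_one, Real.rpow_neg hs.le (1 / p), div_inv_eq_mul]
      have : lam = lam ^ (1 - 2 / p) * lam ^ (-2 * -(1 / p)) := by
        rw [← Real.rpow_add hlam]
        ring_nf; simp
      nth_rw 1 [this]
      field_simp
    · intro t ht
      have ht0 : 0 < t := hc.trans ht
      refine (mul_le_mul_left (min_le_right _ _) _).trans (le_of_eq ?_)
      rw [← ENNReal.ofReal_mul (by positivity), ← ENNReal.ofReal_mul (by positivity)]
      congr 1
      rw [Real.div_rpow (by positivity) hs.le, hlp, ← mul_assoc, ← Real.rpow_add (by positivity),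
        Real.mul_rpow hs.le ht0.le, Real.rpow_sub ht0, Real.rpow_one]
      have e3 : ∀ A B C D : ℝ, A * (B / C * (D / t)) = A * B * (C⁻¹ * D / t) := by
        intro A B C D; ring
      rw [e3, ← Real.rpow_add hlam]
      have e1 : (1 - 2 / p + -2 * (1 / 2 - 1 / p)) = 0 := by ring
      have e2 : -(1 / 2) + 1 / p = -(1 / 2 - 1 / p) := by ring
      rw [e1, e2, Real.rpow_zero, Real.rpow_neg hs.le]
      field_simp

end FixedTime

section HardyLittlewoodSobolev

lemma lintegral_abs_rpow_neg_Icc {α b : ℝ} (hα : α < 1) (hb : 0 < b) :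
    ∫⁻ u in Icc (-b) b, ENNReal.ofReal (|u| ^ (-α)) ≤ ENNReal.ofReal (2 / (1 - α) * b ^ (1 - α)) := by
  have h1 : ∫⁻ u in Ioc 0 b, ENNReal.ofReal (u ^ (-α)) = ENNReal.ofReal (b ^ (1 - α) / (1 - α)) := by
    rw [← ofReal_integral_eq_lintegral_ofReal]
    · rw [← intervalIntegral.integral_of_le hb.le, integral_rpow (Or.inl (by linarith)),
        neg_add_eq_sub, Real.zero_rpow (by linarith), sub_zero]
    · exact (intervalIntegrable_iff_integrableOn_Ioc_of_le hb.le).1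
        (intervalIntegral.intervalIntegrable_rpow' (by linarith))
    · filter_upwards [self_mem_ae_restrict measurableSet_Ioc] with s hs
      have := hs.1
      simp only [Pi.zero_apply]; positivity
  have h2 : ∫⁻ u in Ioc 0 b, ENNReal.ofReal (|u| ^ (-α)) = ENNReal.ofReal (b ^ (1 - α) / (1 - α)) := by
    rw [← h1]
    refine setLIntegral_congr_fun measurableSet_Ioc fun u hu => ?_
    rw [abs_of_pos hu.1]
  have h3 : ∫⁻ u in Icc (-b) 0, ENNReal.ofReal (|u| ^ (-α))
      = ENNReal.ofReal (b ^ (1 - α) / (1 - α)) := by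
    rw [← h2, ← lintegral_indicator measurableSet_Icc, ← lintegral_indicator measurableSet_Ioc,
      ← lintegral_sub_left_eq_self _ 0]
    refine lintegral_congr_ae ?_
    filter_upwards [compl_mem_ae_iff.2 (measure_singleton (μ := volume) (0:ℝ))] with u hu
    have hu : u ≠ 0 := hu
    have : (0 - u ∈ Icc (-b) 0) ↔ u ∈ Ioc 0 b := by
      simp only [mem_Icc, mem_Ioc]
      constructor
      · rintro ⟨h, h'⟩; exact ⟨lt_of_le_of_ne (by linarith) hu.symm, by linarith⟩
      · rintro ⟨h, h'⟩; constructor <;> linarith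
    by_cases h : u ∈ Ioc 0 b
    · rw [indicator_of_mem h, indicator_of_mem (this.2 h)]; simp
    · rw [indicator_of_notMem h, indicator_of_notMem (fun h' => h (this.1 h'))]
  rw [← Icc_union_Ioc_eq_Icc (by linarith : -b ≤ 0) hb.le]
  refine (lintegral_union_le _ _ _).trans (le_of_eq ?_)
  have : 0 < 1 - α := by linarith
  rw [h3, h2, ← ENNReal.ofReal_add (by positivity) (by positivity)]
  congr 1; ring

lemma setLIntegral_abs_sub_rpow_neg_le {α : ℝ} (hα0 : 0 ≤ α) (hα : α < 1) (B : Set ℝ)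
    (hB : volume B ≠ ⊤) (t : ℝ) :
    ∫⁻ τ in B, ENNReal.ofReal (|t - τ| ^ (-α))
      ≤ ENNReal.ofReal (2 / (1 - α) + 1) * volume B ^ (1 - α) := by
  by_cases h0 : volume B = 0
  · simp [Measure.restrict_eq_zero.2 h0]
  have hα' : 0 < 1 - α := by linarith
  set b := (volume B).toReal with hb
  have hb0 : 0 < b := ENNReal.toReal_pos h0 hB
  have hBb : volume B = ENNReal.ofReal b := (ENNReal.ofReal_toReal hB).symm
  calc _ ≤ ∫⁻ τ in B, ((Icc (-b) b).indicator (fun u => ENNReal.ofReal (|u| ^ (-α))) (t - τ)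
        + ENNReal.ofReal (b ^ (-α))) := by
        refine lintegral_mono fun τ => ?_
        by_cases h : t - τ ∈ Icc (-b) b
        · rw [indicator_of_mem h]; exact le_self_add
        · refine le_trans (ENNReal.ofReal_le_ofReal ?_) le_add_self
          refine Real.rpow_le_rpow_of_nonpos hb0 ?_ (by linarith)
          by_contra! h'
          exact h (abs_le.1 h'.le)
    _ ≤ (∫⁻ τ, (Icc (-b) b).indicator (fun u => ENNReal.ofReal (|u| ^ (-α))) (t - τ))
        + ENNReal.ofReal (b ^ (-α)) * volume B := by
        rw [lintegral_add_right _ measurable_const, setLIntegral_const]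
        gcongr
        exact Measure.restrict_le_self
    _ ≤ ENNReal.ofReal (2 / (1 - α) * b ^ (1 - α)) + ENNReal.ofReal (b ^ (1 - α)) := by
        gcongr
        · rw [lintegral_sub_left_eq_self, lintegral_indicator measurableSet_Icc]
          exact lintegral_abs_rpow_neg_Icc hα hb0
        · rw [hBb, ← ENNReal.ofReal_mul (by positivity)]
          nth_rw 2 [← Real.rpow_one b]
          rw [← Real.rpow_add hb0, neg_add_eq_sub]
    _ = _ := by
        rw [hBb, ENNReal.ofReal_rpow_of_pos hb0, ← ENNReal.ofReal_add (by positivity) (by positivity),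
          ← ENNReal.ofReal_mul (by positivity)]
        congr 1; ring

lemma lintegral_ltInd_mul_abs_sub_le {α : ℝ} (hα0 : 0 ≤ α) (hα : α < 1) {F G : ℝ → ℝ≥0∞}
    (hF : Measurable F) (hG : Measurable G) {a b : ℝ≥0∞}
    (hGs : volume {t | b < G t} ≠ ⊤) :
    ∫⁻ t, ∫⁻ τ, ENNReal.ofReal (|t - τ| ^ (-α)) * (ltInd a (F t) * ltInd b (G τ))
      ≤ ENNReal.ofReal (2 / (1 - α) + 1) * volume {t | b < G t} ^ (1 - α)
        * volume {t | a < F t} := by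
  have hA : MeasurableSet {t | a < F t} := measurableSet_lt measurable_const hF
  have hB : MeasurableSet {t | b < G t} := measurableSet_lt measurable_const hG
  rw [← lintegral_indicator_one hA, ← lintegral_const_mul _ (by fun_prop)]
  refine lintegral_mono fun t => ?_
  have e : ∀ τ, ENNReal.ofReal (|t - τ| ^ (-α)) * (ltInd a (F t) * ltInd b (G τ))
      = {t | b < G t}.indicator (fun τ => ENNReal.ofReal (|t - τ| ^ (-α))) τ
        * {t | a < F t}.indicator 1 t := by
    intro τ
    simp only [ltInd, indicator, mem_ofPred_eq]
    split_ifs <;> simp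
  simp_rw [e]
  rw [lintegral_mul_const'' _ (Measurable.aemeasurable
    (Measurable.indicator (by fun_prop) hB)), lintegral_indicator hB]
  gcongr
  exact setLIntegral_abs_sub_rpow_neg_le hα0 hα _ hGs t

/-- The constant in the Hardy–Littlewood–Sobolev inequality below. -/
noncomputable def hlsConst (α : ℝ) : ℝ≥0∞ :=
  1 + ENNReal.ofReal (2 / (1 - α) + 1) * ENNReal.ofReal (1 / (α / 2) + 1 / (α / 2))

/-- The diagonal Hardy–Littlewood–Sobolev inequality on the line. -/
lemma hardyLittlewoodSobolev {α : ℝ} (hα0 : 0 ≤ α) (hα : α < 1) {F G : ℝ → ℝ≥0∞}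
    (hF : Measurable F) (hG : Measurable G) (hFs : volume (Function.support F) ≠ ⊤)
    (hGs : volume (Function.support G) ≠ ⊤) :
    ∫⁻ t, ∫⁻ τ, ENNReal.ofReal (|t - τ| ^ (-α)) * (F t * G τ) ≤ hlsConst α
      * ((∫⁻ t, F t ^ (1 - α / 2)⁻¹) ^ (1 - α / 2) * (∫⁻ t, G t ^ (1 - α / 2)⁻¹) ^ (1 - α / 2)) := by
  rcases hα0.eq_or_lt with rfl | hα0'
  · refine le_trans (le_of_eq ?_) (le_mul_of_one_le_left bot_le le_self_add)
    simp only [neg_zero, Real.rpow_zero, ENNReal.ofReal_one, one_mul, zero_div, sub_zero, inv_one,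
      ENNReal.rpow_one]
    simp_rw [lintegral_const_mul _ hG]
    rw [lintegral_mul_const _ hF]
  set q := (1 - α / 2)⁻¹ with hq
  have hq1 : 1 / q = 1 - α / 2 := by rw [hq]; simp
  have hq0 : 0 < q := inv_pos.2 (by linarith)
  have hq2 : q ≤ 2 := by rw [hq, inv_le_comm₀ (by linarith) two_pos]; linarith
  set C1 : ℝ := 2 / (1 - α) + 1 with hC1
  have hC1p : 0 < C1 := by have : 0 < 1 - α := by linarith
                           positivity
  set κ : ℝ → ℝ → ℝ≥0∞ := fun s t => ENNReal.ofReal C1 * ENNReal.ofReal (max s t ^ (-α)) with hκ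
  have mκ : Measurable (Function.uncurry κ) := by
    simp only [hκ, Function.uncurry_def]; fun_prop
  have hfin : ∀ {H : ℝ → ℝ≥0∞} (_ : volume (Function.support H) ≠ ⊤) (a : ℝ≥0∞),
      volume {t | a < H t} ≠ ⊤ := by
    intro H hH a
    refine ((measure_mono ?_).trans_lt hH.lt_top).ne
    intro t (ht : a < H t) (h : H t = 0)
    simp [h] at ht
  set Φ : ℝ → ℝ → ℝ≥0∞ := fun a b => ∫⁻ t, ∫⁻ τ, ENNReal.ofReal (|t - τ| ^ (-α)) *
    (ltInd (ENNReal.ofReal a) (F t) * ltInd (ENNReal.ofReal b) (G τ)) with hΦ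
  have step1 : ∫⁻ t, ∫⁻ τ, ENNReal.ofReal (|t - τ| ^ (-α)) * (F t * G τ)
      = ∫⁻ a in Ioi (0:ℝ), ∫⁻ b in Ioi (0:ℝ), Φ a b := by
    set m := (volume.restrict (Ioi (0:ℝ))).prod (volume.restrict (Ioi (0:ℝ))) with hm
    have hmeas : Measurable fun w : (ℝ × ℝ) × (ℝ × ℝ) => ENNReal.ofReal (|w.1.1 - w.1.2| ^ (-α)) *
      (ltInd (ENNReal.ofReal w.2.1) (F w.1.1) * ltInd (ENNReal.ofReal w.2.2) (G w.1.2)) := by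
      fun_prop
    calc _ = ∫⁻ z : ℝ × ℝ, ENNReal.ofReal (|z.1 - z.2| ^ (-α)) * (F z.1 * G z.2)
            ∂(volume.prod volume) := by
          rw [lintegral_prod _ (Measurable.aemeasurable (by fun_prop))]
      _ = ∫⁻ z : ℝ × ℝ, (∫⁻ w, ENNReal.ofReal (|z.1 - z.2| ^ (-α)) *
          (ltInd (ENNReal.ofReal w.1) (F z.1) * ltInd (ENNReal.ofReal w.2) (G z.2)) ∂m)
            ∂(volume.prod volume) := by
          refine lintegral_congr fun z => ?_
          rw [lintegral_const_mul _ (by fun_prop), hm,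
            lintegral_prod _ (Measurable.aemeasurable (by fun_prop)), lintegral_lintegral_ltInd]
      _ = ∫⁻ w, (∫⁻ z : ℝ × ℝ, ENNReal.ofReal (|z.1 - z.2| ^ (-α)) *
          (ltInd (ENNReal.ofReal w.1) (F z.1) * ltInd (ENNReal.ofReal w.2) (G z.2))
            ∂(volume.prod volume)) ∂m := lintegral_lintegral_swap hmeas.aemeasurable
      _ = _ := by
          rw [hm, lintegral_prod]
          · refine lintegral_congr fun a => lintegral_congr fun b => ?_
            rw [lintegral_prod _ (Measurable.aemeasurable (by fun_prop))]
          · exact (Measurable.lintegral_prod_right' (f := fun w : (ℝ × ℝ) × (ℝ × ℝ) =>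
              ENNReal.ofReal (|w.2.1 - w.2.2| ^ (-α)) * (ltInd (ENNReal.ofReal w.1.1) (F w.2.1)
              * ltInd (ENNReal.ofReal w.1.2) (G w.2.2))) (by fun_prop)).aemeasurable
  rw [step1]
  refine (lintegral_lintegral_distr_le (μ := volume) (ν := volume) (κ := κ) F G mκ ?_).trans ?_
  · intro a ha b hb
    set d := volume {x | ENNReal.ofReal a < F x} with hd
    set e := volume {x | ENNReal.ofReal b < G x} with he
    have hd' : d ≠ ⊤ := hfin hFs _
    have he' : e ≠ ⊤ := hfin hGs _
    have b1 : Φ a b ≤ ENNReal.ofReal C1 * e ^ (1 - α) * d :=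
      lintegral_ltInd_mul_abs_sub_le hα0 hα hF hG he'
    have b2 : Φ a b ≤ ENNReal.ofReal C1 * d ^ (1 - α) * e := by
      refine le_trans (le_of_eq ?_) (lintegral_ltInd_mul_abs_sub_le hα0 hα hG hF hd')
      simp only [hΦ]
      rw [lintegral_lintegral_swap (Measurable.aemeasurable (by fun_prop))]
      refine lintegral_congr fun t => lintegral_congr fun τ => ?_
      rw [abs_sub_comm, mul_comm (ltInd _ (F τ))]
    by_cases hd0 : d = 0
    · rw [hd0, mul_zero] at b1; exact b1.trans bot_le
    by_cases he0 : e = 0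
    · rw [he0, mul_zero] at b2; exact b2.trans bot_le
    have hpow : ∀ x : ℝ≥0∞, x ≠ 0 → x ≠ ⊤ → x ^ (1 - α) = x ^ (-α) * x := by
      intro x h0 h1
      nth_rw 3 [← ENNReal.rpow_one x]
      rw [← ENNReal.rpow_add _ _ h0 h1, neg_add_eq_sub]
    rw [hpow _ he0 he'] at b1
    rw [hpow _ hd0 hd'] at b2
    refine le_trans ?_ (lintegral_lintegral_mul_ltInd_ge
      (k := ENNReal.ofReal C1 * min (e ^ (-α)) (d ^ (-α))) ?_)
    · rcases le_total (e ^ (-α)) (d ^ (-α)) with h | h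
      · rw [min_eq_left h]; exact b1.trans (le_of_eq (by ring))
      · rw [min_eq_right h]; exact b2.trans (le_of_eq (by ring))
    · intro s hs t ht hsd hte
      simp only [hκ]
      gcongr
      rw [← ENNReal.ofReal_rpow_of_pos (lt_max_of_lt_left hs), ENNReal.rpow_neg, ENNReal.rpow_neg,
        ENNReal.rpow_neg]
      rcases le_total s t with h | h
      · rw [max_eq_right h]
        refine (min_le_left _ _).trans ?_
        gcongr
      · rw [max_eq_left h]
        refine (min_le_right _ _).trans ?_
        gcongr
  · refine (lintegral_kernel_rearr_le (q := q) (S := ENNReal.ofReal C1 * ENNReal.ofReal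
      (1 / (α / 2) + 1 / (α / 2))) _ _ mκ (fun s t => by simp only [hκ, max_comm]) ?_).trans ?_
    · intro s hs
      have hq' : 1 - 1 / q = α / 2 := by rw [hq1]; ring
      rw [hq']
      refine lintegral_le_of_le_powers hs (e₁ := α / 2) (e₂ := α / 2) (by positivity)
        (by positivity) ?_ ?_
      · intro t ht hts
        simp only [hκ]
        rw [max_eq_left hts, mul_assoc, ← ENNReal.ofReal_mul (by positivity),
          Real.mul_rpow hs.le ht.le, Real.rpow_sub ht, Real.rpow_one]
        refine le_of_eq ?_
        congr 2
        have : s ^ (-(α / 2)) = s ^ (-α) * s ^ (α / 2) := by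
          rw [← Real.rpow_add hs]; ring_nf
        rw [this]; ring
      · intro t hst
        have ht : 0 < t := hs.trans hst
        simp only [hκ]
        rw [max_eq_right hst.le, mul_assoc, ← ENNReal.ofReal_mul (by positivity),
          Real.mul_rpow hs.le ht.le, Real.rpow_sub ht, Real.rpow_one]
        refine le_of_eq ?_
        congr 2
        have : t ^ (-(α / 2)) = t ^ (-α) * t ^ (α / 2) := by
          rw [← Real.rpow_add ht]; ring_nf
        rw [this]; ring
    · rw [← hq1]
      unfold hlsConst
      gcongr
      · exact le_add_self
      · exact lor_le_lintegral_rpow hF hq0 hq2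
      · exact lor_le_lintegral_rpow hG hq0 hq2

end HardyLittlewoodSobolev

section SpaceTimeForm

set_option linter.unusedSectionVars false

variable {X Y Z : Type*} [MeasurableSpace X] [MeasurableSpace Y] [MeasurableSpace Z]

lemma Nice.form_integrand {μ : Measure X} {ν : Measure Y} [SFinite ν] {L : X → Y → ℂ}
    (hL : Measurable (Function.uncurry L)) (hb : ∃ M, ∀ x y, ‖L x y‖ ≤ M) {f : X → ℂ} {g : Y → ℂ}
    (hf : Nice μ f) (hg : Nice ν g) :
    Nice (μ.prod ν) (fun z => L z.1 z.2 * (f z.1 * g z.2)) where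
  meas := by
    have hL' : Measurable fun z : X × Y => L z.1 z.2 := hL
    have := hf.meas
    have := hg.meas
    fun_prop
  bdd := by
    obtain ⟨M, hM⟩ := hb
    obtain ⟨A, hA⟩ := hf.bdd
    obtain ⟨B, hB⟩ := hg.bdd
    refine ⟨M * (A * B), fun z => ?_⟩
    rw [norm_mul, norm_mul]
    have h1 := (norm_nonneg _).trans (hM z.1 z.2)
    have h2 := (norm_nonneg _).trans (hA z.1)
    gcongr
    exacts [hM _ _, hA _, hB _]
  supp := by
    refine (measure_mono (t := Function.support f ×ˢ Function.support g) ?_).trans_lt ?_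
    · intro z hz
      refine ⟨fun h => hz ?_, fun h => hz ?_⟩ <;> simp [h]
    · rw [Measure.prod_prod]
      exact ENNReal.mul_lt_top hf.supp hg.supp

lemma form_swap {μ : Measure X} {ν : Measure Y} [SFinite μ] [SFinite ν] (L : X → Y → ℂ) (f : X → ℂ)
    (g : Y → ℂ) : form μ ν L f g = form ν μ (fun y x => L x y) g f := by
  unfold form
  rw [← integral_prod_swap]
  refine integral_congr_ae (ae_of_all _ fun z => ?_)
  simp only [Prod.fst_swap, Prod.snd_swap, mul_comm (f _)]

lemma form_eq_integral {μ : Measure X} {ν : Measure Y} [SFinite μ] [SFinite ν] {L : X → Y → ℂ}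
    (hL : Measurable (Function.uncurry L)) (hb : ∃ M, ∀ x y, ‖L x y‖ ≤ M) {f : X → ℂ} {g : Y → ℂ}
    (hf : Nice μ f) (hg : Nice ν g) :
    form μ ν L f g = ∫ x, f x * ∫ y, L x y * g y ∂ν ∂μ := by
  unfold form
  rw [integral_prod _ (hf.form_integrand hL hb hg).integrable]
  refine integral_congr_ae (ae_of_all _ fun x => ?_)
  simp only
  rw [← integral_const_mul]
  refine integral_congr_ae (ae_of_all _ fun y => ?_)
  simp only; ring

/-- Bounded measurable functions on space-time supported in a box of finite measure. -/
structure BoxNice (μ : Measure X) (f : ℝ × X → ℂ) : Prop where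
  meas : Measurable f
  bdd : ∃ M : ℝ, ∀ z, ‖f z‖ ≤ M
  box : ∃ (T : ℝ) (B : Set X), μ B < ⊤ ∧ ∀ z, f z ≠ 0 → |z.1| ≤ T ∧ z.2 ∈ B

lemma BoxNice.nice {μ : Measure X} [SFinite μ] {f : ℝ × X → ℂ} (hf : BoxNice μ f) :
    Nice (volume.prod μ) f where
  meas := hf.meas
  bdd := hf.bdd
  supp := by
    obtain ⟨T, B, hB, h⟩ := hf.box
    refine (measure_mono (t := Icc (-T) T ×ˢ B) ?_).trans_lt ?_
    · exact fun z hz => ⟨abs_le.1 (h z hz).1, (h z hz).2⟩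
    · rw [Measure.prod_prod]
      exact ENNReal.mul_lt_top measure_Icc_lt_top hB

lemma BoxNice.slice {μ : Measure X} {f : ℝ × X → ℂ} (hf : BoxNice μ f) (t : ℝ) :
    Nice μ (fun x => f (t, x)) where
  meas := hf.meas.comp (by fun_prop)
  bdd := hf.bdd.imp fun M hM x => hM (t, x)
  supp := by
    obtain ⟨T, B, hB, h⟩ := hf.box
    exact (measure_mono fun x hx => (h (t, x) hx).2).trans_lt hB

lemma BoxNice.measurable_lor {μ : Measure X} [SFinite μ] {f : ℝ × X → ℂ} (hf : Measurable f)
    (q : ℝ) : Measurable (fun t => lor μ q (fun x => ‖f (t, x)‖ₑ)) :=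
  _root_.measurable_lor μ q (u := fun t x => ‖f (t, x)‖ₑ) hf.enorm

lemma BoxNice.support_lor {μ : Measure X} {f : ℝ × X → ℂ} (hf : BoxNice μ f) (q : ℝ) :
    volume (Function.support fun t => lor μ q (fun x => ‖f (t, x)‖ₑ)) ≠ ⊤ := by
  obtain ⟨T, B, hB, h⟩ := hf.box
  refine ((measure_mono (t := Icc (-T) T) ?_).trans_lt measure_Icc_lt_top).ne
  intro t ht
  by_contra hT
  refine ht ?_
  have : (fun x => ‖f (t, x)‖ₑ) = fun _ => 0 := by
    ext x
    by_contra hx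
    exact hT (abs_le.1 (h (t, x) (by simpa using hx)).1)
  simp only [this, lor_zero]

lemma form_prod_left {μ : Measure X} {ν : Measure Y} [SFinite μ] [SFinite ν] {K : ℝ × X → Y → ℂ}
    (hK : Measurable (Function.uncurry K)) (hb : ∃ M, ∀ x y, ‖K x y‖ ≤ M) {f : ℝ × X → ℂ}
    {g : Y → ℂ} (hf : BoxNice μ f) (hg : Nice ν g) :
    form (volume.prod μ) ν K f g = ∫ t, form μ ν (fun x => K (t, x)) (fun x => f (t, x)) g := by
  have h := (hf.nice.form_integrand hK hb hg).integrable
  unfold form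
  rw [integral_prod _ h, integral_prod _ h.integral_prod_left]
  refine integral_congr_ae (ae_of_all _ fun t => ?_)
  simp only
  rw [integral_prod]
  exact ((hf.slice t).form_integrand (L := fun x => K (t, x))
    (hK.comp (by fun_prop : Measurable fun z : X × Y => ((t, z.1), z.2)))
    (hb.imp fun M hM x y => hM _ _) hg).integrable

lemma enorm_form_le_lintegral_slices {μ : Measure X} [SFinite μ] {K : ℝ × X → ℝ × X → ℂ}
    (hK : Measurable (Function.uncurry K)) (hb : ∃ M, ∀ x y, ‖K x y‖ ≤ M) {f g : ℝ × X → ℂ}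
    (hf : BoxNice μ f) (hg : BoxNice μ g) :
    ‖form (volume.prod μ) (volume.prod μ) K f g‖ₑ ≤ ∫⁻ t, ∫⁻ τ,
      ‖form μ μ (fun x y => K (t, x) (τ, y)) (fun x => f (t, x)) (fun y => g (τ, y))‖ₑ := by
  rw [form_prod_left hK hb hf hg.nice]
  refine (enorm_integral_le_lintegral_enorm _).trans (lintegral_mono fun t => ?_)
  rw [form_swap, form_prod_left (K := fun y x => K (t, x) y)
    (hK.comp (by fun_prop : Measurable fun z : (ℝ × X) × X => ((t, z.2), z.1)))
    (hb.imp fun M hM x y => hM _ _) hg (hf.slice t)]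
  refine (enorm_integral_le_lintegral_enorm _).trans (lintegral_mono fun τ => ?_)
  rw [form_swap]

/-- Space-time kernels with bounded energy on time slices and dispersive decay of order `ν`. -/
structure DispersiveKernel (μ : Measure X) (ν : ℝ) (K : ℝ × X → ℝ × X → ℂ) : Prop where
  meas : Measurable (Function.uncurry K)
  bdd : ∃ M, ∀ z w, ‖K z w‖ ≤ M
  decay : ∀ z w, z.1 ≠ w.1 → ‖K z w‖ ≤ |z.1 - w.1| ^ (-ν)
  energy : ∀ t τ, ∀ f g, Nice μ f → Nice μ g →
    ‖form μ μ (fun x y => K (t, x) (τ, y)) f g‖ₑ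
      ≤ lor μ 2 (fun x => ‖f x‖ₑ) * lor μ 2 (fun x => ‖g x‖ₑ)

/-- The `L^{2/(2-α)}` norm in time of a nonnegative function. -/
noncomputable def inNorm (α : ℝ) (N : ℝ → ℝ≥0∞) : ℝ≥0∞ :=
  (∫⁻ t, N t ^ (1 - α / 2)⁻¹) ^ (1 - α / 2)

/-- The constant in the space-time bilinear estimate. -/
noncomputable def formConst (p α : ℝ) : ℝ≥0∞ :=
  (1 + ENNReal.ofReal (1 / (1 / p) + 1 / (1 / 2 - 1 / p))) * hlsConst α

lemma formConst_ne_top (p α : ℝ) : formConst p α ≠ ⊤ := by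
  unfold formConst hlsConst
  finiteness

lemma DispersiveKernel.enorm_form_slice_le {μ : Measure X} [SFinite μ] {ν p : ℝ}
    {K : ℝ × X → ℝ × X → ℂ} (hK : DispersiveKernel μ ν K) (hp : 2 ≤ p) {t τ : ℝ} (h : t ≠ τ)
    {f g : X → ℂ} (hf : Nice μ f) (hg : Nice μ g) :
    ‖form μ μ (fun x y => K (t, x) (τ, y)) f g‖ₑ ≤
      (1 + ENNReal.ofReal (1 / (1 / p) + 1 / (1 / 2 - 1 / p)))
      * (ENNReal.ofReal (|t - τ| ^ (-(ν * (1 - 2 / p))))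
      * (lor μ (p / (p - 1)) (fun x => ‖f x‖ₑ) * lor μ (p / (p - 1)) (fun x => ‖g x‖ₑ))) := by
  have hpos : 0 < |t - τ| := abs_pos.2 (sub_ne_zero.2 h)
  rcases hp.eq_or_lt with rfl | hp
  · refine (hK.energy t τ f g hf hg).trans ?_
    norm_num
    exact le_mul_of_one_le_left bot_le (by norm_num)
  · refine (enorm_form_le_lor (L := fun x y => K (t, x) (τ, y)) (lam := |t - τ| ^ (-ν))
      (hK.meas.comp (by fun_prop : Measurable fun z : X × X => ((t, z.1), (τ, z.2)))) (by positivity)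
      (fun x y => hK.decay _ _ h) (hK.energy t τ) hp hf hg).trans ?_
    rw [← Real.rpow_mul hpos.le, neg_mul]
    rw [mul_comm (ENNReal.ofReal (_ ^ _)), mul_assoc]
    gcongr
    exact le_add_self

lemma DispersiveKernel.enorm_form_le {μ : Measure X} [SFinite μ] {ν p α : ℝ}
    {K : ℝ × X → ℝ × X → ℂ} (hK : DispersiveKernel μ ν K) (hp : 2 ≤ p)
    (hα : ν * (1 - 2 / p) = α) (hα0 : 0 ≤ α) (hα1 : α < 1) {f g : ℝ × X → ℂ}
    (hf : BoxNice μ f) (hg : BoxNice μ g) :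
    ‖form (volume.prod μ) (volume.prod μ) K f g‖ₑ ≤ formConst p α *
      (inNorm α (fun t => lor μ (p / (p - 1)) fun x => ‖f (t, x)‖ₑ)
        * inNorm α (fun t => lor μ (p / (p - 1)) fun x => ‖g (t, x)‖ₑ)) := by
  set F := fun t => lor μ (p / (p - 1)) fun x => ‖f (t, x)‖ₑ with hF
  set G := fun t => lor μ (p / (p - 1)) fun x => ‖g (t, x)‖ₑ with hG
  set c := (1 + ENNReal.ofReal (1 / (1 / p) + 1 / (1 / 2 - 1 / p))) with hc
  have hc' : c ≠ ⊤ := by rw [hc]; finiteness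
  have mF : Measurable F := BoxNice.measurable_lor hf.meas _
  have mG : Measurable G := BoxNice.measurable_lor hg.meas _
  calc _ ≤ ∫⁻ t, ∫⁻ τ,
      ‖form μ μ (fun x y => K (t, x) (τ, y)) (fun x => f (t, x)) (fun y => g (τ, y))‖ₑ :=
        enorm_form_le_lintegral_slices hK.meas hK.bdd hf hg
    _ ≤ ∫⁻ t, ∫⁻ τ, c * (ENNReal.ofReal (|t - τ| ^ (-α)) * (F t * G τ)) := by
        refine lintegral_mono fun t => lintegral_mono_ae ?_
        filter_upwards [compl_mem_ae_iff.2 (measure_singleton (μ := volume) t)] with τ hτ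
        rw [← hα]
        exact hK.enorm_form_slice_le hp (fun h => hτ h.symm) (hf.slice t) (hg.slice τ)
    _ = c * ∫⁻ t, ∫⁻ τ, ENNReal.ofReal (|t - τ| ^ (-α)) * (F t * G τ) := by
        rw [← lintegral_const_mul' _ _ hc']
        refine lintegral_congr fun t => lintegral_const_mul' _ _ hc'
    _ ≤ c * (hlsConst α * (inNorm α F * inNorm α G)) := by
        gcongr
        exact hardyLittlewoodSobolev hα0 hα1 mF mG (hf.support_lor _) (hg.support_lor _)
    _ = _ := by unfold formConst; ring

end SpaceTimeForm

section WeightedRearrangement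

set_option linter.unusedSectionVars false

variable {X : Type*} [MeasurableSpace X]

/-- The measure of the set where `u` is at least `u x`, as a limit over rational levels. -/
noncomputable def superWeight (μ : Measure X) (u : X → ℝ≥0∞) (x : X) : ℝ≥0∞ :=
  ⨅ q : ℚ, if ENNReal.ofReal q < u x then μ {y | ENNReal.ofReal q < u y} else ⊤

lemma measurable_superWeight {T : Type*} [MeasurableSpace T] (μ : Measure X) [SFinite μ]
    {u : T → X → ℝ≥0∞} (hu : Measurable (Function.uncurry u)) :
    Measurable (fun z : T × X => superWeight μ (u z.1) z.2) := by
  refine Measurable.iInf fun q => Measurable.ite (measurableSet_lt measurable_const hu) ?_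
    measurable_const
  exact (measurable_distr_left μ hu _).comp measurable_fst

lemma le_superWeight {μ : Measure X} {u : X → ℝ≥0∞} {x : X} {s : ℝ} (h : u x ≤ rearr μ u s) :
    ENNReal.ofReal s ≤ superWeight μ u x := by
  refine le_iInf fun q => ?_
  split_ifs with hq
  · exact ((lt_rearr_iff μ u s _).1 (hq.trans_le h)).le
  · exact le_top

lemma superWeight_le {μ : Measure X} {u : X → ℝ≥0∞} {x : X} {a : ℝ≥0∞} (h : a < u x) :
    superWeight μ u x ≤ μ {y | a < u y} := by
  obtain ⟨q, -, hq1, hq2⟩ := ENNReal.lt_iff_exists_rat_btwn.1 h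
  refine (iInf_le _ q).trans ?_
  rw [if_pos (by exact hq2)]
  exact measure_mono fun y (hy : ENNReal.ofReal q < u y) => hq1.trans hy

lemma rearr_mul_superWeight_le (μ : Measure X) (u : X → ℝ≥0∞) {ρ : ℝ} (hρ : 0 ≤ ρ) (e : ℝ≥0∞)
    (s : ℝ) : rearr μ (fun x => u x * (superWeight μ u x + e) ^ (-ρ)) s
      ≤ rearr μ u s * (ENNReal.ofReal s + e) ^ (-ρ) := by
  refine rearr_le_of_measure_le ((measure_mono ?_).trans (measure_rearr_lt_le μ u s))
  intro x (hx : rearr μ u s * (ENNReal.ofReal s + e) ^ (-ρ)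
    < u x * (superWeight μ u x + e) ^ (-ρ))
  by_contra hle
  have hle : u x ≤ rearr μ u s := not_lt.1 hle
  refine absurd hx (not_lt.2 ?_)
  rw [ENNReal.rpow_neg, ENNReal.rpow_neg]
  gcongr
  exact le_superWeight hle

/-- The square of a regularised Lorentz norm. -/
noncomputable def regNorm (μ : Measure X) (ρ : ℝ) (e : ℝ≥0∞) (u : X → ℝ≥0∞) : ℝ≥0∞ :=
  ∫⁻ s in Ioi (0:ℝ), (ENNReal.ofReal s + e) ^ (-ρ) * rearr μ u s ^ 2

lemma lor_mul_superWeight_sq_le (μ : Measure X) (u : X → ℝ≥0∞) {ρ q : ℝ} (hρ : 0 ≤ ρ)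
    (hq : 2 / q - 1 = ρ) {e : ℝ≥0∞} (he : e ≠ ⊤) :
    lor μ q (fun x => u x * (superWeight μ u x + e) ^ (-ρ)) ^ 2 ≤ regNorm μ ρ e u := by
  rw [lor_sq, hq]
  refine setLIntegral_mono' measurableSet_Ioi fun s (hs : 0 < s) => ?_
  set w := ENNReal.ofReal s + e with hw
  have hw0 : w ≠ 0 := by simp [hw, hs]
  have hwt : w ≠ ⊤ := by simp [hw, he]
  calc _ ≤ w ^ ρ * (rearr μ u s * w ^ (-ρ)) ^ 2 := by
        gcongr
        · exact le_self_add
        · exact rearr_mul_superWeight_le μ u hρ e s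
    _ = (w ^ ρ * w ^ (-ρ)) * (w ^ (-ρ) * rearr μ u s ^ 2) := by ring
    _ = _ := by rw [← ENNReal.rpow_add _ _ hw0 hwt, add_neg_cancel, ENNReal.rpow_zero, one_mul]

lemma setLIntegral_add_rpow_neg_le {ρ η δ : ℝ} (hρ0 : 0 ≤ ρ) (hρ : ρ < 1) (hη : 0 < η)
    (hδ : 0 ≤ δ) :
    ENNReal.ofReal (1 - ρ) * ∫⁻ s in Ioo 0 δ, (ENNReal.ofReal s + ENNReal.ofReal η) ^ (-ρ)
      ≤ ENNReal.ofReal δ * (ENNReal.ofReal δ + ENNReal.ofReal η) ^ (-ρ) := by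
  have h1 : ∫⁻ s in Ioo 0 δ, (ENNReal.ofReal s + ENNReal.ofReal η) ^ (-ρ)
      = ENNReal.ofReal (∫ s in Ioc 0 δ, (s + η) ^ (-ρ)) := by
    rw [restrict_Ioo_eq_restrict_Ioc, ofReal_integral_eq_lintegral_ofReal]
    · refine setLIntegral_congr_fun measurableSet_Ioc fun s hs => ?_
      have := hs.1
      rw [← ENNReal.ofReal_add this.le hη.le, ENNReal.ofReal_rpow_of_pos (by positivity)]
    · refine Measure.integrableOn_of_bounded (M := η ^ (-ρ)) measure_Ioc_lt_top.ne
        (Measurable.aestronglyMeasurable (by fun_prop)) ?_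
      filter_upwards [self_mem_ae_restrict measurableSet_Ioc] with s hs
      have := hs.1
      rw [Real.norm_of_nonneg (by positivity)]
      exact Real.rpow_le_rpow_of_nonpos hη (by linarith) (by linarith)
    · filter_upwards [self_mem_ae_restrict measurableSet_Ioc] with s hs
      have := hs.1
      simp only [Pi.zero_apply]; positivity
  have hρ' : 0 < 1 - ρ := by linarith
  rw [h1, ← intervalIntegral.integral_of_le hδ,
    intervalIntegral.integral_comp_add_right (fun s => s ^ (-ρ)),
    integral_rpow (Or.inl (by linarith)), ← ENNReal.ofReal_mul hρ'.le,
    ← ENNReal.ofReal_add hδ hη.le, ENNReal.ofReal_rpow_of_pos (by positivity),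
    ← ENNReal.ofReal_mul hδ]
  refine ENNReal.ofReal_le_ofReal ?_
  rw [neg_add_eq_sub, zero_add, mul_div_cancel₀ _ hρ'.ne']
  have e1 : (δ + η) ^ (1 - ρ) = (δ + η) * (δ + η) ^ (-ρ) := by
    rw [sub_eq_add_neg, Real.rpow_add (by positivity), Real.rpow_one]
  have e2 : η ^ (1 - ρ) = η * η ^ (-ρ) := by
    rw [sub_eq_add_neg, Real.rpow_add hη, Real.rpow_one]
  have e3 : (δ + η) ^ (-ρ) ≤ η ^ (-ρ) :=
    Real.rpow_le_rpow_of_nonpos hη (by linarith) (by linarith)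
  rw [e1, e2]
  nlinarith

lemma regNorm_le_lintegral_superWeight {μ : Measure X} [SFinite μ] {u : X → ℝ≥0∞}
    (hu : Measurable u) (hfin : ∀ a, μ {x | ENNReal.ofReal a < u x} ≠ ⊤) {ρ η : ℝ} (hρ0 : 0 ≤ ρ)
    (hρ : ρ < 1) (hη : 0 < η) :
    ENNReal.ofReal (1 - ρ) * regNorm μ ρ (ENNReal.ofReal η) u
      ≤ ∫⁻ x, u x ^ 2 * (superWeight μ u x + ENNReal.ofReal η) ^ (-ρ) ∂μ := by
  have mW : Measurable fun x => superWeight μ u x :=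
    (measurable_superWeight μ (u := fun _ : Unit => u) (hu.comp measurable_snd)).comp
      (measurable_const (a := ()).prodMk measurable_id)
  have md := measurable_distr_right μ u
  unfold regNorm
  rw [lintegral_mul_rearr_sq (by fun_prop), ← lintegral_const_mul' _ _ ENNReal.ofReal_ne_top]
  have hR : ∫⁻ x, u x ^ 2 * (superWeight μ u x + ENNReal.ofReal η) ^ (-ρ) ∂μ
      = ∫⁻ a in Ioi (0:ℝ), ∫⁻ x, ENNReal.ofReal (2 * a) * ltInd (ENNReal.ofReal a) (u x)
        * (superWeight μ u x + ENNReal.ofReal η) ^ (-ρ) ∂μ := by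
    rw [lintegral_lintegral_swap (Measurable.aemeasurable (by fun_prop))]
    refine lintegral_congr fun x => ?_
    rw [lintegral_mul_const _ (by fun_prop), lintegral_two_mul_ltInd]
  rw [hR]
  refine lintegral_mono fun a => ?_
  set d := μ {x | ENNReal.ofReal a < u x} with hd
  have hdδ : d = ENNReal.ofReal d.toReal := (ENNReal.ofReal_toReal (hfin a)).symm
  calc ENNReal.ofReal (1 - ρ) * (ENNReal.ofReal (2 * a) * ∫⁻ s in Ioi (0:ℝ),
        (ENNReal.ofReal s + ENNReal.ofReal η) ^ (-ρ) * ltInd (ENNReal.ofReal s) d)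
      = ENNReal.ofReal (2 * a) * (ENNReal.ofReal (1 - ρ) * ∫⁻ s in Ioi (0:ℝ),
        (ENNReal.ofReal s + ENNReal.ofReal η) ^ (-ρ) * ltInd (ENNReal.ofReal s) d) := by ring
    _ ≤ ENNReal.ofReal (2 * a) * (d * (d + ENNReal.ofReal η) ^ (-ρ)) := by
        refine mul_le_mul_right ?_ _
        rw [hdδ, lintegral_mul_ltInd_ofReal]
        exact setLIntegral_add_rpow_neg_le hρ0 hρ hη ENNReal.toReal_nonneg
    _ = ∫⁻ x, ENNReal.ofReal (2 * a) * ltInd (ENNReal.ofReal a) (u x)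
        * (d + ENNReal.ofReal η) ^ (-ρ) ∂μ := by
        rw [lintegral_mul_const _ (by fun_prop), lintegral_const_mul _ (by fun_prop), mul_assoc]
        congr 2
        have hA : MeasurableSet {x | ENNReal.ofReal a < u x} :=
          measurableSet_lt measurable_const hu
        rw [hd, ← lintegral_indicator_one hA]
        simp [indicator, ltInd]
    _ ≤ _ := by
        refine lintegral_mono fun x => ?_
        by_cases h : ENNReal.ofReal a < u x
        · rw [ENNReal.rpow_neg, ENNReal.rpow_neg]
          gcongr
          exact superWeight_le h
        · simp [ltInd, h]

end WeightedRearrangement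

section ConverseHolder

set_option linter.unusedSectionVars false

variable {X : Type*} [MeasurableSpace X]

lemma lor_const_mul_le (μ : Measure X) (q : ℝ) (c : ℝ≥0∞) (u : X → ℝ≥0∞) :
    lor μ q (fun x => c * u x) ≤ c * lor μ q u := by
  have h : ∀ s, rearr μ (fun x => c * u x) s ≤ c * rearr μ u s := by
    intro s
    refine rearr_le_of_measure_le ((measure_mono ?_).trans (measure_rearr_lt_le μ u s))
    intro x (hx : c * rearr μ u s < c * u x)
    exact lt_of_mul_lt_mul_left' hx
  by_cases hc : c = ⊤
  · subst hc
    by_cases h0 : lor μ q u = 0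
    · have h1 : ∀ᵐ s ∂volume.restrict (Ioi (0:ℝ)),
          ENNReal.ofReal s ^ (2 / q - 1) * rearr μ u s ^ 2 = 0 := by
        rw [lor, ENNReal.rpow_eq_zero_iff] at h0
        rcases h0 with h0 | h0
        · exact (lintegral_eq_zero_iff (by fun_prop)).1 h0.1
        · norm_num at h0
      rw [h0, mul_zero, lor]
      refine le_of_eq (ENNReal.rpow_eq_zero_iff.2 (Or.inl ⟨?_, by norm_num⟩))
      refine (lintegral_eq_zero_iff (by fun_prop)).2 ?_
      filter_upwards [h1, self_mem_ae_restrict measurableSet_Ioi] with s hs (hs0 : 0 < s)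
      have h2 : rearr μ u s = 0 := by
        rcases mul_eq_zero.1 hs with h | h
        · rw [ENNReal.ofReal_rpow_of_pos hs0, ENNReal.ofReal_eq_zero] at h
          exact absurd h (not_le.2 (by positivity))
        · simpa using h
      have h3 := h s
      rw [h2, mul_zero] at h3
      simp [le_antisymm h3 bot_le]
    · rw [ENNReal.top_mul h0]; exact le_top
  · have : c * lor μ q u = (c ^ 2 * ∫⁻ t in Ioi (0:ℝ),
        ENNReal.ofReal t ^ (2 / q - 1) * rearr μ u t ^ 2) ^ (1 / 2 : ℝ) := by
      rw [ENNReal.mul_rpow_of_nonneg _ _ (by norm_num), ← ENNReal.rpow_ofNat, ← ENNReal.rpow_mul]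
      norm_num [lor]
    rw [this, ← lintegral_const_mul _ (by fun_prop), lor]
    refine ENNReal.rpow_le_rpow (lintegral_mono fun t => ?_) (by norm_num)
    calc ENNReal.ofReal t ^ (2 / q - 1) * rearr μ (fun x => c * u x) t ^ 2
        ≤ ENNReal.ofReal t ^ (2 / q - 1) * (c * rearr μ u t) ^ 2 :=
          mul_le_mul_right (pow_le_pow_left' (h t) 2) _
      _ = _ := by ring

lemma enorm_integral_ofReal_of_nonneg {Z : Type*} [MeasurableSpace Z] {m : Measure Z} {h : Z → ℝ}
    (hi : Integrable (fun z => (h z : ℂ)) m) (h0 : ∀ z, 0 ≤ h z) :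
    ‖∫ z, (h z : ℂ) ∂m‖ₑ = ∫⁻ z, ENNReal.ofReal (h z) ∂m := by
  have hi' : Integrable h m := by simpa using hi.re
  rw [integral_complex_ofReal, ← ofReal_norm, Complex.norm_real,
    Real.norm_of_nonneg (integral_nonneg h0), ofReal_integral_eq_lintegral_ofReal hi'
    (ae_of_all _ h0)]

/-- The `L^{2/α}` norm in time of a nonnegative function. -/
noncomputable def outNorm (α : ℝ) (N : ℝ → ℝ≥0∞) : ℝ≥0∞ :=
  if α = 0 then essSup N volume else (∫⁻ t, N t ^ (2 / α)) ^ (α / 2)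

lemma measurable_regNorm {μ : Measure X} [SFinite μ] {T : Type*} [MeasurableSpace T]
    {u : T → X → ℝ≥0∞} (hu : Measurable (Function.uncurry u)) (ρ : ℝ) (e : ℝ≥0∞) :
    Measurable (fun t => regNorm μ ρ e (u t)) := by
  have := measurable_rearr_prod μ hu
  exact Measurable.lintegral_prod_right' (f := fun z : T × ℝ =>
    (ENNReal.ofReal z.2 + e) ^ (-ρ) * rearr μ (u z.1) z.2 ^ 2) (by fun_prop)

lemma regNorm_le_lintegral_sq {μ : Measure X} [SFinite μ] {u : X → ℝ≥0∞} (hu : Measurable u) {ρ : ℝ}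
    (hρ : 0 ≤ ρ) (e : ℝ≥0∞) : regNorm μ ρ e u ≤ e ^ (-ρ) * ∫⁻ x, u x ^ 2 ∂μ := by
  have h := lintegral_rearr_rpow (μ := μ) hu (q := 2) two_pos
  simp only [ENNReal.rpow_ofNat] at h
  rw [← h, ← lintegral_const_mul _ (by fun_prop)]
  unfold regNorm
  refine lintegral_mono fun s => mul_le_mul_left ?_ _
  rw [ENNReal.rpow_neg, ENNReal.rpow_neg]
  gcongr
  exact le_add_self

set_option maxHeartbeats 1000000 in
lemma lintegral_regNorm_rpow_le {μ : Measure X} [SFinite μ] {F : ℝ × X → ℂ} (hF : BoxNice μ F)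
    {p α ρ η : ℝ} (hp : 2 < p) (hρ : ρ = 1 - 2 / p) (hα0 : 0 < α) (hα1 : α < 1) (hη : 0 < η)
    {A : ℝ≥0∞}
    (hA : ∀ g, BoxNice μ g → ‖∫ z, F z * g z ∂(volume.prod μ)‖ₑ
      ≤ A * inNorm α (fun t => lor μ (p / (p - 1)) fun x => ‖g (t, x)‖ₑ)) :
    ENNReal.ofReal (2 / p) *
      (∫⁻ t, regNorm μ ρ (ENNReal.ofReal η) (fun x => ‖F (t, x)‖ₑ) ^ (1 / α)) ^ (α / 2) ≤ A := by
  have hp0 : 0 < p := by linarith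
  have hp2 : 2 / p < 1 := by rw [div_lt_one hp0]; exact hp
  have hρ0 : 0 < ρ := by rw [hρ]; linarith
  have hρ1 : ρ < 1 := by
    have : 0 < 2 / p := by positivity
    linarith
  have hα' : 1 < 1 / α := by rw [lt_div_iff₀ hα0]; linarith
  set e := ENNReal.ofReal η with he
  have he0 : e ≠ 0 := by simp [he, hη]
  have het : e ≠ ⊤ := ENNReal.ofReal_ne_top
  set u : ℝ → X → ℝ≥0∞ := fun t x => ‖F (t, x)‖ₑ with hu
  have mu : Measurable (Function.uncurry u) := hF.meas.enorm
  have hmu_t : ∀ t, Measurable (u t) := fun t => mu.comp (by fun_prop : Measurable fun x => (t, x))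
  set P : ℝ → ℝ≥0∞ := fun t => regNorm μ ρ e (u t) with hP
  have mP : Measurable P := measurable_regNorm mu ρ e
  have msw : Measurable (fun z : ℝ × X => superWeight μ (u z.1) z.2) := measurable_superWeight μ mu
  obtain ⟨M, hM⟩ := hF.bdd
  obtain ⟨T, B, hB, hTB⟩ := hF.box
  set Q : ℝ≥0∞ := e ^ (-ρ) * (ENNReal.ofReal M ^ 2 * μ B) with hQ
  have hBm : μ (toMeasurable μ B) = μ B := measure_toMeasurable B
  have heρ : e ^ (-ρ) ≠ ⊤ := by
    rw [he, ENNReal.ofReal_rpow_of_pos hη]; exact ENNReal.ofReal_ne_top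
  have hQt : Q ≠ ⊤ := ENNReal.mul_ne_top heρ (ENNReal.mul_ne_top (by finiteness) hB.ne)
  have hPQ : ∀ t, P t ≤ Q := by
    intro t
    refine (regNorm_le_lintegral_sq (hmu_t t) hρ0.le e).trans ?_
    rw [hQ, ← hBm]
    gcongr
    rw [← setLIntegral_const, ← lintegral_indicator (measurableSet_toMeasurable _ _)]
    refine lintegral_mono fun x => ?_
    by_cases hx : F (t, x) = 0
    · simp [hu, hx]
    · rw [indicator_of_mem (subset_toMeasurable _ _ (hTB _ hx).2)]
      gcongr
      simp only [hu]
      rw [← ofReal_norm]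
      exact ENNReal.ofReal_le_ofReal (hM _)
  have hPT : ∀ t, t ∉ Icc (-T) T → P t = 0 := by
    intro t ht
    have h0 : u t = fun _ => 0 := by
      ext x
      by_contra hx
      exact ht (abs_le.1 (hTB (t, x) (by simpa [hu] using hx)).1)
    simp [hP, regNorm, h0, rearr_zero]
  set J := ∫⁻ t, P t ^ (1 / α) with hJ
  have hJt : J ≠ ⊤ := by
    have : J ≤ ∫⁻ t in Icc (-T) T, Q ^ (1 / α) := by
      rw [hJ, ← lintegral_indicator measurableSet_Icc]
      refine lintegral_mono fun t => ?_
      by_cases ht : t ∈ Icc (-T) T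
      · rw [indicator_of_mem ht]
        gcongr
        exact hPQ t
      · rw [hPT t ht, ENNReal.zero_rpow_of_pos (by linarith)]; exact bot_le
    refine (this.trans_lt ?_).ne
    rw [setLIntegral_const]
    exact ENNReal.mul_lt_top (ENNReal.rpow_lt_top_of_nonneg (by linarith) hQt)
      measure_Icc_lt_top
  set w : ℝ × X → ℝ≥0∞ := fun z =>
    P z.1 ^ (1 / α - 1) * (superWeight μ (u z.1) z.2 + e) ^ (-ρ) with hw
  have mw : Measurable w := by
    have : Measurable fun z : ℝ × X => P z.1 := mP.comp measurable_fst
    fun_prop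
  set W : ℝ≥0∞ := Q ^ (1 / α - 1) * e ^ (-ρ) with hW
  have hWt : W ≠ ⊤ := ENNReal.mul_ne_top (ENNReal.rpow_ne_top_of_nonneg (by linarith) hQt) heρ
  have hwW : ∀ z, w z ≤ W := by
    intro z
    have : (superWeight μ (u z.1) z.2 + e) ^ (-ρ) ≤ e ^ (-ρ) := by
      rw [ENNReal.rpow_neg, ENNReal.rpow_neg]
      gcongr
      exact le_add_self
    refine mul_le_mul' (ENNReal.rpow_le_rpow (hPQ _) (by linarith)) this
  have hwt : ∀ z, w z ≠ ⊤ := fun z => ((hwW z).trans_lt hWt.lt_top).ne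
  set g : ℝ × X → ℂ := fun z => (starRingEnd ℂ) (F z) * ((w z).toReal : ℂ) with hg
  have gnice : BoxNice μ g :=
    { meas := by
        have := hF.meas
        have h2 : Measurable fun z => (starRingEnd ℂ) (F z) := Complex.continuous_conj.measurable.comp this
        fun_prop
      bdd := by
        refine ⟨M * W.toReal, fun z => ?_⟩
        simp only [hg, norm_mul, RCLike.norm_conj, Complex.norm_real,
          Real.norm_of_nonneg ENNReal.toReal_nonneg]
        have := (norm_nonneg _).trans (hM z)
        gcongr
        · exact hM z
        exact hwW z
      box := ⟨T, B, hB, fun z hz => hTB z fun h => hz (by simp [hg, h])⟩ }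
  have hgn : ∀ z, ‖g z‖ₑ = w z * ‖F z‖ₑ := by
    intro z
    simp only [hg, enorm_mul]
    rw [← ofReal_norm, ← ofReal_norm, RCLike.norm_conj, Complex.norm_real,
      Real.norm_of_nonneg ENNReal.toReal_nonneg, ENNReal.ofReal_toReal (hwt z), ofReal_norm, mul_comm]
  have lower : ENNReal.ofReal (2 / p) * J ≤ ‖∫ z, F z * g z ∂(volume.prod μ)‖ₑ := by
    have hFg : ∀ z, F z * g z = ((Complex.normSq (F z) * (w z).toReal : ℝ) : ℂ) := by
      intro z
      simp only [hg]
      rw [← mul_assoc, Complex.mul_conj]; push_cast; rfl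
    have hint : Integrable (fun z => F z * g z) (volume.prod μ) :=
      gnice.nice.integrable.bdd_mul hF.meas.aestronglyMeasurable (ae_of_all _ hM)
    simp_rw [hFg] at hint ⊢
    rw [enorm_integral_ofReal_of_nonneg hint
      (fun z => mul_nonneg (Complex.normSq_nonneg _) ENNReal.toReal_nonneg)]
    have e1 : ∀ z, ENNReal.ofReal (Complex.normSq (F z) * (w z).toReal) = ‖F z‖ₑ ^ 2 * w z := by
      intro z
      rw [ENNReal.ofReal_mul (Complex.normSq_nonneg _), ENNReal.ofReal_toReal (hwt z),
        Complex.normSq_eq_norm_sq, ENNReal.ofReal_pow (norm_nonneg _), ofReal_norm]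
    simp_rw [e1]
    have mF := hF.meas
    rw [lintegral_prod _ (Measurable.aemeasurable (by fun_prop)), hJ,
      ← lintegral_const_mul _ (by fun_prop)]
    refine lintegral_mono fun t => ?_
    have mst : Measurable fun x => superWeight μ (u t) x :=
      msw.comp (by fun_prop : Measurable fun x => (t, x))
    have hr := regNorm_le_lintegral_superWeight (μ := μ) (hmu_t t)
      (fun a => ((hF.slice t).measure_lt a).ne) hρ0.le hρ1 hη
    have hρp : 1 - ρ = 2 / p := by rw [hρ]; ring
    rw [hρp] at hr
    calc ENNReal.ofReal (2 / p) * P t ^ (1 / α)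
        = P t ^ (1 / α - 1) * (ENNReal.ofReal (2 / p) * P t) := by
          have : P t ^ (1 / α) = P t ^ (1 / α - 1) * P t := by
            nth_rw 3 [← ENNReal.rpow_one (P t)]
            rw [← ENNReal.rpow_add_of_nonneg _ _ (by linarith) zero_le_one, sub_add_cancel]
          rw [this]; ring
      _ ≤ P t ^ (1 / α - 1) * ∫⁻ x, u t x ^ 2 * (superWeight μ (u t) x + e) ^ (-ρ) ∂μ := by
          gcongr
      _ = ∫⁻ x, ‖F (t, x)‖ₑ ^ 2 * w (t, x) ∂μ := by
          rw [← lintegral_const_mul _ (by fun_prop)]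
          refine lintegral_congr fun x => ?_
          simp only [hw, hu]; ring
  have upper : inNorm α (fun t => lor μ (p / (p - 1)) fun x => ‖g (t, x)‖ₑ) ≤ J ^ (1 - α / 2) := by
    unfold inNorm
    rw [hJ]
    refine ENNReal.rpow_le_rpow (lintegral_mono fun t => ?_) (by linarith)
    have hp1 : 2 / (p / (p - 1)) - 1 = ρ := by rw [hρ]; field_simp; ring
    have h1 := lor_mul_superWeight_sq_le μ (u t) hρ0.le hp1 het
    have h2 : lor μ (p / (p - 1)) (fun x => u t x * (superWeight μ (u t) x + e) ^ (-ρ))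
        ≤ P t ^ (1 / 2 : ℝ) := by
      rw [← ENNReal.rpow_ofNat] at h1
      rw [one_div]
      exact (ENNReal.le_rpow_inv_iff two_pos).2 h1
    have h3 : lor μ (p / (p - 1)) (fun x => ‖g (t, x)‖ₑ)
        ≤ P t ^ (1 / α - 1) * P t ^ (1 / 2 : ℝ) := by
      refine le_trans (le_of_eq ?_) ((lor_const_mul_le μ _ (P t ^ (1 / α - 1))
        (fun x => u t x * (superWeight μ (u t) x + e) ^ (-ρ))).trans (by gcongr))
      congr 1
      ext x
      rw [hgn]; simp only [hw, hu]; ring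
    rw [← ENNReal.rpow_add_of_nonneg _ _ (by linarith) (by norm_num)] at h3
    refine (ENNReal.rpow_le_rpow h3 (inv_nonneg.2 (by linarith))).trans (le_of_eq ?_)
    rw [← ENNReal.rpow_mul]
    congr 1
    have h4 : 1 - α / 2 ≠ 0 := by linarith
    have h5 : 2 - α ≠ 0 := by linarith
    field_simp
    ring
  have main := lower.trans ((hA g gnice).trans (mul_le_mul_right upper A))
  by_cases hJ0 : J = 0
  · rw [hJ0, ENNReal.zero_rpow_of_pos (by linarith), mul_zero]; exact bot_le
  have hJJ : J = J ^ (α / 2) * J ^ (1 - α / 2) := by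
    rw [← ENNReal.rpow_add _ _ hJ0 hJt]; simp
  nth_rw 1 [hJJ] at main
  rw [← mul_assoc] at main
  refine (ENNReal.mul_le_mul_iff_left ?_ ?_).1 main
  · simp [ENNReal.rpow_eq_zero_iff, hJ0, hJt]
  · exact ENNReal.rpow_ne_top_of_nonneg (by linarith) hJt

end ConverseHolder

section ConverseHolderLimit

set_option linter.unusedSectionVars false

variable {X : Type*} [MeasurableSpace X]

lemma outNorm_le_of_le_liminf {α : ℝ} (hα : 0 ≤ α) {N : ℝ → ℝ≥0∞} {M : ℕ → ℝ → ℝ≥0∞}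
    (hM : ∀ k, Measurable (M k)) (h : ∀ᵐ t, N t ≤ liminf (fun k => M k t) atTop) {C : ℝ≥0∞}
    (hC : ∀ k, outNorm α (M k) ≤ C) : outNorm α N ≤ C := by
  unfold outNorm at hC ⊢
  split_ifs at hC ⊢ with h0
  · have h1 : ∀ᵐ t, ∀ k, M k t ≤ C := by
      rw [ae_all_iff]
      intro k
      filter_upwards [ENNReal.ae_le_essSup (μ := volume) (M k)] with t ht
      exact ht.trans (hC k)
    refine essSup_le_of_ae_le _ ?_
    filter_upwards [h, h1] with t ht h1t
    exact ht.trans ((liminf_le_liminf (Eventually.of_forall h1t)).trans_eq (liminf_const _))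
  · have hα' : 0 < α := lt_of_le_of_ne hα (Ne.symm h0)
    calc (∫⁻ t, N t ^ (2 / α)) ^ (α / 2)
        ≤ (∫⁻ t, liminf (fun k => M k t ^ (2 / α)) atTop) ^ (α / 2) := by
          refine ENNReal.rpow_le_rpow (lintegral_mono_ae ?_) (by linarith)
          filter_upwards [h] with t ht
          rw [← ENNReal.rpow_liminf_le _ (by positivity)]
          exact ENNReal.rpow_le_rpow ht (by positivity)
      _ ≤ (liminf (fun k => ∫⁻ t, M k t ^ (2 / α)) atTop) ^ (α / 2) := by
          refine ENNReal.rpow_le_rpow (lintegral_liminf_le fun k => ?_) (by linarith)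
          exact (hM k).pow_const _
      _ = liminf (fun k => (∫⁻ t, M k t ^ (2 / α)) ^ (α / 2)) atTop :=
          ENNReal.rpow_liminf_le _ (by positivity)
      _ ≤ C := (liminf_le_liminf (Eventually.of_forall hC)).trans_eq (liminf_const _)

lemma inNorm_mono {α : ℝ} (hα : α < 1) {N M : ℝ → ℝ≥0∞} (h : ∀ᵐ t, N t ≤ M t) :
    inNorm α N ≤ inNorm α M := by
  unfold inNorm
  refine ENNReal.rpow_le_rpow (lintegral_mono_ae ?_) (by linarith)
  filter_upwards [h] with t ht
  exact ENNReal.rpow_le_rpow ht (inv_nonneg.2 (by linarith))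

lemma lor_sq_le_liminf_regNorm (μ : Measure X) {p ρ : ℝ} (hρ : 2 / p - 1 = -ρ)
    (u : X → ℝ≥0∞) :
    lor μ p u ^ 2 ≤
      liminf (fun k : ℕ => regNorm μ ρ (ENNReal.ofReal (1 / ((k : ℝ) + 1))) u) atTop := by
  rw [lor_sq, hρ]
  refine le_trans ?_ (lintegral_liminf_le fun k => by fun_prop)
  refine setLIntegral_mono_ae' measurableSet_Ioi (ae_of_all _ fun s (hs : 0 < s) => ?_)
  have h1 : Tendsto (fun k : ℕ => ENNReal.ofReal (1 / ((k : ℝ) + 1))) atTop (nhds 0) := by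
    have := (ENNReal.continuous_ofReal.tendsto 0).comp tendsto_one_div_add_atTop_nhds_zero_nat
    simpa [Function.comp_def] using this
  have h2 : Tendsto (fun k : ℕ => (ENNReal.ofReal s + ENNReal.ofReal (1 / ((k : ℝ) + 1))) ^ (-ρ))
      atTop (nhds (ENNReal.ofReal s ^ (-ρ))) := by
    refine (ENNReal.continuous_rpow_const.tendsto _).comp ?_
    simpa using h1.const_add (ENNReal.ofReal s)
  have h3 : ENNReal.ofReal s ^ (-ρ) ≠ 0 := by
    rw [ENNReal.ofReal_rpow_of_pos hs]
    simp only [ne_eq, ENNReal.ofReal_eq_zero, not_le]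
    positivity
  exact (ENNReal.Tendsto.mul_const h2 (Or.inl h3)).liminf_eq.ge

lemma outNorm_le_of_boxNice {μ : Measure X} [SFinite μ] {F : ℝ × X → ℂ} (hF : BoxNice μ F)
    {p α : ℝ} (hp : 2 < p) (hα0 : 0 < α) (hα1 : α < 1) {A : ℝ≥0∞}
    (hA : ∀ g, BoxNice μ g → ‖∫ z, F z * g z ∂(volume.prod μ)‖ₑ
      ≤ A * inNorm α (fun t => lor μ (p / (p - 1)) fun x => ‖g (t, x)‖ₑ)) :
    outNorm α (fun t => lor μ p fun x => ‖F (t, x)‖ₑ) ≤ (ENNReal.ofReal (2 / p))⁻¹ * A := by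
  have hp0 : 0 < p := by linarith
  have mF := hF.meas
  have key : ∀ k : ℕ, outNorm α (fun t => regNorm μ (1 - 2 / p)
      (ENNReal.ofReal (1 / ((k : ℝ) + 1))) (fun x => ‖F (t, x)‖ₑ) ^ (1 / 2 : ℝ))
      ≤ (ENNReal.ofReal (2 / p))⁻¹ * A := by
    intro k
    have := lintegral_regNorm_rpow_le hF hp rfl hα0 hα1 (η := 1 / ((k : ℝ) + 1)) (by positivity) hA
    unfold outNorm
    rw [if_neg hα0.ne']
    simp_rw [← ENNReal.rpow_mul]
    have e : 1 / 2 * (2 / α) = 1 / α := by field_simp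
    rw [e]
    have h2p : ENNReal.ofReal (2 / p) ≠ 0 := by
      simp only [ne_eq, ENNReal.ofReal_eq_zero, not_le]; positivity
    rw [mul_comm, ← div_eq_mul_inv]
    rwa [ENNReal.le_div_iff_mul_le (Or.inl h2p) (Or.inl ENNReal.ofReal_ne_top), mul_comm]
  refine outNorm_le_of_le_liminf hα0.le (fun k => ?_) (ae_of_all _ fun t => ?_) key
  · exact (measurable_regNorm (u := fun t x => ‖F (t, x)‖ₑ) mF.enorm _ _).pow_const _
  · rw [← ENNReal.rpow_liminf_le _ (by norm_num)]
    have h := lor_sq_le_liminf_regNorm μ (p := p) (ρ := 1 - 2 / p) (by ring) (fun x => ‖F (t, x)‖ₑ)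
    rw [← ENNReal.rpow_ofNat] at h
    rw [one_div]
    exact (ENNReal.le_rpow_inv_iff two_pos).2 h

/-- Converse Hölder inequality for mixed Lorentz norms of bounded functions. -/
lemma outNorm_le_of_forall_boxNice {μ : Measure X} [SigmaFinite μ] {F : ℝ × X → ℂ}
    (mF : Measurable F) (bF : ∃ M, ∀ z, ‖F z‖ ≤ M)
    {p α : ℝ} (hp : 2 < p) (hα0 : 0 < α) (hα1 : α < 1) {A : ℝ≥0∞}
    (hA : ∀ g, BoxNice μ g → ‖∫ z, F z * g z ∂(volume.prod μ)‖ₑ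
      ≤ A * inNorm α (fun t => lor μ (p / (p - 1)) fun x => ‖g (t, x)‖ₑ)) :
    outNorm α (fun t => lor μ p fun x => ‖F (t, x)‖ₑ) ≤ (ENNReal.ofReal (2 / p))⁻¹ * A := by
  set S : ℕ → Set (ℝ × X) := fun k => Icc (-(k : ℝ)) k ×ˢ spanningSets μ k with hS
  have mS : ∀ k, MeasurableSet (S k) := fun k =>
    measurableSet_Icc.prod (measurableSet_spanningSets μ k)
  obtain ⟨M, hM⟩ := bF
  have box : ∀ (k : ℕ) (G : ℝ × X → ℂ), Measurable G → (∃ M, ∀ z, ‖G z‖ ≤ M) →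
      BoxNice μ ((S k).indicator G) := by
    rintro k G mG ⟨M', hM'⟩
    refine ⟨mG.indicator (mS k), ⟨M', fun z => ?_⟩,
      ⟨k, spanningSets μ k, measure_spanningSets_lt_top μ k, fun z hz => ?_⟩⟩
    · exact (norm_indicator_le_norm_self _ _).trans (hM' z)
    · have : z ∈ S k := by
        by_contra h
        exact hz (indicator_of_notMem h _)
      exact ⟨abs_le.2 this.1, this.2⟩
  have bk : ∀ k, BoxNice μ ((S k).indicator F) := fun k => box k F mF ⟨M, hM⟩
  refine outNorm_le_of_le_liminf hα0.le
    (M := fun k t => lor μ p fun x => ‖(S k).indicator F (t, x)‖ₑ)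
    (fun k => BoxNice.measurable_lor (bk k).meas _) (ae_of_all _ fun t => ?_) fun k => ?_
  · refine lor_le_liminf p (fun k => ?_) fun x => ?_
    · have := (bk k).meas
      fun_prop
    · refine le_liminf_of_le (by isBoundedDefault) ?_
      obtain ⟨k₁, hk₁⟩ := exists_nat_ge |t|
      filter_upwards [eventually_ge_atTop (max k₁ (spanningSetsIndex μ x))] with k hk
      have : (t, x) ∈ S k := by
        refine ⟨abs_le.1 (hk₁.trans ?_), ?_⟩
        · exact_mod_cast (le_max_left _ _).trans hk
        · exact monotone_spanningSets μ ((le_max_right _ _).trans hk)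
            (mem_spanningSetsIndex μ x)
      rw [indicator_of_mem this]
  · refine outNorm_le_of_boxNice (bk k) hp hα0 hα1 fun g hg => ?_
    have e : ∀ z, (S k).indicator F z * g z = F z * (S k).indicator g z := by
      intro z
      by_cases hz : z ∈ S k <;> simp [hz]
    simp_rw [e]
    refine (hA _ (box k g hg.meas hg.bdd)).trans ?_
    gcongr
    refine inNorm_mono hα1 (ae_of_all _ fun t => lor_mono _ (ae_of_all _ fun x => ?_))
    exact enorm_indicator_le_enorm_self _ _

end ConverseHolderLimit

section StrichartzKernels

set_option linter.unusedSectionVars false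

variable {X Y Z : Type*} [MeasurableSpace X] [MeasurableSpace Y] [MeasurableSpace Z]

lemma Nice.conj {μ : Measure X} {f : X → ℂ} (hf : Nice μ f) :
    Nice μ (fun x => (starRingEnd ℂ) (f x)) where
  meas := Complex.continuous_conj.measurable.comp hf.meas
  bdd := by simpa using hf.bdd
  supp := by
    refine (measure_mono (t := Function.support f) ?_).trans_lt hf.supp
    exact fun x hx h => hx (by simp [h])

lemma BoxNice.conj {μ : Measure X} {f : ℝ × X → ℂ} (hf : BoxNice μ f) :
    BoxNice μ (fun x => (starRingEnd ℂ) (f x)) where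
  meas := Complex.continuous_conj.measurable.comp hf.meas
  bdd := by simpa using hf.bdd
  box := by
    obtain ⟨T, B, hB, h⟩ := hf.box
    exact ⟨T, B, hB, fun z hz => h z fun h0 => hz (by simp [h0])⟩

/-- The weighted composition `∫ w(x) k(x,y) l(x,z) dx` of two kernels. -/
noncomputable def composeKernel (μ : Measure X) (w : X → ℝ) (k : X → Y → ℂ) (l : X → Z → ℂ)
    (y : Y) (z : Z) : ℂ := ∫ x, (w x : ℂ) * (k x y * l x z) ∂μ

lemma measurable_composeKernel {μ : Measure X} [SFinite μ] {w : X → ℝ} (mw : Measurable w)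
    {k : X → Y → ℂ} {l : X → Z → ℂ} (mk : Measurable (Function.uncurry k))
    (ml : Measurable (Function.uncurry l)) :
    Measurable (Function.uncurry (composeKernel μ w k l)) := by
  have h1 : Measurable fun q : (Y × Z) × X => k q.2 q.1.1 :=
    mk.comp (by fun_prop : Measurable fun q : (Y × Z) × X => (q.2, q.1.1))
  have h2 : Measurable fun q : (Y × Z) × X => l q.2 q.1.2 :=
    ml.comp (by fun_prop : Measurable fun q : (Y × Z) × X => (q.2, q.1.2))
  have h3 : Measurable fun q : (Y × Z) × X => (w q.2 : ℂ) * (k q.2 q.1.1 * l q.2 q.1.2) := by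
    fun_prop
  exact (h3.stronglyMeasurable.integral_prod_right' (ν := μ)).measurable

lemma norm_composeKernel_le {μ : Measure X} {w : X → ℝ} (hw0 : ∀ x, 0 ≤ w x) (hwi : Integrable w μ)
    {k : X → Y → ℂ} {l : X → Z → ℂ} {M : ℝ} (hk : ∀ x y, ‖k x y‖ ≤ M) (hl : ∀ x y, ‖l x y‖ ≤ M)
    (y : Y) (z : Z) : ‖composeKernel μ w k l y z‖ ≤ ∫ x, w x * (M * M) ∂μ := by
  refine norm_integral_le_of_norm_le (hwi.mul_const _) (ae_of_all _ fun x => ?_)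
  rw [norm_mul, norm_mul, Complex.norm_real, Real.norm_of_nonneg (hw0 x)]
  have := (norm_nonneg _).trans (hk x y)
  have := hw0 x
  gcongr
  exacts [hk _ _, hl _ _]

lemma form_composeKernel {μ : Measure X} {ν : Measure Y} {κ : Measure Z} [SFinite μ] [SFinite ν]
    [SFinite κ] {w : X → ℝ} (hwi : Integrable w μ) {k : X → Y → ℂ} {l : X → Z → ℂ}
    (mk : Measurable (Function.uncurry k)) (ml : Measurable (Function.uncurry l))
    {M : ℝ} (hk : ∀ x y, ‖k x y‖ ≤ M) (hl : ∀ x y, ‖l x y‖ ≤ M)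
    {f : Y → ℂ} {g : Z → ℂ} (hf : Nice ν f) (hg : Nice κ g) :
    form ν κ (composeKernel μ w k l) f g =
      ∫ x, (w x : ℂ) * ((∫ y, k x y * f y ∂ν) * ∫ z, l x z * g z ∂κ) ∂μ := by
  have h1 : Measurable fun q : (Y × Z) × X => k q.2 q.1.1 :=
    mk.comp (by fun_prop : Measurable fun q : (Y × Z) × X => (q.2, q.1.1))
  have h2 : Measurable fun q : (Y × Z) × X => l q.2 q.1.2 :=
    ml.comp (by fun_prop : Measurable fun q : (Y × Z) × X => (q.2, q.1.2))
  have hi : Integrable (fun q : (Y × Z) × X =>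
      (k q.2 q.1.1 * l q.2 q.1.2) * ((f q.1.1 * g q.1.2) * (w q.2 : ℂ))) ((ν.prod κ).prod μ) := by
    refine Integrable.bdd_mul (c := M * M) ?_ (h1.mul h2).aestronglyMeasurable (ae_of_all _ fun q => ?_)
    · exact (hf.integrable.mul_prod hg.integrable).mul_prod hwi.ofReal
    · rw [norm_mul]
      have := (norm_nonneg _).trans (hk q.2 q.1.1)
      gcongr
      exacts [hk _ _, hl _ _]
  unfold form composeKernel
  calc ∫ q : Y × Z, (∫ x, (w x : ℂ) * (k x q.1 * l x q.2) ∂μ) * (f q.1 * g q.2) ∂(ν.prod κ)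
      = ∫ q : Y × Z, ∫ x, (k x q.1 * l x q.2) * ((f q.1 * g q.2) * (w x : ℂ)) ∂μ ∂(ν.prod κ) := by
        refine integral_congr_ae (ae_of_all _ fun q => ?_)
        simp only
        rw [← integral_mul_const]
        refine integral_congr_ae (ae_of_all _ fun x => ?_)
        simp only; ring
    _ = ∫ x, ∫ q : Y × Z, (k x q.1 * l x q.2) * ((f q.1 * g q.2) * (w x : ℂ)) ∂(ν.prod κ) ∂μ :=
        integral_integral_swap hi
    _ = _ := by
        refine integral_congr_ae (ae_of_all _ fun x => ?_)
        simp only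
        rw [← integral_prod_mul, ← integral_const_mul]
        refine integral_congr_ae (ae_of_all _ fun q => ?_)
        simp only; ring

lemma lintegral_weight_mul_sq_eq {μ : Measure X} {ν : Measure Y} [SFinite μ] [SFinite ν]
    {w : X → ℝ} (hw0 : ∀ x, 0 ≤ w x) (hwi : Integrable w μ) {k : X → Y → ℂ}
    (mk : Measurable (Function.uncurry k)) (hb : ∃ M, ∀ x y, ‖k x y‖ ≤ M)
    {f : Y → ℂ} (hf : Nice ν f) :
    ∫⁻ x, ENNReal.ofReal (w x) * ‖∫ y, k x y * f y ∂ν‖ₑ ^ 2 ∂μ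
      = ‖form ν ν (composeKernel μ w k fun x z => (starRingEnd ℂ) (k x z)) f
        (fun y => (starRingEnd ℂ) (f y))‖ₑ := by
  obtain ⟨M, hM⟩ := hb
  have hM' : ∀ x y, ‖(starRingEnd ℂ) (k x y)‖ ≤ M := by simpa using hM
  have mk' : Measurable fun q : X × Y => (starRingEnd ℂ) (k q.1 q.2) :=
    Complex.continuous_conj.measurable.comp mk
  set G : X → ℂ := fun x => ∫ y, k x y * f y ∂ν with hG
  have mG : Measurable G := by
    have h : Measurable fun q : X × Y => k q.1 q.2 := mk
    exact ((h.mul (hf.meas.comp measurable_snd)).stronglyMeasurable.integral_prod_right'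
      (ν := ν)).measurable
  rw [form_composeKernel hwi mk mk' hM hM' hf hf.conj]
  have e : ∀ x, (w x : ℂ) * ((∫ y, k x y * f y ∂ν)
      * ∫ z, (starRingEnd ℂ) (k x z) * (starRingEnd ℂ) (f z) ∂ν)
      = ((w x * Complex.normSq (G x) : ℝ) : ℂ) := by
    intro x
    have : ∫ z, (starRingEnd ℂ) (k x z) * (starRingEnd ℂ) (f z) ∂ν
        = (starRingEnd ℂ) (G x) := by
      simp only [hG]
      rw [← integral_conj]; simp
    rw [this]
    change (w x : ℂ) * (G x * _) = _
    rw [Complex.mul_conj]; push_cast; rfl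
  simp_rw [e]
  have hA : ∀ x, ‖G x‖ ≤ ∫ y, M * ‖f y‖ ∂ν := by
    intro x
    refine norm_integral_le_of_norm_le (hf.integrable.norm.const_mul M) (ae_of_all _ fun y => ?_)
    rw [norm_mul]
    gcongr
    exact hM _ _
  have hint : Integrable (fun x => ((w x * Complex.normSq (G x) : ℝ) : ℂ)) μ := by
    refine Integrable.ofReal ?_
    refine hwi.mul_bdd (c := (∫ y, M * ‖f y‖ ∂ν) ^ 2)
      (Complex.continuous_normSq.measurable.comp mG).aestronglyMeasurable (ae_of_all _ fun x => ?_)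
    rw [Real.norm_of_nonneg (Complex.normSq_nonneg _), Complex.normSq_eq_norm_sq]
    gcongr
    exact hA _
  rw [enorm_integral_ofReal_of_nonneg hint
    (fun x => mul_nonneg (hw0 x) (Complex.normSq_nonneg _))]
  refine lintegral_congr fun x => ?_
  rw [ENNReal.ofReal_mul (hw0 x), Complex.normSq_eq_norm_sq, ENNReal.ofReal_pow (norm_nonneg _),
    ofReal_norm]

lemma lintegral_sq_le_of_weights {μ : Measure X} {w : ℕ → X → ℝ} (mw : ∀ j, Measurable (w j))
    (hw : ∀ x, Tendsto (fun j => w j x) atTop (nhds 1)) {u : X → ℝ≥0∞} (hu : Measurable u)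
    {A : ℝ≥0∞} (h : ∀ j, ∫⁻ x, ENNReal.ofReal (w j x) * u x ^ 2 ∂μ ≤ A) :
    ∫⁻ x, u x ^ 2 ∂μ ≤ A := by
  calc ∫⁻ x, u x ^ 2 ∂μ
      = ∫⁻ x, liminf (fun j => ENNReal.ofReal (w j x) * u x ^ 2) atTop ∂μ := by
        refine lintegral_congr fun x => ?_
        have h1 : Tendsto (fun j => ENNReal.ofReal (w j x)) atTop (nhds 1) := by
          have := (ENNReal.continuous_ofReal.tendsto 1).comp (hw x)
          simpa [Function.comp_def] using this
        have h2 := ENNReal.Tendsto.mul_const (b := u x ^ 2) h1 (Or.inl one_ne_zero)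
        rw [h2.liminf_eq, one_mul]
    _ ≤ liminf (fun j => ∫⁻ x, ENNReal.ofReal (w j x) * u x ^ 2 ∂μ) atTop := by
        refine lintegral_liminf_le fun j => ?_
        have := mw j
        fun_prop
    _ ≤ A := (liminf_le_liminf (Eventually.of_forall h)).trans_eq (liminf_const _)

/-- A space-time kernel with bounded energy whose weighted compositions with its conjugate obey
the dispersive decay. -/
structure StrichartzKernel (μ : Measure X) (ν : ℝ) (K : ℝ × X → ℝ × X → ℂ) : Prop where
  meas : Measurable (Function.uncurry K)
  bdd : ∃ M, ∀ z w, ‖K z w‖ ≤ M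
  decay : ∀ z w, z.1 ≠ w.1 → ‖K z w‖ ≤ |z.1 - w.1| ^ (-ν)
  energy : ∀ t τ, ∀ f, Nice μ f →
    lor μ 2 (fun x => ‖∫ y, K (t, x) (τ, y) * f y ∂μ‖ₑ) ≤ lor μ 2 (fun x => ‖f x‖ₑ)
  compose : ∀ t, ∃ w : ℕ → X → ℝ, (∀ j, Measurable (w j)) ∧ (∀ j x, 0 ≤ w j x) ∧
    (∀ j x, w j x ≤ 1) ∧ (∀ j, Integrable (w j) μ) ∧
    (∀ x, Tendsto (fun j => w j x) atTop (nhds 1)) ∧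
    ∀ j z z', z.1 ≠ z'.1 → ‖composeKernel μ (w j) (fun x => K (t, x))
      (fun x z => (starRingEnd ℂ) (K (t, x) z)) z z'‖ ≤ |z.1 - z'.1| ^ (-ν)

lemma StrichartzKernel.dispersive {μ : Measure X} [SFinite μ] {ν : ℝ} {K : ℝ × X → ℝ × X → ℂ}
    (hK : StrichartzKernel μ ν K) : DispersiveKernel μ ν K where
  meas := hK.meas
  bdd := hK.bdd
  decay := hK.decay
  energy := by
    intro t τ f g hf hg
    have mK : Measurable fun q : X × X => K (t, q.1) (τ, q.2) :=
      hK.meas.comp (by fun_prop : Measurable fun q : X × X => ((t, q.1), (τ, q.2)))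
    rw [form_eq_integral (L := fun x y => K (t, x) (τ, y)) mK (hK.bdd.imp fun M h x y => h _ _) hf hg]
    refine (enorm_integral_le_lintegral_enorm _).trans ?_
    simp_rw [enorm_mul]
    have mg := hg.meas
    have m2 : Measurable fun x => ∫ y, K (t, x) (τ, y) * g y ∂μ :=
      ((mK.mul (mg.comp measurable_snd)).stronglyMeasurable.integral_prod_right'
        (ν := μ)).measurable
    exact (lintegral_mul_le_lor hf.meas.enorm m2.enorm (q := 2) (r := 2) (by norm_num)).trans
      (mul_le_mul_right (hK.energy t τ g hg) _)

lemma StrichartzKernel.compose_dispersive {μ : Measure X} [SFinite μ] {ν : ℝ}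
    {K : ℝ × X → ℝ × X → ℂ} (hK : StrichartzKernel μ ν K) (t : ℝ) {w : X → ℝ} (mw : Measurable w)
    (hw0 : ∀ x, 0 ≤ w x) (hw1 : ∀ x, w x ≤ 1) (hwi : Integrable w μ)
    (hd : ∀ z z', z.1 ≠ z'.1 → ‖composeKernel μ w (fun x => K (t, x))
      (fun x z => (starRingEnd ℂ) (K (t, x) z)) z z'‖ ≤ |z.1 - z'.1| ^ (-ν)) :
    DispersiveKernel μ ν (composeKernel μ w (fun x => K (t, x))
      (fun x z => (starRingEnd ℂ) (K (t, x) z))) := by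
  have mK : Measurable fun q : X × (ℝ × X) => K (t, q.1) q.2 :=
    hK.meas.comp (by fun_prop : Measurable fun q : X × (ℝ × X) => ((t, q.1), q.2))
  have mK' : Measurable fun q : X × (ℝ × X) => (starRingEnd ℂ) (K (t, q.1) q.2) :=
    Complex.continuous_conj.measurable.comp mK
  obtain ⟨M, hM⟩ := hK.bdd
  have hM' : ∀ z w, ‖(starRingEnd ℂ) (K z w)‖ ≤ M := by simpa using hM
  refine ⟨measurable_composeKernel mw mK mK', ⟨_, norm_composeKernel_le hw0 hwi (fun _ _ => hM _ _)
    (fun _ _ => hM' _ _)⟩, hd, fun τ σ f g hf hg => ?_⟩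
  have e := form_composeKernel (μ := μ) (ν := μ) (κ := μ) hwi (k := fun x y => K (t, x) (τ, y))
    (l := fun x z => (starRingEnd ℂ) (K (t, x) (σ, z)))
    (mK.comp (by fun_prop : Measurable fun q : X × X => (q.1, (τ, q.2))))
    (mK'.comp (by fun_prop : Measurable fun q : X × X => (q.1, (σ, q.2))))
    (fun _ _ => hM _ _) (fun _ _ => hM' _ _) hf hg
  have me : ∀ (τ : ℝ) (h : X → ℂ), Nice μ h →
      Measurable fun x => ∫ y, K (t, x) (τ, y) * h y ∂μ := by
    intro τ h hh
    have mKτ : Measurable fun q : X × X => K (t, q.1) (τ, q.2) :=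
      hK.meas.comp (by fun_prop : Measurable fun q : X × X => ((t, q.1), (τ, q.2)))
    exact ((mKτ.mul (hh.meas.comp measurable_snd)).stronglyMeasurable.integral_prod_right'
        (ν := μ)).measurable
  have hconj : ∀ x, ‖∫ z, (starRingEnd ℂ) (K (t, x) (σ, z)) * g z ∂μ‖ₑ
      = ‖∫ z, K (t, x) (σ, z) * (starRingEnd ℂ) (g z) ∂μ‖ₑ := by
    intro x
    have : ∫ z, (starRingEnd ℂ) (K (t, x) (σ, z)) * g z ∂μ
        = (starRingEnd ℂ) (∫ z, K (t, x) (σ, z) * (starRingEnd ℂ) (g z) ∂μ) := by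
      rw [← integral_conj]; simp
    rw [this, ← ofReal_norm, RCLike.norm_conj, ofReal_norm]
  change ‖form μ μ (composeKernel μ w (fun x y => K (t, x) (τ, y))
    (fun x z => (starRingEnd ℂ) (K (t, x) (σ, z)))) f g‖ₑ ≤ _
  rw [e]
  refine (enorm_integral_le_lintegral_enorm _).trans ?_
  calc _ ≤ ∫⁻ x, ‖∫ y, K (t, x) (τ, y) * f y ∂μ‖ₑ
        * ‖∫ z, K (t, x) (σ, z) * (starRingEnd ℂ) (g z) ∂μ‖ₑ ∂μ := by
        refine lintegral_mono fun x => ?_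
        simp only
        rw [enorm_mul, enorm_mul, hconj]
        refine (mul_le_mul_left ?_ _).trans_eq (one_mul _)
        rw [← ofReal_norm, Complex.norm_real, Real.norm_of_nonneg (hw0 x)]
        exact ENNReal.ofReal_le_one.2 (hw1 x)
    _ ≤ lor μ 2 (fun x => ‖f x‖ₑ) * lor μ 2 (fun x => ‖(starRingEnd ℂ) (g x)‖ₑ) :=
        (lintegral_mul_le_lor (me τ f hf).enorm (me σ _ hg.conj).enorm (q := 2) (r := 2)
          (by norm_num)).trans (mul_le_mul' (hK.energy t τ f hf) (hK.energy t σ _ hg.conj))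
    _ = _ := by
        congr 2
        ext x
        rw [← ofReal_norm, RCLike.norm_conj, ofReal_norm]

/-- The integral operator with kernel `K` on space-time. -/
noncomputable def kernelOp (μ : Measure X) (K : ℝ × X → ℝ × X → ℂ) (f : ℝ × X → ℂ) (z : ℝ × X) :
    ℂ := ∫ w, K z w * f w ∂(volume.prod μ)

lemma measurable_kernelOp {μ : Measure X} [SFinite μ] {K : ℝ × X → ℝ × X → ℂ}
    (hK : Measurable (Function.uncurry K)) {f : ℝ × X → ℂ} (hf : Measurable f) :
    Measurable (kernelOp μ K f) := by
  have hK' : Measurable fun q : (ℝ × X) × (ℝ × X) => K q.1 q.2 := hK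
  exact ((hK'.mul (hf.comp measurable_snd)).stronglyMeasurable.integral_prod_right'
    (ν := volume.prod μ)).measurable

lemma norm_kernelOp_le {μ : Measure X} [SFinite μ] {K : ℝ × X → ℝ × X → ℂ}
    (hb : ∃ M, ∀ z w, ‖K z w‖ ≤ M) {f : ℝ × X → ℂ} (hf : BoxNice μ f) :
    ∃ M, ∀ z, ‖kernelOp μ K f z‖ ≤ M := by
  obtain ⟨M, hM⟩ := hb
  refine ⟨∫ w, M * ‖f w‖ ∂(volume.prod μ), fun z => ?_⟩
  refine norm_integral_le_of_norm_le (hf.nice.integrable.norm.const_mul M) (ae_of_all _ fun w => ?_)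
  rw [norm_mul]
  gcongr
  exact hM _ _

/-- The `L^∞_t L^2_x` endpoint, by the `T T^*` method. -/
lemma StrichartzKernel.lor_two_kernelOp_le {μ : Measure X} [SFinite μ] {ν r α : ℝ}
    {K : ℝ × X → ℝ × X → ℂ} (hK : StrichartzKernel μ ν K) (hr : 2 ≤ r)
    (hα : ν * (1 - 2 / r) = α) (hα0 : 0 ≤ α) (hα1 : α < 1) {f : ℝ × X → ℂ} (hf : BoxNice μ f)
    (t : ℝ) : lor μ 2 (fun x => ‖kernelOp μ K f (t, x)‖ₑ) ≤ formConst r α ^ (1 / 2 : ℝ) *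
      inNorm α (fun t => lor μ (r / (r - 1)) fun x => ‖f (t, x)‖ₑ) := by
  obtain ⟨w, mw, hw0, hw1, hwi, hwt, hd⟩ := hK.compose t
  set N := inNorm α (fun t => lor μ (r / (r - 1)) fun x => ‖f (t, x)‖ₑ) with hN
  have mK : Measurable fun q : X × (ℝ × X) => K (t, q.1) q.2 :=
    hK.meas.comp (by fun_prop : Measurable fun q : X × (ℝ × X) => ((t, q.1), q.2))
  have mG : Measurable fun x => kernelOp μ K f (t, x) :=
    (measurable_kernelOp hK.meas hf.meas).comp (by fun_prop)
  have key : ∀ j, ∫⁻ x, ENNReal.ofReal (w j x) * ‖kernelOp μ K f (t, x)‖ₑ ^ 2 ∂μ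
      ≤ formConst r α * (N * N) := by
    intro j
    have h1 := (hK.compose_dispersive t (mw j) (hw0 j) (hw1 j) (hwi j) (hd j)).enorm_form_le
      hr hα hα0 hα1 hf hf.conj
    have hc : (fun t => lor μ (r / (r - 1)) fun x => ‖(starRingEnd ℂ) (f (t, x))‖ₑ)
        = fun t => lor μ (r / (r - 1)) fun x => ‖f (t, x)‖ₑ := by
      ext t
      congr 1
      ext x
      rw [← ofReal_norm, RCLike.norm_conj, ofReal_norm]
    rw [hc] at h1
    exact (lintegral_weight_mul_sq_eq (hw0 j) (hwi j) mK (hK.bdd.imp fun M h x y => h _ _)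
      hf.nice).trans_le h1
  rw [lor_two mG.enorm]
  refine (ENNReal.rpow_le_rpow (lintegral_sq_le_of_weights mw hwt mG.enorm key)
    (by norm_num)).trans (le_of_eq ?_)
  rw [ENNReal.mul_rpow_of_nonneg _ _ (by norm_num), ← sq, ← ENNReal.rpow_ofNat, ← ENNReal.rpow_mul]
  norm_num

end StrichartzKernels

section AbstractStrichartz

set_option linter.unusedSectionVars false

variable {X : Type*} [MeasurableSpace X]

lemma lintegral_mul_le_inNorm_mul_outNorm {α : ℝ} (hα0 : 0 ≤ α) (hα1 : α < 1) {N M : ℝ → ℝ≥0∞}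
    (hN : Measurable N) (hM : Measurable M) :
    ∫⁻ t, N t * M t ≤ inNorm α N * outNorm α M := by
  unfold inNorm outNorm
  split_ifs with h0
  · subst h0
    simp only [zero_div, sub_zero, inv_one, ENNReal.rpow_one]
    rw [← lintegral_mul_const _ hN]
    refine lintegral_mono_ae ?_
    filter_upwards [ENNReal.ae_le_essSup (μ := volume) M] with t ht
    gcongr
  · have hα : 0 < α := lt_of_le_of_ne hα0 (Ne.symm h0)
    have hc : ((1 - α / 2)⁻¹).HolderConjugate (2 / α) := by
      rw [Real.holderConjugate_iff]
      have h2 : 0 < 1 - α / 2 := by linarith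
      refine ⟨?_, ?_⟩
      · rw [lt_inv_comm₀ one_pos h2]; linarith
      · rw [inv_inv, inv_div]; ring
    have := ENNReal.lintegral_mul_le_Lp_mul_Lq volume hc hN.aemeasurable hM.aemeasurable
    simpa only [Pi.mul_apply, one_div, inv_inv, inv_div] using this

variable {μ : Measure X}

lemma form_kernelOp [SFinite μ] {K : ℝ × X → ℝ × X → ℂ} (mK : Measurable (Function.uncurry K))
    (hb : ∃ M, ∀ z w, ‖K z w‖ ≤ M) {f g : ℝ × X → ℂ} (hf : BoxNice μ f) (hg : BoxNice μ g) :
    ∫ z, kernelOp μ K f z * g z ∂(volume.prod μ)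
      = ∫ z, f z * kernelOp μ (fun z w => K w z) g z ∂(volume.prod μ) := by
  have h1 := form_eq_integral mK hb hg.nice hf.nice
  have h2 := form_eq_integral (L := fun z w => K w z) (mK.comp measurable_swap)
    (hb.imp fun M h z w => h w z) hf.nice hg.nice
  rw [form_swap, h2] at h1
  unfold kernelOp
  rw [h1]
  exact integral_congr_ae (ae_of_all _ fun z => mul_comm _ _)

/-- Exponents on the side `2 ≤ p ≤ r` of the Strichartz estimate. -/
lemma exists_outNorm_kernelOp_le_of_le [SigmaFinite μ] {ν p r : ℝ} (hν : 0 < ν) (hp : 2 ≤ p)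
    (hpr : p ≤ r) (hα1 : ν * (1 - 2 / r) < 1) :
    ∃ C : ℝ≥0∞, C ≠ ⊤ ∧ ∀ K, StrichartzKernel μ ν K → ∀ f, BoxNice μ f →
      outNorm (ν * (1 - 2 / p)) (fun t => lor μ p fun x => ‖kernelOp μ K f (t, x)‖ₑ)
        ≤ C * inNorm (ν * (1 - 2 / r)) (fun t => lor μ (r / (r - 1)) fun x => ‖f (t, x)‖ₑ) := by
  have hp0 : 0 < p := by linarith
  have hr0 : 0 < r := by linarith
  set α := ν * (1 - 2 / r) with hα
  have hrle : 2 / r ≤ 1 := by rw [div_le_one hr0]; linarith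
  have hple : 2 / p ≤ 1 := by rw [div_le_one hp0]; linarith
  have hα0 : 0 ≤ α := mul_nonneg hν.le (by linarith)
  set C2 := formConst r α ^ (1 / 2 : ℝ) with hC2
  have hC2t : C2 ≠ ⊤ := ENNReal.rpow_ne_top_of_nonneg (by norm_num) (formConst_ne_top _ _)
  rcases hp.eq_or_lt with rfl | hp2
  · refine ⟨C2, hC2t, fun K hK f hf => ?_⟩
    have : ν * (1 - 2 / 2) = 0 := by norm_num
    rw [this, outNorm, if_pos rfl]
    exact essSup_le_of_ae_le _ (ae_of_all _ fun t =>
      hK.lor_two_kernelOp_le (by linarith) hα.symm hα0 hα1 hf t)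
  · have hr2 : 2 < r := by linarith
    have hrlt : 2 / r < 1 := by rw [div_lt_one hr0]; exact hr2
    have hplt : 2 / p < 1 := by rw [div_lt_one hp0]; exact hp2
    have hα0' : 0 < α := mul_pos hν (by linarith)
    have hβ0 : 0 < ν * (1 - 2 / p) := mul_pos hν (by linarith)
    set C1 := (ENNReal.ofReal (2 / r))⁻¹ * formConst r α with hC1
    have hC1t : C1 ≠ ⊤ := by
      refine ENNReal.mul_ne_top ?_ (formConst_ne_top _ _)
      simp only [ne_eq, ENNReal.inv_eq_top, ENNReal.ofReal_eq_zero, not_le]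
      positivity
    set θ := (1 - 2 / p) / (1 - 2 / r) with hθ
    have hr' : 0 < 1 - 2 / r := by linarith
    have hθ0 : 0 < θ := div_pos (by linarith) hr'
    have hθ1 : θ ≤ 1 := by
      rw [hθ, div_le_one hr']
      have : 2 / r ≤ 2 / p := by gcongr
      linarith
    have hθe : 1 - 2 / p = θ * (1 - 2 / r) := (div_mul_cancel₀ _ hr'.ne').symm
    refine ⟨C2 ^ (1 - θ) * C1 ^ θ, ENNReal.mul_ne_top
      (ENNReal.rpow_ne_top_of_nonneg (by linarith) hC2t)
      (ENNReal.rpow_ne_top_of_nonneg hθ0.le hC1t), fun K hK f hf => ?_⟩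
    set N := inNorm α (fun t => lor μ (r / (r - 1)) fun x => ‖f (t, x)‖ₑ) with hN
    have mD := measurable_kernelOp hK.meas hf.meas (μ := μ)
    have diag : outNorm α (fun t => lor μ r fun x => ‖kernelOp μ K f (t, x)‖ₑ) ≤ C1 * N := by
      rw [hC1, mul_assoc]
      refine outNorm_le_of_forall_boxNice mD (norm_kernelOp_le hK.bdd hf) hr2 hα0' hα1
        fun g hg => ?_
      have h := hK.dispersive.enorm_form_le (by linarith) hα.symm hα0 hα1 hg hf
      rw [form_eq_integral hK.meas hK.bdd hg.nice hf.nice] at h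
      calc _ = ‖∫ x, g x * ∫ y, K x y * f y ∂(volume.prod μ) ∂(volume.prod μ)‖ₑ := by
            congr 1
            exact integral_congr_ae (ae_of_all _ fun z => mul_comm _ _)
        _ ≤ _ := h
        _ = _ := by ring
    have hβ : ν * (1 - 2 / p) = θ * α := by rw [hθe, hα]; ring
    rw [hβ] at hβ0 ⊢
    rw [outNorm, if_neg hα0'.ne'] at diag
    rw [outNorm, if_neg hβ0.ne']
    calc (∫⁻ t, lor μ p (fun x => ‖kernelOp μ K f (t, x)‖ₑ) ^ (2 / (θ * α))) ^ (θ * α / 2)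
        ≤ (∫⁻ t, (C2 * N) ^ ((1 - θ) * (2 / (θ * α))) *
          lor μ r (fun x => ‖kernelOp μ K f (t, x)‖ₑ) ^ (2 / α)) ^ (θ * α / 2) := by
          refine ENNReal.rpow_le_rpow (lintegral_mono fun t => ?_) (by linarith)
          have h1 := lor_interpolation μ (fun x => ‖kernelOp μ K f (t, x)‖ₑ) hθ0.le hθ1
            (p := p) (r := r) (by linarith)
          have h2 := hK.lor_two_kernelOp_le hr2.le hα.symm hα0 hα1 hf t
          refine (ENNReal.rpow_le_rpow h1 (by positivity)).trans ?_
          rw [ENNReal.mul_rpow_of_nonneg _ _ (by positivity), ← ENNReal.rpow_mul,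
            ← ENNReal.rpow_mul]
          refine mul_le_mul' (ENNReal.rpow_le_rpow h2
            (mul_nonneg (by linarith) (by positivity))) (le_of_eq ?_)
          congr 1
          field_simp
      _ = (C2 * N) ^ (1 - θ) * ((∫⁻ t,
          lor μ r (fun x => ‖kernelOp μ K f (t, x)‖ₑ) ^ (2 / α)) ^ (α / 2)) ^ θ := by
          rw [lintegral_const_mul _ ((BoxNice.measurable_lor mD r).pow_const _),
            ENNReal.mul_rpow_of_nonneg _ _ (by linarith), ← ENNReal.rpow_mul, ← ENNReal.rpow_mul]
          congr 2
          · field_simp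
          · ring
      _ ≤ (C2 * N) ^ (1 - θ) * (C1 * N) ^ θ :=
          mul_le_mul_right (ENNReal.rpow_le_rpow diag hθ0.le) _
      _ = C2 ^ (1 - θ) * C1 ^ θ * (N ^ (1 - θ) * N ^ θ) := by
          rw [ENNReal.mul_rpow_of_nonneg _ _ (by linarith), ENNReal.mul_rpow_of_nonneg _ _ hθ0.le]
          ring
      _ = C2 ^ (1 - θ) * C1 ^ θ * N := by
          rw [← ENNReal.rpow_add_of_nonneg _ _ (by linarith) hθ0.le]; simp

/-- Inhomogeneous Strichartz estimate for abstract kernels. -/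
theorem exists_outNorm_kernelOp_le [SigmaFinite μ] {ν p r : ℝ} (hν : 0 < ν) (hp : 2 ≤ p)
    (hr : 2 ≤ r) (hαp : ν * (1 - 2 / p) < 1) (hαr : ν * (1 - 2 / r) < 1) :
    ∃ C : ℝ≥0∞, C ≠ ⊤ ∧ ∀ K, StrichartzKernel μ ν K → StrichartzKernel μ ν (fun z w => K w z) →
      ∀ f, BoxNice μ f →
      outNorm (ν * (1 - 2 / p)) (fun t => lor μ p fun x => ‖kernelOp μ K f (t, x)‖ₑ)
        ≤ C * inNorm (ν * (1 - 2 / r)) (fun t => lor μ (r / (r - 1)) fun x => ‖f (t, x)‖ₑ) := by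
  rcases le_or_gt p r with hpr | hpr
  · obtain ⟨C, hC, h⟩ := exists_outNorm_kernelOp_le_of_le (μ := μ) hν hp hpr hαr
    exact ⟨C, hC, fun K hK _ => h K hK⟩
  · obtain ⟨C, hC, h⟩ := exists_outNorm_kernelOp_le_of_le (μ := μ) hν hr hpr.le hαp
    have hp0 : 0 < p := by linarith
    have hr0 : 0 < r := by linarith
    have hplt : 2 / p < 1 := by rw [div_lt_one hp0]; linarith
    have hrle : 2 / r ≤ 1 := by rw [div_le_one hr0]; exact hr
    refine ⟨(ENNReal.ofReal (2 / p))⁻¹ * C, ENNReal.mul_ne_top ?_ hC, fun K hK hK' f hf => ?_⟩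
    · simp only [ne_eq, ENNReal.inv_eq_top, ENNReal.ofReal_eq_zero, not_le]
      positivity
    rw [mul_assoc]
    refine outNorm_le_of_forall_boxNice (measurable_kernelOp hK.meas hf.meas)
      (norm_kernelOp_le hK.bdd hf) (by linarith) (mul_pos hν (by linarith)) hαp fun g hg => ?_
    rw [form_kernelOp hK.meas hK.bdd hf hg]
    have mD := measurable_kernelOp hK'.meas hg.meas (μ := μ)
    have mf := hf.meas
    calc _ ≤ ∫⁻ z, ‖f z‖ₑ * ‖kernelOp μ (fun z w => K w z) g z‖ₑ ∂(volume.prod μ) := by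
          refine (enorm_integral_le_lintegral_enorm _).trans_eq ?_
          simp_rw [enorm_mul]
      _ = ∫⁻ t, ∫⁻ x, ‖f (t, x)‖ₑ * ‖kernelOp μ (fun z w => K w z) g (t, x)‖ₑ ∂μ :=
          lintegral_prod _ (Measurable.aemeasurable (by fun_prop))
      _ ≤ ∫⁻ t, lor μ (r / (r - 1)) (fun x => ‖f (t, x)‖ₑ) *
          lor μ r (fun x => ‖kernelOp μ (fun z w => K w z) g (t, x)‖ₑ) := by
          refine lintegral_mono fun t => lintegral_mul_le_lor ?_ ?_ ?_
          · fun_prop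
          · fun_prop
          · have : r - 1 ≠ 0 := by linarith
            field_simp; ring
      _ ≤ _ := lintegral_mul_le_inNorm_mul_outNorm (mul_nonneg hν.le (by linarith)) hαr
          (BoxNice.measurable_lor mf _) (BoxNice.measurable_lor mD _)
      _ ≤ _ := mul_le_mul_right (h _ hK' g hg) _
      _ = _ := by ring

end AbstractStrichartz

section FreeKernel

/-- The convolution kernel of the free Schrödinger propagator. -/
noncomputable def freeKernel (n : ℕ) (s : ℝ) (z : Rn n) : ℂ :=
  (4 * (Real.pi : ℂ) * Complex.I * (s : ℂ)) ^ (-(n : ℂ) / 2) *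
    Complex.exp (Complex.I * ((‖z‖ : ℂ)) ^ 2 / (4 * (s : ℂ)))

lemma schrodinger_eq_integral_freeKernel (n : ℕ) (t : ℝ) (f : Rn n → ℂ) (x : Rn n) :
    schrodinger n t f x = ∫ y, freeKernel n t (x - y) * f y := by
  unfold schrodinger freeKernel
  rw [← integral_const_mul]
  refine integral_congr_ae (ae_of_all _ fun y => ?_)
  simp only; ring

lemma measurable_freeKernel (n : ℕ) : Measurable fun q : ℝ × Rn n => freeKernel n q.1 q.2 := by
  unfold freeKernel
  fun_prop

lemma norm_cexp_I_mul_sq_div (a s : ℝ) :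
    ‖Complex.exp (Complex.I * (a : ℂ) ^ 2 / (4 * (s : ℂ)))‖ = 1 := by
  have : Complex.I * (a : ℂ) ^ 2 / (4 * (s : ℂ)) = ((a ^ 2 / (4 * s) : ℝ) : ℂ) * Complex.I := by
    push_cast; ring
  rw [this, Complex.norm_exp_ofReal_mul_I]

lemma norm_freeKernel_coeff (n : ℕ) (s : ℝ) :
    ‖(4 * (Real.pi : ℂ) * Complex.I * (s : ℂ)) ^ (-(n : ℂ) / 2)‖
      = (4 * Real.pi * |s|) ^ (-(n / 2 : ℝ)) := by
  have : -(n : ℂ) / 2 = ((-(n / 2 : ℝ) : ℝ) : ℂ) := by push_cast; ring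
  rw [this, Complex.norm_cpow_real]
  congr 1
  simp [abs_of_pos Real.pi_pos]

lemma norm_freeKernel (n : ℕ) (s : ℝ) (z : Rn n) :
    ‖freeKernel n s z‖ = (4 * Real.pi * |s|) ^ (-(n / 2 : ℝ)) := by
  rw [freeKernel, norm_mul, norm_cexp_I_mul_sq_div, mul_one, norm_freeKernel_coeff]

lemma norm_freeKernel_le (n : ℕ) {s : ℝ} (hs : s ≠ 0) (z : Rn n) :
    ‖freeKernel n s z‖ ≤ |s| ^ (-(n / 2 : ℝ)) := by
  rw [norm_freeKernel]
  have hs' := abs_pos.2 hs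
  refine Real.rpow_le_rpow_of_nonpos hs' ?_ (neg_nonpos.2 (by positivity))
  have := Real.pi_gt_three
  nlinarith

lemma norm_integral_gaussian_mul_freeKernel (n : ℕ) {e s s' : ℝ} (he : 0 < e)
    (hs : s ≠ 0) (hs' : s' ≠ 0) (y y' : Rn n) :
    ‖∫ x : Rn n, ((Real.exp (-e * ‖x‖ ^ 2) : ℝ) : ℂ) *
        (freeKernel n s (x - y) * (starRingEnd ℂ) (freeKernel n s' (x - y')))‖
      = (4 * Real.pi * |s|) ^ (-(n / 2 : ℝ)) * (4 * Real.pi * |s'|) ^ (-(n / 2 : ℝ)) *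
        ((Real.pi / ‖(e : ℂ) - Complex.I / (4 * s) + Complex.I / (4 * s')‖) ^ (n / 2 : ℝ) *
          Real.exp (-(‖(-1 / (2 * s)) • y + (1 / (2 * s')) • y'‖ ^ 2) / 4 *
            ((e : ℂ) - Complex.I / (4 * s) + Complex.I / (4 * s'))⁻¹.re)) := by
  set b : ℂ := (e : ℂ) - Complex.I / (4 * s) + Complex.I / (4 * s') with hb
  set w : Rn n := (-1 / (2 * s)) • y + (1 / (2 * s')) • y' with hw
  have hbre : b.re = e := by
    have h1 : b = (e : ℂ) + ((1 / (4 * s') - 1 / (4 * s) : ℝ) : ℂ) * Complex.I := by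
      rw [hb]; push_cast; ring
    rw [h1]; simp
  set c1 := (4 * (Real.pi : ℂ) * Complex.I * (s : ℂ)) ^ (-(n : ℂ) / 2) with hc1
  set c2 := (4 * (Real.pi : ℂ) * Complex.I * (s' : ℂ)) ^ (-(n : ℂ) / 2) with hc2
  set ph := Complex.exp (((‖y‖ ^ 2 / (4 * s) - ‖y'‖ ^ 2 / (4 * s') : ℝ) : ℂ) * Complex.I) with hph
  have key : ∀ x : Rn n, ((Real.exp (-e * ‖x‖ ^ 2) : ℝ) : ℂ) *
        (freeKernel n s (x - y) * (starRingEnd ℂ) (freeKernel n s' (x - y')))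
      = (c1 * (starRingEnd ℂ) c2 * ph) *
        Complex.exp (-b * (‖x‖ : ℂ) ^ 2 + Complex.I * (inner ℝ w x : ℝ)) := by
    intro x
    have e1 : ((‖x - y‖ : ℝ) : ℂ) ^ 2
        = (‖x‖ : ℂ) ^ 2 - 2 * (inner ℝ x y : ℝ) + (‖y‖ : ℂ) ^ 2 := by
      exact_mod_cast congrArg (fun r : ℝ => (r : ℂ)) (norm_sub_sq_real x y)
    have e2 : ((‖x - y'‖ : ℝ) : ℂ) ^ 2
        = (‖x‖ : ℂ) ^ 2 - 2 * (inner ℝ x y' : ℝ) + (‖y'‖ : ℂ) ^ 2 := by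
      exact_mod_cast congrArg (fun r : ℝ => (r : ℂ)) (norm_sub_sq_real x y')
    have e3 : inner ℝ w x = -1 / (2 * s) * inner ℝ x y + 1 / (2 * s') * inner ℝ x y' := by
      rw [hw, inner_add_left, inner_smul_left, inner_smul_left, real_inner_comm x y,
        real_inner_comm x y']
      simp
    unfold freeKernel
    rw [map_mul, ← Complex.exp_conj]
    have e4 : (starRingEnd ℂ) (Complex.I * (‖x - y'‖ : ℂ) ^ 2 / (4 * (s' : ℂ)))
        = -(Complex.I * (‖x - y'‖ : ℂ) ^ 2 / (4 * (s' : ℂ))) := by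
      simp [Complex.conj_ofReal, neg_div, Complex.conj_ofNat]
    rw [e4, e1, e2, e3, hph, Complex.ofReal_exp]
    have : ∀ A B C D E F : ℂ, Complex.exp A * (c1 * Complex.exp B * ((starRingEnd ℂ) c2 * Complex.exp C))
        = (c1 * (starRingEnd ℂ) c2) * Complex.exp (A + B + C) := by
      intro A B C D E F
      rw [Complex.exp_add, Complex.exp_add]; ring
    rw [this _ _ _ 0 0 0, mul_assoc _ (Complex.exp _) (Complex.exp _), ← Complex.exp_add]
    congr 2
    rw [hb]
    have : (s : ℂ) ≠ 0 := by exact_mod_cast hs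
    have : (s' : ℂ) ≠ 0 := by exact_mod_cast hs'
    push_cast
    field_simp
    ring
  simp_rw [key]
  rw [integral_const_mul, GaussianFourier.integral_cexp_neg_mul_sq_norm_add (by rw [hbre]; exact he),
    norm_mul, norm_mul, norm_mul, norm_mul, RCLike.norm_conj, hph, Complex.norm_exp_ofReal_mul_I,
    norm_freeKernel_coeff, norm_freeKernel_coeff, mul_one, Complex.norm_exp]
  congr 2
  · have : ((Module.finrank ℝ (Rn n) : ℂ) / 2) = (((n / 2 : ℝ)) : ℂ) := by
      simp
    rw [this, Complex.norm_cpow_real, norm_div, Complex.norm_real, Real.norm_of_nonneg Real.pi_pos.le]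
  · have : Complex.I ^ 2 * (‖w‖ : ℂ) ^ 2 / (4 * b) = ((-(‖w‖ ^ 2) / 4 : ℝ) : ℂ) * b⁻¹ := by
      rw [Complex.I_sq]; push_cast; field_simp
    rw [this, Complex.re_ofReal_mul]

end FreeKernel

section FreeKernelBounds

lemma norm_integral_gaussian_mul_freeKernel_le (n : ℕ) {e s s' : ℝ} (he : 0 < e)
    (hs : s ≠ 0) (hs' : s' ≠ 0) (hss : s ≠ s') (y y' : Rn n) :
    ‖∫ x : Rn n, ((Real.exp (-e * ‖x‖ ^ 2) : ℝ) : ℂ) *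
        (freeKernel n s (x - y) * (starRingEnd ℂ) (freeKernel n s' (x - y')))‖
      ≤ |s - s'| ^ (-(n / 2 : ℝ)) := by
  rw [norm_integral_gaussian_mul_freeKernel n he hs hs']
  set b : ℂ := (e : ℂ) - Complex.I / (4 * s) + Complex.I / (4 * s') with hb
  have h1 : b = (e : ℂ) + ((1 / (4 * s') - 1 / (4 * s) : ℝ) : ℂ) * Complex.I := by
    rw [hb]; push_cast; ring
  have hbre : b.re = e := by rw [h1]; simp
  have hbim : b.im = (s - s') / (4 * s * s') := by
    rw [h1]
    simp only [Complex.add_im, Complex.ofReal_im, Complex.mul_im, Complex.ofReal_re, Complex.I_im,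
      Complex.I_re]
    field_simp
    ring
  have a1 := abs_pos.2 hs
  have a2 := abs_pos.2 hs'
  have a3 := abs_pos.2 (sub_ne_zero.2 hss)
  have hbn : |s - s'| / (4 * |s| * |s'|) ≤ ‖b‖ := by
    have := Complex.abs_im_le_norm b
    rw [hbim, abs_div, abs_mul, abs_mul] at this
    simpa using this
  have hb0 : 0 < ‖b‖ := lt_of_lt_of_le (by positivity) hbn
  have hexp : Real.exp (-(‖(-1 / (2 * s)) • y + (1 / (2 * s')) • y'‖ ^ 2) / 4 * b⁻¹.re) ≤ 1 := by
    rw [Real.exp_le_one_iff]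
    have : 0 ≤ b⁻¹.re := by
      rw [Complex.inv_re, hbre]
      exact div_nonneg he.le (Complex.normSq_nonneg _)
    refine mul_nonpos_of_nonpos_of_nonneg ?_ this
    have := sq_nonneg ‖(-1 / (2 * s)) • y + (1 / (2 * s')) • y'‖
    linarith
  have hπ := Real.pi_pos
  refine (mul_le_mul_of_nonneg_left (mul_le_of_le_one_right (by positivity) hexp)
    (by positivity)).trans ?_
  rw [Real.rpow_neg (by positivity), Real.rpow_neg (by positivity), Real.rpow_neg a3.le,
    ← Real.inv_rpow (by positivity), ← Real.inv_rpow (by positivity), ← Real.inv_rpow a3.le,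
    ← Real.mul_rpow (by positivity) (by positivity), ← Real.mul_rpow (by positivity) (by positivity)]
  refine Real.rpow_le_rpow (by positivity) ?_ (by positivity)
  calc (4 * Real.pi * |s|)⁻¹ * (4 * Real.pi * |s'|)⁻¹ * (Real.pi / ‖b‖)
      ≤ (4 * Real.pi * |s|)⁻¹ * (4 * Real.pi * |s'|)⁻¹ *
        (Real.pi / (|s - s'| / (4 * |s| * |s'|))) := by gcongr
    _ = (4 * Real.pi)⁻¹ * |s - s'|⁻¹ := by field_simp
    _ ≤ 1 * |s - s'|⁻¹ := by
        gcongr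
        refine inv_le_one_of_one_le₀ ?_
        linarith [Real.pi_gt_three]
    _ = _ := one_mul _

/-- The Gaussian majorant of the composition of a propagator with its adjoint. -/
noncomputable def gaussianMajorant (n : ℕ) (e s : ℝ) (z : Rn n) : ℝ :=
  (4 * Real.pi * |s|) ^ (-(n / 2 : ℝ)) * (4 * Real.pi * |s|) ^ (-(n / 2 : ℝ)) *
    ((Real.pi / e) ^ (n / 2 : ℝ) * Real.exp (-(1 / (16 * s ^ 2 * e)) * ‖z‖ ^ 2))

lemma norm_integral_gaussian_mul_freeKernel_self (n : ℕ) {e s : ℝ} (he : 0 < e)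
    (hs : s ≠ 0) (y y' : Rn n) :
    ‖∫ x : Rn n, ((Real.exp (-e * ‖x‖ ^ 2) : ℝ) : ℂ) *
        (freeKernel n s (x - y) * (starRingEnd ℂ) (freeKernel n s (x - y')))‖
      = gaussianMajorant n e s (y - y') := by
  rw [norm_integral_gaussian_mul_freeKernel n he hs hs, sub_add_cancel, Complex.norm_real,
    Real.norm_of_nonneg he.le, gaussianMajorant, ← Complex.ofReal_inv, Complex.ofReal_re]
  congr 3
  have : (-1 / (2 * s)) • y + (1 / (2 * s)) • y' = (-1 / (2 * s)) • (y - y') := by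
    rw [smul_sub, sub_eq_add_neg, ← neg_smul]
    congr 2
    ring
  rw [this, norm_smul, mul_pow, Real.norm_eq_abs, sq_abs]
  field_simp
  ring

lemma lintegral_gaussianMajorant (n : ℕ) {e s : ℝ} (he : 0 < e) (hs : s ≠ 0) :
    ∫⁻ z : Rn n, ENNReal.ofReal (gaussianMajorant n e s z) = 1 := by
  have hπ := Real.pi_pos
  have hs2 : 0 < s ^ 2 := by positivity
  have hc : 0 < 1 / (16 * s ^ 2 * e) := by positivity
  have hi : ∫ z : Rn n, gaussianMajorant n e s z = 1 := by
    unfold gaussianMajorant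
    rw [integral_const_mul, integral_const_mul, GaussianFourier.integral_rexp_neg_mul_sq_norm hc]
    have : (Module.finrank ℝ (Rn n) : ℝ) / 2 = n / 2 := by simp
    rw [this, Real.rpow_neg (by positivity), ← Real.inv_rpow (by positivity),
      ← Real.mul_rpow (by positivity) (by positivity),
      ← Real.mul_rpow (by positivity) (by positivity),
      ← Real.mul_rpow (by positivity) (by positivity)]
    have h1 : (4 * Real.pi * |s|)⁻¹ * (4 * Real.pi * |s|)⁻¹ *
        (Real.pi / e * (Real.pi / (1 / (16 * s ^ 2 * e)))) = 1 := by
      rw [← sq_abs s]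
      have := abs_pos.2 hs
      field_simp
      norm_num
    rw [h1, Real.one_rpow]
  rw [← ofReal_integral_eq_lintegral_ofReal, hi, ENNReal.ofReal_one]
  · by_contra h
    rw [integral_undef h] at hi
    exact zero_ne_one hi
  · refine ae_of_all _ fun z => ?_
    simp only [Pi.zero_apply]
    unfold gaussianMajorant
    positivity

lemma integrable_gaussianWeight (n : ℕ) {e : ℝ} (he : 0 < e) :
    Integrable (fun x : Rn n => Real.exp (-e * ‖x‖ ^ 2)) := by
  have h := GaussianFourier.integrable_cexp_neg_mul_sq_norm_add (V := Rn n) (b := (e : ℂ))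
    (by simpa using he) 0 0
  have h2 := h.re
  refine h2.congr (ae_of_all _ fun x => ?_)
  have : Complex.exp (-(e : ℂ) * (‖x‖ : ℂ) ^ 2 + 0 * ((inner ℝ (0 : Rn n) x : ℝ) : ℂ))
      = ((Real.exp (-e * ‖x‖ ^ 2) : ℝ) : ℂ) := by
    push_cast; simp
  simp only [this]
  exact Complex.ofReal_re _

lemma tendsto_gaussianWeight (n : ℕ) (x : Rn n) :
    Tendsto (fun j : ℕ => Real.exp (-(1 / ((j : ℝ) + 1)) * ‖x‖ ^ 2)) atTop (nhds 1) := by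
  have h := (tendsto_one_div_add_atTop_nhds_zero_nat (𝕜 := ℝ)).neg.mul_const (‖x‖ ^ 2)
  rw [neg_zero, zero_mul] at h
  simpa [Function.comp_def] using (Real.continuous_exp.tendsto 0).comp h

/-- The free propagator is a contraction on `L²`. -/
lemma lor_two_freeKernel_le (n : ℕ) {s : ℝ} (hs : s ≠ 0) {f : Rn n → ℂ} (hf : Nice volume f) :
    lor volume 2 (fun x => ‖∫ y, freeKernel n s (x - y) * f y‖ₑ)
      ≤ lor volume 2 (fun x => ‖f x‖ₑ) := by
  have mk : Measurable fun q : Rn n × Rn n => freeKernel n s (q.1 - q.2) :=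
    (measurable_freeKernel n).comp (by fun_prop : Measurable fun q : Rn n × Rn n => (s, q.1 - q.2))
  have mf := hf.meas
  have mG : Measurable fun x => ∫ y, freeKernel n s (x - y) * f y :=
    ((mk.mul (mf.comp measurable_snd)).stronglyMeasurable.integral_prod_right'
      (ν := volume)).measurable
  rw [lor_two mG.enorm, lor_two mf.enorm]
  refine ENNReal.rpow_le_rpow (lintegral_sq_le_of_weights (μ := volume)
    (w := fun (j : ℕ) (x : Rn n) => Real.exp (-(1 / ((j : ℝ) + 1)) * ‖x‖ ^ 2))
    (fun j => by fun_prop) (tendsto_gaussianWeight n) mG.enorm fun j => ?_) (by norm_num)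
  have he : (0 : ℝ) < 1 / ((j : ℝ) + 1) := by positivity
  set e := 1 / ((j : ℝ) + 1)
  rw [lintegral_weight_mul_sq_eq (fun x => (Real.exp_pos _).le) (integrable_gaussianWeight n he)
    (k := fun x y => freeKernel n s (x - y)) mk ⟨_, fun x y => (norm_freeKernel n s _).le⟩ hf]
  set H : Rn n → ℝ≥0∞ := fun z => ENNReal.ofReal (gaussianMajorant n e s z) with hH
  have mH : Measurable H := by
    have : Measurable (gaussianMajorant n e s) := by unfold gaussianMajorant; fun_prop
    exact this.ennreal_ofReal
  have hHint : ∫⁻ z, H z = 1 := lintegral_gaussianMajorant n he hs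
  set a : Rn n → ℝ≥0∞ := fun y => ‖f y‖ₑ with ha
  have ma : Measurable a := mf.enorm
  have two : (2 : ℝ≥0∞)⁻¹ * 2 = 1 := ENNReal.inv_mul_cancel (by norm_num) (by norm_num)
  have amgm : ∀ u v : ℝ≥0∞, u * v ≤ 2⁻¹ * (u ^ 2 + v ^ 2) := by
    intro u v
    have : 2 * (u * v) ≤ u ^ 2 + v ^ 2 := by
      rcases le_total u v with h | h
      · obtain ⟨d, rfl⟩ := exists_add_of_le h
        calc 2 * (u * (u + d)) ≤ 2 * (u * (u + d)) + d ^ 2 := le_self_add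
          _ = _ := by ring
      · obtain ⟨d, rfl⟩ := exists_add_of_le h
        calc 2 * ((v + d) * v) ≤ 2 * ((v + d) * v) + d ^ 2 := le_self_add
          _ = _ := by ring
    calc u * v = 2⁻¹ * (2 * (u * v)) := by rw [← mul_assoc, two, one_mul]
      _ ≤ _ := by gcongr
  calc _ ≤ ∫⁻ q : Rn n × Rn n, H (q.1 - q.2) * (a q.1 * a q.2) ∂(volume.prod volume) := by
        refine (enorm_integral_le_lintegral_enorm _).trans (lintegral_mono fun q => ?_)
        simp only
        rw [enorm_mul, enorm_mul, ← ofReal_norm (composeKernel _ _ _ _ _ _)]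
        refine mul_le_mul' (ENNReal.ofReal_le_ofReal
          (norm_integral_gaussian_mul_freeKernel_self n he hs q.1 q.2).le) (le_of_eq ?_)
        rw [← ofReal_norm ((starRingEnd ℂ) _), RCLike.norm_conj, ofReal_norm]
    _ ≤ ∫⁻ q : Rn n × Rn n, 2⁻¹ * (H (q.1 - q.2) * a q.1 ^ 2 + H (q.1 - q.2) * a q.2 ^ 2)
        ∂(volume.prod volume) := by
        refine lintegral_mono fun q => ?_
        calc H (q.1 - q.2) * (a q.1 * a q.2)
            ≤ H (q.1 - q.2) * (2⁻¹ * (a q.1 ^ 2 + a q.2 ^ 2)) := mul_le_mul_right (amgm _ _) _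
          _ = _ := by ring
    _ = 2⁻¹ * ((∫⁻ y, ∫⁻ y', H (y - y') * a y ^ 2) + ∫⁻ y', ∫⁻ y, H (y - y') * a y' ^ 2) := by
        rw [lintegral_const_mul _ (by fun_prop), lintegral_add_left (by fun_prop),
          lintegral_prod _ (Measurable.aemeasurable (by fun_prop)),
          lintegral_prod_symm _ (Measurable.aemeasurable (by fun_prop))]
    _ = 2⁻¹ * ((∫⁻ y, a y ^ 2) + ∫⁻ y, a y ^ 2) := by
        congr 2
        · refine lintegral_congr fun y => ?_
          rw [lintegral_mul_const _ (by fun_prop), lintegral_sub_left_eq_self H y, hHint, one_mul]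
        · refine lintegral_congr fun y => ?_
          rw [lintegral_mul_const _ (by fun_prop), lintegral_sub_right_eq_self H y, hHint, one_mul]
    _ = ∫⁻ y, a y ^ 2 := by rw [← two_mul, ← mul_assoc, two, one_mul]

end FreeKernelBounds

section CutoffKernel

/-- The free propagator `e^{iσ(t-τ)Δ}` weighted by a function `a t τ` of the two times. -/
noncomputable def cutoffKernel (n : ℕ) (σ : ℝ) (a : ℝ → ℝ → ℝ) (z w : ℝ × Rn n) : ℂ :=
  (a z.1 w.1 : ℂ) * freeKernel n (σ * (z.1 - w.1)) (z.2 - w.2)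

lemma measurable_cutoffKernel (n : ℕ) (σ : ℝ) {a : ℝ → ℝ → ℝ}
    (ma : Measurable (Function.uncurry a)) :
    Measurable (Function.uncurry (cutoffKernel n σ a)) := by
  have h1 : Measurable fun q : (ℝ × Rn n) × (ℝ × Rn n) => (a q.1.1 q.2.1 : ℂ) :=
    Complex.measurable_ofReal.comp
      (ma.comp (by fun_prop : Measurable fun q : (ℝ × Rn n) × (ℝ × Rn n) => (q.1.1, q.2.1)))
  have h2 : Measurable fun q : (ℝ × Rn n) × (ℝ × Rn n) =>
      freeKernel n (σ * (q.1.1 - q.2.1)) (q.1.2 - q.2.2) := by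
    have : Measurable fun q : (ℝ × Rn n) × (ℝ × Rn n) => q.1.2 - q.2.2 :=
      (measurable_snd.comp measurable_fst).sub (measurable_snd.comp measurable_snd)
    unfold freeKernel
    fun_prop
  have e : Function.uncurry (cutoffKernel n σ a) = fun q : (ℝ × Rn n) × (ℝ × Rn n) =>
      (a q.1.1 q.2.1 : ℂ) * freeKernel n (σ * (q.1.1 - q.2.1)) (q.1.2 - q.2.2) := rfl
  rw [e]
  exact h1.mul h2

lemma strichartzKernel_cutoffKernel (n : ℕ) {σ δ : ℝ} {a : ℝ → ℝ → ℝ} (hσ : |σ| = 1)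
    (hδ : 0 < δ) (ma : Measurable (Function.uncurry a)) (h1 : ∀ t τ, |a t τ| ≤ 1)
    (h0 : ∀ t τ, |t - τ| < δ → a t τ = 0) :
    StrichartzKernel (volume : Measure (Rn n)) (n / 2 : ℝ) (cutoffKernel n σ a) := by
  have hn1 : ∀ t τ, ‖(a t τ : ℂ)‖ ≤ 1 := fun t τ => by
    rw [Complex.norm_real]; exact h1 t τ
  have hσ0 : σ ≠ 0 := fun h => by simp [h] at hσ
  have hne : ∀ t τ, a t τ ≠ 0 → σ * (t - τ) ≠ 0 := fun t τ h => by
    refine mul_ne_zero hσ0 fun h' => h (h0 t τ ?_)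
    rw [h', abs_zero]; exact hδ
  have habs : ∀ s, |σ * s| = |s| := fun s => by rw [abs_mul, hσ, one_mul]
  refine ⟨measurable_cutoffKernel n σ ma, ⟨δ ^ (-(n / 2 : ℝ)), fun z w => ?_⟩, fun z w hzw => ?_,
    fun t τ f hf => ?_, fun t => ?_⟩
  · by_cases h : |z.1 - w.1| < δ
    · rw [cutoffKernel, h0 _ _ h]
      simpa using by positivity
    · have hs : σ * (z.1 - w.1) ≠ 0 := by
        refine mul_ne_zero hσ0 fun h' => h ?_
        rw [h', abs_zero]; exact hδ
      rw [cutoffKernel, norm_mul]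
      refine (mul_le_of_le_one_left (norm_nonneg _) (hn1 _ _)).trans
        ((norm_freeKernel_le n hs _).trans ?_)
      rw [habs]
      exact Real.rpow_le_rpow_of_nonpos hδ (not_lt.1 h) (neg_nonpos.2 (by positivity))
  · rw [cutoffKernel, norm_mul]
    refine (mul_le_of_le_one_left (norm_nonneg _) (hn1 _ _)).trans
      ((norm_freeKernel_le n (mul_ne_zero hσ0 (sub_ne_zero.2 hzw)) _).trans_eq ?_)
    rw [habs]
  · by_cases h : a t τ = 0
    · simp [cutoffKernel, h, lor_zero]
    · refine le_trans (lor_mono 2 (ae_of_all _ fun x => ?_)) (lor_two_freeKernel_le n (hne t τ h) hf)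
      simp only [cutoffKernel, mul_assoc]
      rw [integral_const_mul, enorm_mul]
      refine mul_le_of_le_one_left bot_le ?_
      rw [← ofReal_norm]
      exact ENNReal.ofReal_le_one.2 (hn1 t τ)
  · refine ⟨fun (j : ℕ) x => Real.exp (-(1 / ((j : ℝ) + 1)) * ‖x‖ ^ 2), fun j => by fun_prop,
      fun j x => (Real.exp_pos _).le, fun j x => ?_,
      fun j => integrable_gaussianWeight n (by positivity), tendsto_gaussianWeight n,
      fun j z z' hz => ?_⟩
    · rw [Real.exp_le_one_iff]
      have : 0 ≤ (1 / ((j : ℝ) + 1)) * ‖x‖ ^ 2 := by positivity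
      linarith
    · have e : composeKernel volume (fun x : Rn n => Real.exp (-(1 / ((j : ℝ) + 1)) * ‖x‖ ^ 2))
          (fun x => cutoffKernel n σ a (t, x))
          (fun x z => (starRingEnd ℂ) (cutoffKernel n σ a (t, x) z)) z z'
          = ((a t z.1 : ℂ) * (a t z'.1 : ℂ)) *
            ∫ x : Rn n, ((Real.exp (-(1 / ((j : ℝ) + 1)) * ‖x‖ ^ 2) : ℝ) : ℂ) *
              (freeKernel n (σ * (t - z.1)) (x - z.2) *
                (starRingEnd ℂ) (freeKernel n (σ * (t - z'.1)) (x - z'.2))) := by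
        rw [← integral_const_mul]
        unfold composeKernel
        refine integral_congr_ae (ae_of_all _ fun x => ?_)
        simp only [cutoffKernel, map_mul, Complex.conj_ofReal]
        ring
      rw [e, norm_mul, norm_mul]
      by_cases h : a t z.1 = 0
      · simpa [h] using by positivity
      by_cases h' : a t z'.1 = 0
      · simpa [h'] using by positivity
      refine (mul_le_of_le_one_left (norm_nonneg _)
        (mul_le_one₀ (hn1 _ _) (norm_nonneg _) (hn1 _ _))).trans ?_
      refine (norm_integral_gaussian_mul_freeKernel_le n (by positivity) (hne _ _ h) (hne _ _ h')
        ?_ _ _).trans_eq ?_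
      · intro h''
        have := mul_left_cancel₀ hσ0 h''
        exact hz (by linarith)
      · rw [← mul_sub, habs, abs_sub_comm]
        ring_nf

lemma freeKernel_neg (n : ℕ) (s : ℝ) (z : Rn n) : freeKernel n s (-z) = freeKernel n s z := by
  rw [freeKernel, norm_neg, freeKernel]

lemma cutoffKernel_swap (n : ℕ) (σ : ℝ) (a : ℝ → ℝ → ℝ) :
    (fun z w => cutoffKernel n σ a w z) = cutoffKernel n (-σ) (fun t τ => a τ t) := by
  ext z w
  have : σ * (w.1 - z.1) = -σ * (z.1 - w.1) := by ring
  rw [cutoffKernel, cutoffKernel, ← freeKernel_neg n _ (w.2 - z.2), neg_sub, this]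

/-- Strichartz estimate for truncated Duhamel operators, uniform in the truncation. -/
lemma exists_outNorm_cutoffKernel_le (n : ℕ) (hn : 1 ≤ n) {p r : ℝ} (hp : 2 ≤ p) (hr : 2 ≤ r)
    (hαp : (n / 2 : ℝ) * (1 - 2 / p) < 1) (hαr : (n / 2 : ℝ) * (1 - 2 / r) < 1) :
    ∃ C : ℝ≥0∞, C ≠ ⊤ ∧ ∀ (a : ℝ → ℝ → ℝ) (δ : ℝ), 0 < δ → Measurable (Function.uncurry a) →
      (∀ t τ, |a t τ| ≤ 1) → (∀ t τ, |t - τ| < δ → a t τ = 0) →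
      ∀ f : ℝ × Rn n → ℂ, BoxNice volume f →
        outNorm ((n / 2 : ℝ) * (1 - 2 / p))
          (fun t => lor volume p fun x => ‖kernelOp volume (cutoffKernel n 1 a) f (t, x)‖ₑ) ≤
        C * inNorm ((n / 2 : ℝ) * (1 - 2 / r))
          (fun t => lor volume (r / (r - 1)) fun x => ‖f (t, x)‖ₑ) := by
  have hν : (0 : ℝ) < n / 2 := by
    have : (0 : ℝ) < n := by exact_mod_cast hn
    positivity
  obtain ⟨C, hC, h⟩ := exists_outNorm_kernelOp_le (μ := (volume : Measure (Rn n))) hν hp hr hαp hαr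
  refine ⟨C, hC, fun a δ hδ ma h1 h0 f hf => h _ ?_ ?_ f hf⟩
  · exact strichartzKernel_cutoffKernel n (by simp) hδ ma h1 h0
  · rw [cutoffKernel_swap]
    exact strichartzKernel_cutoffKernel n (by simp) hδ (ma.comp measurable_swap)
      (fun t τ => h1 τ t) (fun t τ h => h0 τ t (by rwa [abs_sub_comm]))

end CutoffKernel

section Norms

lemma lornorm_eq_lor (n : ℕ) {p : ℝ} (hp : 0 < p) (f : Rn n → ℂ) :
    lornorm n p f = lor volume p (fun x => ‖f x‖ₑ) := by
  unfold lornorm lorentzNorm lor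
  rw [if_neg (by norm_num)]
  have h2 : (2 : ℝ≥0∞).toReal = 2 := by norm_num
  rw [h2, ENNReal.toReal_ofReal hp.le, one_div]
  congr 1
  refine setLIntegral_congr_fun measurableSet_Ioi fun t (ht : 0 < t) => ?_
  have e : rearrangement volume f t = rearr volume (fun x => ‖f x‖ₑ) t := rfl
  simp only [e]
  rw [ENNReal.mul_rpow_of_nonneg _ _ (by norm_num), ENNReal.rpow_two, ENNReal.rpow_two,
    mul_right_comm, ENNReal.ofReal_rpow_of_pos ht, ← ENNReal.ofReal_pow (by positivity),
    ← ENNReal.ofReal_mul (by positivity)]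
  congr 2
  rw [← Real.rpow_natCast, ← Real.rpow_mul ht.le, Real.rpow_sub_one ht.ne', ← div_eq_mul_inv]
  congr 2
  push_cast
  ring

lemma gam_eq (n : ℕ) (p : ℝ) :
    gam n p = (ENNReal.ofReal ((n / 2 : ℝ) * (1 - 2 / p) / 2))⁻¹ := by
  unfold gam
  congr 2
  ring

lemma timeNorm_le_outNorm {α : ℝ} (hα : 0 ≤ α) {I : Set ℝ} (hI : MeasurableSet I)
    {N M : ℝ → ℝ≥0∞} (h : ∀ t ∈ I, N t ≤ M t) :
    timeNorm (ENNReal.ofReal (α / 2))⁻¹ I N ≤ outNorm α M := by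
  unfold timeNorm outNorm
  rcases hα.eq_or_lt with rfl | h0
  · rw [if_pos (by simp), if_pos rfl]
    exact (essSup_mono_ae (ae_restrict_of_forall_mem hI h)).trans
      (essSup_mono_measure' Measure.restrict_le_self)
  · have h1 : 0 < ENNReal.ofReal (α / 2) := ENNReal.ofReal_pos.2 (by positivity)
    rw [if_neg (ENNReal.inv_ne_top.2 h1.ne'), if_neg h0.ne', ENNReal.toReal_inv,
      ENNReal.toReal_ofReal (by positivity), inv_inv, inv_div]
    refine ENNReal.rpow_le_rpow ((setLIntegral_mono' hI fun t ht =>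
      ENNReal.rpow_le_rpow (h t ht) (by positivity)).trans (setLIntegral_le_lintegral _ _))
      (by positivity)

lemma inNorm_indicator_le_timeNorm {α : ℝ} (hα : 0 ≤ α) (hα1 : α < 1) {I : Set ℝ}
    (hI : MeasurableSet I) (N : ℝ → ℝ≥0∞) :
    inNorm α (I.indicator N) ≤ timeNorm (conjE (ENNReal.ofReal (α / 2))⁻¹) I N := by
  have e : conjE (ENNReal.ofReal (α / 2))⁻¹ = ENNReal.ofReal (1 - α / 2)⁻¹ := by
    unfold conjE
    rw [inv_inv, ← ENNReal.ofReal_one, ← ENNReal.ofReal_sub _ (by positivity),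
      ENNReal.ofReal_inv_of_pos (by linarith)]
  have hpos : 0 < (1 - α / 2)⁻¹ := inv_pos.2 (by linarith)
  rw [e, timeNorm, if_neg ENNReal.ofReal_ne_top, ENNReal.toReal_ofReal hpos.le, inv_inv, inNorm,
    ← lintegral_indicator hI]
  refine le_of_eq ?_
  congr 2
  ext t
  by_cases ht : t ∈ I
  · simp [ht]
  · simp [ht, hpos]

lemma subcrit.two_le {n : ℕ} {p : ℝ} (h : subcrit n p) : 2 ≤ p := h.1

lemma subcrit.exponent_nonneg {n : ℕ} {p : ℝ} (h : subcrit n p) :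
    0 ≤ (n / 2 : ℝ) * (1 - 2 / p) := by
  have h2 := h.1
  have : 2 / p ≤ 1 := (div_le_one (by linarith)).2 h2
  exact mul_nonneg (by positivity) (by linarith)

lemma subcrit.exponent_lt_one {n : ℕ} {p : ℝ} (h : subcrit n p) :
    (n / 2 : ℝ) * (1 - 2 / p) < 1 := by
  have h2 := h.1
  have hp : 0 < p := by linarith
  have h3 : 0 < 2 / p := by positivity
  by_cases hn : 3 ≤ n
  · have h4 := h.2 hn
    have hn' : (3 : ℝ) ≤ n := by exact_mod_cast hn
    rw [lt_div_iff₀ (by linarith)] at h4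
    have : (n / 2 : ℝ) * (1 - 2 / p) = (n * (p - 2)) / (2 * p) := by field_simp
    rw [this, div_lt_one (by positivity)]
    nlinarith
  · have hn' : (n : ℝ) ≤ 2 := by exact_mod_cast (by omega : n ≤ 2)
    have hn0 : (0 : ℝ) ≤ n := by positivity
    have : 2 / p ≤ 1 := (div_le_one (by linarith)).2 h2
    nlinarith

end Norms

section Truncation

/-- The sign with which `τ` contributes to the oriented integral from `t₀` to `t`. -/
noncomputable def timeSign (t₀ t τ : ℝ) : ℝ :=
  (if t₀ < τ ∧ τ ≤ t then 1 else 0) - (if t < τ ∧ τ ≤ t₀ then 1 else 0)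

/-- `timeSign` with a neighbourhood of the diagonal removed. -/
noncomputable def timeCut (t₀ δ t τ : ℝ) : ℝ := if δ ≤ |t - τ| then timeSign t₀ t τ else 0

lemma measurable_timeSign (t₀ : ℝ) : Measurable (Function.uncurry (timeSign t₀)) := by
  have h1 : MeasurableSet {q : ℝ × ℝ | t₀ < q.2 ∧ q.2 ≤ q.1} :=
    (measurableSet_lt measurable_const measurable_snd).inter
      (measurableSet_le measurable_snd measurable_fst)
  have h2 : MeasurableSet {q : ℝ × ℝ | q.1 < q.2 ∧ q.2 ≤ t₀} :=
    (measurableSet_lt measurable_fst measurable_snd).inter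
      (measurableSet_le measurable_snd measurable_const)
  exact (Measurable.ite h1 measurable_const measurable_const).sub
    (Measurable.ite h2 measurable_const measurable_const)

lemma measurable_timeCut (t₀ δ : ℝ) : Measurable (Function.uncurry (timeCut t₀ δ)) := by
  have h1 : MeasurableSet {q : ℝ × ℝ | δ ≤ |q.1 - q.2|} :=
    measurableSet_le measurable_const (by fun_prop)
  exact Measurable.ite h1 (measurable_timeSign t₀) measurable_const

lemma abs_timeSign_le (t₀ t τ : ℝ) : |timeSign t₀ t τ| ≤ 1 := by
  unfold timeSign
  split_ifs <;> norm_num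

lemma abs_timeCut_le (t₀ δ t τ : ℝ) : |timeCut t₀ δ t τ| ≤ |timeSign t₀ t τ| := by
  unfold timeCut
  split_ifs <;> simp

lemma timeSign_smul_eq {t₀ t : ℝ} (g : ℝ → ℂ) : (fun τ => (timeSign t₀ t τ : ℂ) * g τ)
    = fun τ => (Ioc t₀ t).indicator g τ - (Ioc t t₀).indicator g τ := by
  ext τ
  simp only [timeSign, indicator, mem_Ioc]
  split_ifs <;> simp

lemma integrable_timeSign_mul {t₀ t : ℝ} {g : ℝ → ℂ} (hg : IntervalIntegrable g volume t₀ t) :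
    Integrable (fun τ => (timeSign t₀ t τ : ℂ) * g τ) := by
  rw [timeSign_smul_eq]
  exact (hg.1.integrable_indicator measurableSet_Ioc).sub
    (hg.2.integrable_indicator measurableSet_Ioc)

lemma intervalIntegral_eq_integral_timeSign {t₀ t : ℝ} {g : ℝ → ℂ}
    (hg : IntervalIntegrable g volume t₀ t) :
    ∫ τ in t₀..t, g τ = ∫ τ, (timeSign t₀ t τ : ℂ) * g τ := by
  rw [timeSign_smul_eq, integral_sub (hg.1.integrable_indicator measurableSet_Ioc)
    (hg.2.integrable_indicator measurableSet_Ioc), integral_indicator measurableSet_Ioc,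
    integral_indicator measurableSet_Ioc]
  rfl

lemma timeSign_eq_zero {I : Set ℝ} (hI : I.OrdConnected) {t₀ t τ : ℝ} (ht₀ : t₀ ∈ closure I)
    (ht : t ∈ I) (hτ : τ ∉ I) (h : τ ≠ t₀) : timeSign t₀ t τ = 0 := by
  have h1 : ¬(t₀ < τ ∧ τ ≤ t) := fun ⟨h1, h2⟩ => by
    obtain ⟨s, hs, hsI⟩ := mem_closure_iff.1 ht₀ (Iio τ) isOpen_Iio h1
    exact hτ (hI.out hsI ht ⟨hs.le, h2⟩)
  have h2 : ¬(t < τ ∧ τ ≤ t₀) := fun ⟨h1, h2⟩ => by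
    obtain ⟨s, hs, hsI⟩ := mem_closure_iff.1 ht₀ (Ioi τ) isOpen_Ioi (lt_of_le_of_ne h2 h)
    exact hτ (hI.out ht hsI ⟨h1.le, hs.le⟩)
  rw [timeSign, if_neg h1, if_neg h2, sub_zero]

/-- An estimate for an integral operator with bounded kernel extends from box-supported bounded
functions to integrable ones. -/
lemma outNorm_kernelOp_le_of_integrable {X : Type*} [NormedAddCommGroup X] [MeasurableSpace X]
    [OpensMeasurableSpace X] {μ : Measure X} [SFinite μ] (hμ : ∀ R, μ (Metric.closedBall 0 R) < ⊤)
    {K : ℝ × X → ℝ × X → ℂ} (mK : Measurable (Function.uncurry K)) (hb : ∃ M, ∀ z w, ‖K z w‖ ≤ M)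
    {p q α β : ℝ} (hα : 0 ≤ α) (hβ : β < 1) {C : ℝ≥0∞}
    (h : ∀ g, BoxNice μ g → outNorm α (fun t => lor μ p fun x => ‖kernelOp μ K g (t, x)‖ₑ)
      ≤ C * inNorm β (fun t => lor μ q fun x => ‖g (t, x)‖ₑ))
    {F : ℝ × X → ℂ} (mF : Measurable F) (hF : Integrable F (volume.prod μ)) :
    outNorm α (fun t => lor μ p fun x => ‖kernelOp μ K F (t, x)‖ₑ)
      ≤ C * inNorm β (fun t => lor μ q fun x => ‖F (t, x)‖ₑ) := by
  classical
  obtain ⟨M, hM⟩ := hb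
  let S : ℕ → Set (ℝ × X) := fun k => {z | |z.1| ≤ k ∧ ‖z.2‖ ≤ k ∧ ‖F z‖ ≤ k}
  have mS : ∀ k, MeasurableSet (S k) := fun k => by
    have h1 : MeasurableSet {z : ℝ × X | |z.1| ≤ k} :=
      measurableSet_le (by fun_prop) measurable_const
    have h2 : MeasurableSet {z : ℝ × X | ‖z.2‖ ≤ k} :=
      measurableSet_le (measurable_norm.comp measurable_snd) measurable_const
    have h3 : MeasurableSet {z : ℝ × X | ‖F z‖ ≤ k} :=
      measurableSet_le mF.norm measurable_const
    exact h1.inter (h2.inter h3)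
  let G : ℕ → ℝ × X → ℂ := fun k => (S k).indicator F
  have mG : ∀ k, Measurable (G k) := fun k => mF.indicator (mS k)
  have hle : ∀ k z, ‖G k z‖ ≤ ‖F z‖ := fun k z => norm_indicator_le_norm_self _ _
  have hG : ∀ k, BoxNice μ (G k) := fun k => by
    refine ⟨mG k, ⟨k, fun z => ?_⟩, k, Metric.closedBall 0 k, hμ k, fun z hz => ?_⟩
    · by_cases hz : z ∈ S k
      · simp only [G, indicator_of_mem hz]; exact hz.2.2
      · simp [G, indicator_of_notMem hz]
    · have := mem_of_indicator_ne_zero hz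
      exact ⟨this.1, by simpa using this.2.1⟩
  have hev : ∀ z, ∀ᶠ k in atTop, G k z = F z := fun z => by
    obtain ⟨k₀, hk₀⟩ := exists_nat_ge (max |z.1| (max ‖z.2‖ ‖F z‖))
    filter_upwards [eventually_ge_atTop k₀] with k hk
    have hk' : (k₀ : ℝ) ≤ k := by exact_mod_cast hk
    have h' := hk₀.trans hk'
    exact indicator_of_mem (show z ∈ S k from ⟨(le_max_left _ _).trans h',
      (le_max_left _ _).trans ((le_max_right _ _).trans h'),
      (le_max_right _ _).trans ((le_max_right _ _).trans h')⟩) _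
  have mKz : ∀ z, Measurable (K z) := fun z => mK.comp (by fun_prop : Measurable fun w => (z, w))
  have hlim : ∀ z, Tendsto (fun k => kernelOp μ K (G k) z) atTop (nhds (kernelOp μ K F z)) := by
    intro z
    refine tendsto_integral_of_dominated_convergence (fun w => M * ‖F w‖)
      (fun k => ((mKz z).mul (mG k)).aestronglyMeasurable) (hF.norm.const_mul M)
      (fun k => ae_of_all _ fun w => ?_) (ae_of_all _ fun w => ?_)
    · rw [norm_mul]
      exact mul_le_mul (hM z w) (hle k w) (norm_nonneg _) ((norm_nonneg _).trans (hM z w))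
    · refine tendsto_const_nhds.congr' ?_
      filter_upwards [hev w] with k hk
      rw [hk]
  have mO : ∀ k, Measurable (kernelOp μ K (G k)) := fun k => measurable_kernelOp mK (mG k)
  refine outNorm_le_of_le_liminf hα (fun k => BoxNice.measurable_lor (mO k) p)
    (ae_of_all _ fun t => lor_le_liminf p
      (fun k => ((mO k).comp (by fun_prop : Measurable fun x => (t, x))).enorm) fun x => ?_)
    fun k => (h _ (hG k)).trans (mul_le_mul_right (inNorm_mono hβ (ae_of_all _ fun t =>
      lor_mono q (ae_of_all _ fun x => ?_))) _)
  · exact (hlim (t, x)).enorm.liminf_eq.ge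
  · rw [← ofReal_norm, ← ofReal_norm]
    exact ENNReal.ofReal_le_ofReal (hle k _)

end Truncation

section Duhamel

lemma schrodinger_eq_zero_of_lintegral_eq_top (n : ℕ) {s : ℝ} (hs : s ≠ 0) {f : Rn n → ℂ}
    (hf : ∫⁻ y, ‖f y‖ₑ = ⊤) (x : Rn n) : schrodinger n s f x = 0 := by
  rw [schrodinger_eq_integral_freeKernel]
  refine integral_undef fun h => ?_
  have h2 := h.2
  rw [HasFiniteIntegral] at h2
  have e : ∀ y, ‖freeKernel n s (x - y) * f y‖ₑ
      = ENNReal.ofReal ((4 * Real.pi * |s|) ^ (-(n / 2 : ℝ))) * ‖f y‖ₑ := fun y => by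
    rw [enorm_mul, ← ofReal_norm (freeKernel _ _ _), norm_freeKernel]
  simp_rw [e] at h2
  rw [lintegral_const_mul' _ _ ENNReal.ofReal_ne_top, hf, ENNReal.mul_top] at h2
  · exact lt_irrefl _ h2
  · have : 0 < |s| := abs_pos.2 hs
    have := Real.pi_pos
    exact (ENNReal.ofReal_pos.2 (by positivity)).ne'

lemma measurable_schrodinger_sub (n : ℕ) {f : ℝ → Rn n → ℂ}
    (mf : Measurable fun q : ℝ × Rn n => f q.1 q.2) (t : ℝ) (x : Rn n) :
    Measurable fun τ => schrodinger n (t - τ) (f τ) x := by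
  simp_rw [schrodinger_eq_integral_freeKernel]
  have h : Measurable fun q : ℝ × Rn n => freeKernel n (t - q.1) (x - q.2) := by
    unfold freeKernel
    fun_prop
  exact ((h.mul mf).stronglyMeasurable.integral_prod_right' (ν := volume)).measurable

/-- The times in `I ∩ [-m, m]` at which `f` has `L¹` norm at most `m`. -/
def goodTimes {n : ℕ} (I : Set ℝ) (f : ℝ → Rn n → ℂ) (m : ℕ) : Set ℝ :=
  {τ | τ ∈ I ∧ |τ| ≤ m ∧ ∫⁻ y, ‖f τ y‖ₑ ≤ m}

/-- The restriction of `f` to its good times. -/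
noncomputable def goodPart {n : ℕ} (I : Set ℝ) (f : ℝ → Rn n → ℂ) (m : ℕ) : ℝ × Rn n → ℂ :=
  (Prod.fst ⁻¹' goodTimes I f m).indicator fun q => f q.1 q.2

variable {n : ℕ} {I : Set ℝ} {f : ℝ → Rn n → ℂ}

lemma measurableSet_goodTimes (hI : MeasurableSet I)
    (mf : Measurable fun q : ℝ × Rn n => f q.1 q.2) (m : ℕ) :
    MeasurableSet (goodTimes I f m) := by
  have h1 : MeasurableSet {τ : ℝ | |τ| ≤ m} := measurableSet_le (by fun_prop) measurable_const
  have h2 : MeasurableSet {τ : ℝ | ∫⁻ y, ‖f τ y‖ₑ ≤ m} :=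
    measurableSet_le mf.enorm.lintegral_prod_right' measurable_const
  exact hI.inter (h1.inter h2)

lemma measurable_goodPart (hI : MeasurableSet I)
    (mf : Measurable fun q : ℝ × Rn n => f q.1 q.2) (m : ℕ) : Measurable (goodPart I f m) :=
  mf.indicator (measurable_fst (measurableSet_goodTimes hI mf m))

lemma goodPart_of_mem {m : ℕ} {τ : ℝ} (h : τ ∈ goodTimes I f m) (y : Rn n) :
    goodPart I f m (τ, y) = f τ y :=
  indicator_of_mem (s := Prod.fst ⁻¹' goodTimes I f m) (a := (τ, y)) h _

lemma goodPart_of_notMem {m : ℕ} {τ : ℝ} (h : τ ∉ goodTimes I f m) (y : Rn n) :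
    goodPart I f m (τ, y) = 0 :=
  indicator_of_notMem (s := Prod.fst ⁻¹' goodTimes I f m) (a := (τ, y)) h _

lemma integrable_goodPart (hI : MeasurableSet I)
    (mf : Measurable fun q : ℝ × Rn n => f q.1 q.2) (m : ℕ) :
    Integrable (goodPart I f m) (volume.prod volume) := by
  have mF := measurable_goodPart hI mf m
  refine ⟨mF.aestronglyMeasurable, ?_⟩
  rw [HasFiniteIntegral, lintegral_prod _ mF.enorm.aemeasurable]
  calc ∫⁻ τ, ∫⁻ y, ‖goodPart I f m (τ, y)‖ₑ
      ≤ ∫⁻ τ, (Icc (-m : ℝ) m).indicator (fun _ => (m : ℝ≥0∞)) τ := by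
        refine lintegral_mono fun τ => ?_
        by_cases h : τ ∈ goodTimes I f m
        · simp_rw [goodPart_of_mem h]
          rw [indicator_of_mem (show τ ∈ Icc (-m : ℝ) m from abs_le.1 h.2.1)]
          exact h.2.2
        · simp_rw [goodPart_of_notMem h]
          simp
    _ = m * volume (Icc (-m : ℝ) m) := by rw [lintegral_indicator_const measurableSet_Icc]
    _ < ⊤ := ENNReal.mul_lt_top (ENNReal.natCast_lt_top m) measure_Icc_lt_top

lemma kernelOp_goodPart_eq (hI : MeasurableSet I)
    (mf : Measurable fun q : ℝ × Rn n => f q.1 q.2) (m : ℕ) {a : ℝ → ℝ → ℝ}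
    (ma : Measurable (Function.uncurry a)) (hb : ∃ M, ∀ z w, ‖cutoffKernel n 1 a z w‖ ≤ M)
    (t : ℝ) (x : Rn n) :
    kernelOp volume (cutoffKernel n 1 a) (goodPart I f m) (t, x)
      = ∫ τ, (goodTimes I f m).indicator
          (fun τ => (a t τ : ℂ) * schrodinger n (t - τ) (f τ) x) τ := by
  obtain ⟨M, hM⟩ := hb
  have mK : Measurable (cutoffKernel n 1 a (t, x)) :=
    (measurable_cutoffKernel n 1 ma).comp (by fun_prop : Measurable fun w => ((t, x), w))
  unfold kernelOp
  rw [integral_prod _ ((integrable_goodPart hI mf m).bdd_mul mK.aestronglyMeasurable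
    (ae_of_all _ fun w => hM (t, x) w))]
  refine integral_congr_ae (ae_of_all _ fun τ => ?_)
  by_cases h : τ ∈ goodTimes I f m
  · simp only [goodPart_of_mem h, indicator_of_mem h, cutoffKernel, one_mul, mul_assoc]
    rw [integral_const_mul, schrodinger_eq_integral_freeKernel]
  · simp [goodPart_of_notMem h, indicator_of_notMem h]

lemma tendsto_kernelOp_goodPart (hI : I.OrdConnected) {t₀ t : ℝ} (ht₀ : t₀ ∈ closure I)
    (ht : t ∈ I) (mf : Measurable fun q : ℝ × Rn n => f q.1 q.2) (x : Rn n)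
    (hb : ∀ m : ℕ, ∃ M, ∀ z w,
      ‖cutoffKernel n 1 (timeCut t₀ (1 / ((m : ℝ) + 1))) z w‖ ≤ M)
    (hint : IntervalIntegrable (fun τ => schrodinger n (t - τ) (f τ) x) volume t₀ t) :
    Tendsto (fun m : ℕ => kernelOp volume (cutoffKernel n 1 (timeCut t₀ (1 / ((m : ℝ) + 1))))
      (goodPart I f m) (t, x)) atTop (nhds (duhamel n t₀ f t x)) := by
  have mI := hI.measurableSet
  have mS := measurable_schrodinger_sub n mf t x
  rw [duhamel, intervalIntegral_eq_integral_timeSign hint]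
  simp_rw [fun m : ℕ => kernelOp_goodPart_eq mI mf m (measurable_timeCut t₀ (1 / ((m : ℝ) + 1)))
    (hb m) t x]
  refine tendsto_integral_of_dominated_convergence
    (fun τ => ‖(timeSign t₀ t τ : ℂ) * schrodinger n (t - τ) (f τ) x‖) (fun m => ?_)
    (integrable_timeSign_mul hint).norm (fun m => ae_of_all _ fun τ => ?_) ?_
  · have h1 : Measurable fun τ => (timeCut t₀ (1 / ((m : ℝ) + 1)) t τ : ℂ) :=
      Complex.measurable_ofReal.comp ((measurable_timeCut t₀ _).comp
        (by fun_prop : Measurable fun τ : ℝ => (t, τ)))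
    exact ((h1.mul mS).indicator (measurableSet_goodTimes mI mf m)).aestronglyMeasurable
  · refine (norm_indicator_le_norm_self _ _).trans ?_
    rw [norm_mul, norm_mul, Complex.norm_real, Complex.norm_real]
    gcongr
    exact abs_timeCut_le _ _ _ _
  · filter_upwards [compl_mem_ae_iff.2 (measure_singleton t),
      compl_mem_ae_iff.2 (measure_singleton t₀)] with τ h1 h2
    have hne : t - τ ≠ 0 := sub_ne_zero.2 fun h => h1 h.symm
    by_cases hτ : τ ∈ I
    · by_cases htop : ∫⁻ y, ‖f τ y‖ₑ = ⊤
      · rw [schrodinger_eq_zero_of_lintegral_eq_top n hne htop]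
        refine tendsto_const_nhds.congr fun m => ?_
        by_cases h : τ ∈ goodTimes I f m
        · rw [indicator_of_mem h, schrodinger_eq_zero_of_lintegral_eq_top n hne htop, mul_zero,
            mul_zero]
        · rw [indicator_of_notMem h, mul_zero]
      · refine tendsto_const_nhds.congr' ?_
        obtain ⟨m₁, hm₁⟩ := exists_nat_ge |τ|
        obtain ⟨m₂, hm₂⟩ := ENNReal.exists_nat_gt htop
        filter_upwards [eventually_ge_atTop m₁, eventually_ge_atTop m₂,
          tendsto_one_div_add_atTop_nhds_zero_nat.eventually_le_const (abs_pos.2 hne)]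
          with m h3 h4 h5
        have hm : τ ∈ goodTimes I f m :=
          ⟨hτ, hm₁.trans (by exact_mod_cast h3), hm₂.le.trans (by exact_mod_cast h4)⟩
        rw [indicator_of_mem hm, timeCut, if_pos h5]
    · refine tendsto_const_nhds.congr fun m => ?_
      rw [timeSign_eq_zero hI ht₀ ht hτ h2, indicator_of_notMem fun h => hτ h.1]
      simp

lemma enorm_duhamel_le_liminf (hI : I.OrdConnected) {t₀ t : ℝ} (ht₀ : t₀ ∈ closure I)
    (ht : t ∈ I) (mf : Measurable fun q : ℝ × Rn n => f q.1 q.2) (x : Rn n)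
    (hb : ∀ m : ℕ, ∃ M, ∀ z w,
      ‖cutoffKernel n 1 (timeCut t₀ (1 / ((m : ℝ) + 1))) z w‖ ≤ M) :
    ‖duhamel n t₀ f t x‖ₑ ≤ liminf (fun m : ℕ =>
      ‖kernelOp volume (cutoffKernel n 1 (timeCut t₀ (1 / ((m : ℝ) + 1))))
        (goodPart I f m) (t, x)‖ₑ) atTop := by
  by_cases hint : IntervalIntegrable (fun τ => schrodinger n (t - τ) (f τ) x) volume t₀ t
  · exact (tendsto_kernelOp_goodPart hI ht₀ ht mf x hb hint).enorm.liminf_eq.ge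
  · rw [duhamel, intervalIntegral.integral_undef hint]
    simp

end Duhamel

/-- inhomogeneous Strichartz estimate in Lorentz spaces:
`‖A_S f‖_{L^{γ(p)}(I, L^{p,2})} ≲ ‖f‖_{L^{γ(r)'}(I, L^{r',2})}` for `2 ≤ p, r < 2*`. -/
theorem strichartz_inhomogeneous_lorentz (n : ℕ) (hn : 1 ≤ n) (p r : ℝ)
    (hp : subcrit n p) (hr : subcrit n r) :
    ∃ C : ℝ≥0∞, C < ∞ ∧ ∀ I : Set ℝ, I.OrdConnected → ∀ t₀ ∈ closure I,
      ∀ f : ℝ → Rn n → ℂ, Measurable (fun q : ℝ × Rn n => f q.1 q.2) →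
        timeNorm (gam n p) I (fun t => lornorm n p (duhamel n t₀ f t)) ≤
          C * timeNorm (conjE (gam n r)) I (fun t => lornorm n (r / (r - 1)) (f t)) := by
  obtain ⟨C, hC, h⟩ := exists_outNorm_cutoffKernel_le n hn hp.two_le hr.two_le
    hp.exponent_lt_one hr.exponent_lt_one
  refine ⟨C, hC.lt_top, fun I hI t₀ ht₀ f mf => ?_⟩
  have hp2 := hp.two_le
  have hr2 := hr.two_le
  have mI := hI.measurableSet
  simp_rw [lornorm_eq_lor n (by linarith : 0 < p),
    lornorm_eq_lor n (div_pos (by linarith) (by linarith) : 0 < r / (r - 1))]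
  rw [gam_eq, gam_eq]
  set α := (n / 2 : ℝ) * (1 - 2 / p)
  set β := (n / 2 : ℝ) * (1 - 2 / r)
  have hβ : β < 1 := hr.exponent_lt_one
  let K : ℕ → ℝ × Rn n → ℝ × Rn n → ℂ := fun m =>
    cutoffKernel n 1 (timeCut t₀ (1 / ((m : ℝ) + 1)))
  have cut_le : ∀ δ t τ, |timeCut t₀ δ t τ| ≤ 1 := fun δ t τ =>
    (abs_timeCut_le _ _ _ _).trans (abs_timeSign_le _ _ _)
  have cut_zero : ∀ δ t τ, |t - τ| < δ → timeCut t₀ δ t τ = 0 := fun δ t τ h =>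
    if_neg (not_le.2 h)
  have hδ : ∀ m : ℕ, (0 : ℝ) < 1 / ((m : ℝ) + 1) := fun m => by positivity
  have hK : ∀ m, StrichartzKernel (volume : Measure (Rn n)) (n / 2 : ℝ) (K m) := fun m =>
    strichartzKernel_cutoffKernel n (by simp) (hδ m) (measurable_timeCut _ _) (cut_le _) (cut_zero _)
  have mO : ∀ m, Measurable (kernelOp volume (K m) (goodPart I f m)) := fun m =>
    measurable_kernelOp (hK m).meas (measurable_goodPart mI mf m)
  refine (timeNorm_le_outNorm hp.exponent_nonneg mI (M := I.indicator fun t =>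
    lor volume p fun x => ‖duhamel n t₀ f t x‖ₑ) fun t ht => (indicator_of_mem ht _).ge).trans ?_
  refine outNorm_le_of_le_liminf hp.exponent_nonneg
    (fun m => BoxNice.measurable_lor (μ := volume) (mO m) p) (ae_of_all _ fun t => ?_) fun m => ?_
  · by_cases ht : t ∈ I
    · rw [indicator_of_mem ht]
      exact lor_le_liminf p
        (fun m => ((mO m).comp (by fun_prop : Measurable fun x => (t, x))).enorm) fun x =>
        enorm_duhamel_le_liminf hI ht₀ ht mf x fun m => (hK m).bdd
    · rw [indicator_of_notMem ht]
      exact bot_le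
  · refine (outNorm_kernelOp_le_of_integrable (fun R => measure_closedBall_lt_top) (hK m).meas
      (hK m).bdd hp.exponent_nonneg hβ (h _ _ (hδ m) (measurable_timeCut _ _) (cut_le _) (cut_zero _))
      (measurable_goodPart mI mf m) (integrable_goodPart mI mf m)).trans
      (mul_le_mul_right ((inNorm_mono hβ (ae_of_all _ fun t => ?_)).trans
        (inNorm_indicator_le_timeNorm hr.exponent_nonneg hβ mI _)) _)
    by_cases ht : t ∈ goodTimes I f m
    · rw [indicator_of_mem ht.1]
      simp_rw [goodPart_of_mem ht]
      exact le_rfl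
    · simp_rw [goodPart_of_notMem ht, enorm_zero, lor_zero]
      exact bot_le
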